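/- Let Ω ⊂ ℝ² be a compact convex region of unit area with nonempty interior whose frontier ∂Ω has length ℓ, k ≥ 1 an integer, c > 0 a constant, and r_n = √((log n + (2k−1)·log log n + ξ)/(π·n)), where ξ = −2·log(√(e^{−c} + π·ℓ²/64) − ℓ·√π/8) if k = 1, and ξ = 2·log(ℓ·√π/(2^{k+1}·k!)) + 2c if k > 1. Then the probability that in the random geometric graph G(χ_n, r_n) every vertex has degree at least k+1 (equivalently, that ρ(χ_n; δ ≥ k+1) ≤ r_n) converges to exp(−e^{−c}) as n → ∞. -/

import Mathlib

open MeasureTheory Metric Real Filter Topology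
open scoped ENNReal

section IndependentSamples

variable {F : Type*} [MeasurableSpace F]

/-- The law of `m` independent points with common law `ρ`. -/
noncomputable abbrev iidLaw (ρ : Measure F) (m : ℕ) : Measure (Fin m → F) :=
  Measure.pi fun _ => ρ

/-- The number of points of the sample `W` lying in `U`. -/
noncomputable def hits {m : ℕ} (U : Set F) (W : Fin m → F) : ℕ :=
  ∑ i, U.indicator (fun _ => 1) (W i)

omit [MeasurableSpace F] in
lemma hits_insertNth {m : ℕ} (U : Set F) (i : Fin (m + 1)) (x : F) (W : Fin m → F) :
    hits U (i.insertNth x W) = U.indicator (fun _ => 1) x + hits U W := by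
  simp [hits, Fin.sum_univ_succAbove _ i]

lemma lintegral_iidLaw_succ (ρ : Measure F) [SigmaFinite ρ] {m : ℕ} (i : Fin (m + 1))
    {f : (Fin (m + 1) → F) → ℝ≥0∞} (hf : Measurable f) :
    ∫⁻ W, f W ∂iidLaw ρ (m + 1) = ∫⁻ x, ∫⁻ W, f (i.insertNth x W) ∂iidLaw ρ m ∂ρ := by
  have h := (measurePreserving_piFinSuccAbove (fun _ : Fin (m + 1) => ρ) i).symm
  rw [← h.lintegral_comp hf, lintegral_prod]
  · rfl
  · exact (hf.comp (MeasurableEquiv.measurable _)).aemeasurable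

lemma measurable_insertNth {m : ℕ} (i : Fin (m + 1)) :
    Measurable fun p : F × (Fin m → F) => (i.insertNth p.1 p.2 : Fin (m + 1) → F) :=
  (MeasurableEquiv.piFinSuccAbove (fun _ : Fin (m + 1) => F) i).symm.measurable

lemma iidLaw_succ_apply (ρ : Measure F) [SigmaFinite ρ] {m : ℕ} (i : Fin (m + 1))
    {A : Set (Fin (m + 1) → F)} (hA : MeasurableSet A) :
    iidLaw ρ (m + 1) A = ∫⁻ x, iidLaw ρ m {W | i.insertNth x W ∈ A} ∂ρ := by
  rw [← lintegral_indicator_one hA,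
    lintegral_iidLaw_succ ρ i (measurable_one.indicator hA)]
  refine lintegral_congr fun x => ?_
  rw [← lintegral_indicator_one]
  · rfl
  · exact (measurable_insertNth i).comp measurable_prodMk_left hA

lemma lintegral_prod_iidLaw (ρ : Measure F) [IsProbabilityMeasure ρ] (m : ℕ)
    {f : F → ℝ≥0∞} (hf : Measurable f) :
    ∫⁻ W, ∏ i, f (W i) ∂iidLaw ρ m = (∫⁻ x, f x ∂ρ) ^ m := by
  induction m with
  | zero => simp
  | succ m ih =>
    rw [lintegral_iidLaw_succ ρ 0 (by fun_prop)]
    have hm : Measurable fun W : Fin m → F => ∏ i, f (W i) := by fun_prop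
    have : ∀ x (W : Fin m → F), ∏ i, f ((0 : Fin (m + 1)).insertNth x W i : F) =
        f x * ∏ i, f (W i) := fun x W => by
      rw [Fin.prod_univ_succAbove _ 0, Fin.insertNth_apply_same]
      simp only [Fin.insertNth_apply_succAbove]
    simp_rw [this, lintegral_const_mul _ hm, ih]
    rw [lintegral_mul_const _ hf, pow_succ, mul_comm]

open Classical in
omit [MeasurableSpace F] in
lemma one_le_mul_prod_of_hits_le {m k : ℕ} {U : Set F} {W : Fin m → F} {s : ℝ} (hs : 0 < s)
    (hs1 : s ≤ 1) (h : hits U W ≤ k) :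
    1 ≤ (s ^ k)⁻¹ * ∏ i, (if W i ∈ U then s else 1) := by
  have : ∏ i, (if W i ∈ U then s else 1) = s ^ hits U W := by
    rw [hits, ← Finset.prod_pow_eq_pow_sum]
    refine Finset.prod_congr rfl fun i _ => ?_
    by_cases hi : W i ∈ U <;> simp [hi]
  rw [this, inv_mul_eq_div, le_div_iff₀ (by positivity), one_mul]
  exact pow_le_pow_of_le_one hs.le hs1 h

open Classical in
lemma integral_ite_mul_ite_le (ρ : Measure F) [IsProbabilityMeasure ρ] {U V : Set F}
    (hU : MeasurableSet U) (hV : MeasurableSet V) (hUV : ρ.real (U ∩ V) ≤ ρ.real U * ρ.real V)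
    {s t : ℝ} (hs0 : 0 ≤ s) (ht0 : 0 ≤ t) (hs1 : s ≤ 1) (ht1 : t ≤ 1) :
    ∫ z, (if z ∈ U then s else 1) * (if z ∈ V then t else 1) ∂ρ ≤
      exp (-((1 - s) * ρ.real U) - (1 - t) * ρ.real V) := by
  have hrw : (fun z => (if z ∈ U then s else 1) * (if z ∈ V then t else 1)) = fun z =>
      1 - (1 - s) * U.indicator 1 z - (1 - t) * V.indicator 1 z +
        (1 - s) * (1 - t) * (U ∩ V).indicator 1 z := by
    funext z
    by_cases h1 : z ∈ U <;> by_cases h2 : z ∈ V <;> simp [h1, h2] <;> ring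
  have hi : ∀ A : Set F, MeasurableSet A → Integrable (A.indicator (1 : F → ℝ)) ρ := fun A hA =>
    (integrable_const (1 : ℝ)).indicator hA
  rw [hrw, integral_add, integral_sub, integral_sub, integral_const_mul, integral_const_mul,
    integral_const_mul, integral_indicator_one hU, integral_indicator_one hV,
    integral_indicator_one (hU.inter hV)]
  · simp only [integral_const, probReal_univ, smul_eq_mul, mul_one]
    have h1 : 1 - (1 - s) * ρ.real U ≤ exp (-((1 - s) * ρ.real U)) := by
      have := add_one_le_exp (-((1 - s) * ρ.real U)); linarith
    have h2 : 1 - (1 - t) * ρ.real V ≤ exp (-((1 - t) * ρ.real V)) := by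
      have := add_one_le_exp (-((1 - t) * ρ.real V)); linarith
    have hU1 : ρ.real U ≤ 1 := measureReal_le_one
    have hV1 : ρ.real V ≤ 1 := measureReal_le_one
    have hst : 0 ≤ (1 - s) * (1 - t) := mul_nonneg (by linarith) (by linarith)
    have ha : (1 - s) * ρ.real U ≤ 1 := by nlinarith [measureReal_nonneg (μ := ρ) (s := U)]
    have hb : (1 - t) * ρ.real V ≤ 1 := by nlinarith [measureReal_nonneg (μ := ρ) (s := V)]
    calc _ ≤ (1 - (1 - s) * ρ.real U) * (1 - (1 - t) * ρ.real V) := by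
          nlinarith [mul_le_mul_of_nonneg_left hUV hst]
      _ ≤ _ := by
          rw [sub_eq_add_neg (-_), exp_add]
          gcongr
  · exact integrable_const _
  · exact (hi U hU).const_mul _
  · exact (integrable_const _).sub ((hi U hU).const_mul _)
  · exact (hi V hV).const_mul _
  · exact ((integrable_const _).sub ((hi U hU).const_mul _)).sub ((hi V hV).const_mul _)
  · exact (hi _ (hU.inter hV)).const_mul _

open Classical in
lemma iidLaw_hits_le_hits_le (ρ : Measure F) [IsProbabilityMeasure ρ] {U V : Set F}
    (hU : MeasurableSet U) (hV : MeasurableSet V) (hUV : ρ.real (U ∩ V) ≤ ρ.real U * ρ.real V)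
    {s t : ℝ} (hs0 : 0 < s) (ht0 : 0 < t) (hs1 : s ≤ 1) (ht1 : t ≤ 1) (m k : ℕ) :
    iidLaw ρ m {W | hits U W ≤ k ∧ hits V W ≤ k} ≤
      ENNReal.ofReal ((s ^ k)⁻¹ * exp (-(m * (1 - s) * ρ.real U)) *
        ((t ^ k)⁻¹ * exp (-(m * (1 - t) * ρ.real V)))) := by
  set φ : F → ℝ := fun z => (if z ∈ U then s else 1) * (if z ∈ V then t else 1) with hφ
  have hφm : Measurable φ :=
    (Measurable.ite hU measurable_const measurable_const).mul
      (Measurable.ite hV measurable_const measurable_const)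
  have hφ0 : ∀ z, 0 ≤ φ z := fun z => by simp only [hφ]; split_ifs <;> positivity
  have hφ1 : ∀ z, φ z ≤ 1 := fun z => by
    simp only [hφ]; split_ifs <;> nlinarith
  have hprod : Measurable fun W : Fin m → F => ∏ i, ENNReal.ofReal (φ (W i)) :=
    Finset.measurable_prod _ fun i _ => (hφm.comp (measurable_pi_apply i)).ennreal_ofReal
  calc iidLaw ρ m {W | hits U W ≤ k ∧ hits V W ≤ k}
      ≤ ∫⁻ W, ENNReal.ofReal ((s ^ k)⁻¹ * (t ^ k)⁻¹) * ∏ i, ENNReal.ofReal (φ (W i))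
          ∂iidLaw ρ m := by
        refine (measure_mono fun W hW => ?_).trans (meas_ge_le_lintegral_div (ε := 1) ?_
          one_ne_zero ENNReal.one_ne_top |>.trans_eq (by rw [div_one]))
        · have h1 := one_le_mul_prod_of_hits_le hs0 hs1 hW.1
          have h2 := one_le_mul_prod_of_hits_le ht0 ht1 hW.2
          rw [Set.mem_ofPred_eq, ← ENNReal.ofReal_prod_of_nonneg fun i _ => hφ0 _,
            ← ENNReal.ofReal_mul (by positivity), ENNReal.one_le_ofReal]
          simp only [hφ, Finset.prod_mul_distrib]
          nlinarith
        · exact (measurable_const.mul hprod).aemeasurable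
    _ = ENNReal.ofReal ((s ^ k)⁻¹ * (t ^ k)⁻¹ * (∫ z, φ z ∂ρ) ^ m) := by
        rw [lintegral_const_mul _ hprod,
          lintegral_prod_iidLaw ρ m (f := fun z => ENNReal.ofReal (φ z)) hφm.ennreal_ofReal,
          ENNReal.ofReal_mul (p := (s ^ k)⁻¹ * (t ^ k)⁻¹) (by positivity),
          ENNReal.ofReal_pow (integral_nonneg hφ0),
          ofReal_integral_eq_lintegral_ofReal _ (ae_of_all _ hφ0)]
        refine Integrable.of_bound (C := 1) hφm.aestronglyMeasurable (ae_of_all _ fun z => ?_)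
        rw [Real.norm_of_nonneg (hφ0 z)]
        exact hφ1 z
    _ ≤ _ := by
        apply ENNReal.ofReal_le_ofReal
        have h := pow_le_pow_left₀ (integral_nonneg hφ0)
          (integral_ite_mul_ite_le ρ hU hV hUV hs0.le ht0.le hs1 ht1) m
        rw [← exp_nat_mul] at h
        have h2 : (m : ℝ) * (-((1 - s) * ρ.real U) - (1 - t) * ρ.real V) =
          -(m * (1 - s) * ρ.real U) + -(m * (1 - t) * ρ.real V) := by ring
        rw [h2, exp_add] at h
        calc _ ≤ (s ^ k)⁻¹ * (t ^ k)⁻¹ * _ := mul_le_mul_of_nonneg_left h (by positivity)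
          _ = _ := by ring

end IndependentSamples

section LowDegree

variable {F : Type*} [PseudoMetricSpace F]

/-- The number of sample points having at most `k + 1` sample points, themselves included, within
distance `r`. -/
noncomputable def lowCount (r : ℝ) (k : ℕ) {m : ℕ} (X : Fin m → F) : ℕ :=
  ∑ l, if hits (closedBall (X l) r) X ≤ k + 1 then 1 else 0

/-- The number of points of `X` of low degree after adding the point `x` to the sample. -/
noncomputable def lowCountAdd (r : ℝ) (k : ℕ) (x : F) {m : ℕ} (X : Fin m → F) : ℕ :=
  ∑ l, if (closedBall (X l) r).indicator (fun _ => 1) x + hits (closedBall (X l) r) X ≤ k + 1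
    then 1 else 0

/-- The number of low degree points of `X` at distance more than `2 * r` from `x`. -/
noncomputable def lowCountFar (r : ℝ) (k : ℕ) (x : F) {m : ℕ} (X : Fin m → F) : ℕ :=
  ∑ l, if 2 * r < dist (X l) x ∧ hits (closedBall (X l) r) X ≤ k + 1 then 1 else 0

lemma hits_closedBall_insertNth_self_le {r : ℝ} (hr : 0 ≤ r) {m k : ℕ} (i : Fin (m + 1)) (x : F)
    (X : Fin m → F) :
    hits (closedBall x r) (i.insertNth x X : Fin (m + 1) → F) ≤ k + 1 ↔
      hits (closedBall x r) X ≤ k := by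
  rw [hits_insertNth, Set.indicator_of_mem (mem_closedBall_self hr)]
  omega

lemma lowCount_insertNth {r : ℝ} (hr : 0 ≤ r) {m k : ℕ} (i : Fin (m + 1)) (x : F)
    (X : Fin m → F) :
    lowCount r k (i.insertNth x X : Fin (m + 1) → F) =
      (if hits (closedBall x r) X ≤ k then 1 else 0) + lowCountAdd r k x X := by
  simp only [lowCount, lowCountAdd, Fin.sum_univ_succAbove _ i, Fin.insertNth_apply_same,
    Fin.insertNth_apply_succAbove, hits_closedBall_insertNth_self_le hr]
  simp only [hits_insertNth]

lemma lowCountAdd_eq_lowCountFar {r : ℝ} (hr : 0 ≤ r) {m k : ℕ} {x : F} {X : Fin m → F}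
    (h : ∀ l, dist (X l) x ≤ 2 * r → ¬ hits (closedBall (X l) r) X ≤ k + 1) :
    lowCountAdd r k x X = lowCountFar r k x X := by
  refine Finset.sum_congr rfl fun l _ => if_congr ?_ rfl rfl
  rcases le_or_gt (dist (X l) x) (2 * r) with hl | hl
  · have := h l hl
    constructor
    · intro h'; omega
    · intro h'; exact absurd h'.2 this
  · rw [Set.indicator_of_notMem, zero_add]
    · simp [hl]
    · rw [mem_closedBall, dist_comm]; linarith

lemma lowCount_eq_lowCountFar {r : ℝ} {m k : ℕ} {x : F} {X : Fin m → F}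
    (h : ∀ l, dist (X l) x ≤ 2 * r → ¬ hits (closedBall (X l) r) X ≤ k + 1) :
    lowCount r k X = lowCountFar r k x X := by
  refine Finset.sum_congr rfl fun l _ => if_congr ?_ rfl rfl
  rcases le_or_gt (dist (X l) x) (2 * r) with hl | hl
  · have := h l hl
    simp [this]
  · simp [hl]

lemma lowCountAdd_eq_lowCount {r : ℝ} {m k : ℕ} {x : F} {X : Fin m → F}
    (h : ∀ l, dist (X l) x ≤ r → ¬ hits (closedBall (X l) r) X ≤ k + 1) :
    lowCountAdd r k x X = lowCount r k X := by
  refine Finset.sum_congr rfl fun l _ => if_congr ?_ rfl rfl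
  rcases le_or_gt (dist (X l) x) r with hl | hl
  · have := h l hl
    constructor <;> intro h' <;> omega
  · rw [Set.indicator_of_notMem, zero_add]
    rw [mem_closedBall, dist_comm]; linarith

variable [MeasurableSpace F]

omit [PseudoMetricSpace F] [MeasurableSpace F] in
lemma measurable_hits {α : Type*} [MeasurableSpace α] {m : ℕ} {G : α → Set F}
    {g : α → Fin m → F} (h : ∀ i, MeasurableSet {a | g a i ∈ G a}) :
    Measurable fun a => hits (G a) (g a) := by
  unfold hits
  refine Finset.measurable_sum _ fun i _ => ?_
  classical
  have : (fun a => (G a).indicator (fun _ => 1) (g a i)) =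
      fun a => if g a i ∈ G a then (1 : ℕ) else 0 := by
    funext a
    rw [Set.indicator_apply]
  rw [this]
  exact Measurable.ite (h i) measurable_const measurable_const

variable [OpensMeasurableSpace F] [SecondCountableTopology F]

lemma measurable_hits_closedBall {α : Type*} [MeasurableSpace α] {m : ℕ} {y : α → F}
    {g : α → Fin m → F} (hy : Measurable y) (hg : ∀ i, Measurable fun a => g a i) (r : ℝ) :
    Measurable fun a => hits (closedBall (y a) r) (g a) :=
  measurable_hits fun i => by
    simp only [mem_closedBall]
    exact measurableSet_le ((hg i).dist hy) measurable_const

lemma measurableSet_hits_closedBall {α : Type*} [MeasurableSpace α] {m : ℕ} {y : α → F}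
    {g : α → Fin m → F} (hy : Measurable y) (hg : ∀ i, Measurable fun a => g a i) (r : ℝ) (k : ℕ) :
    MeasurableSet {a | hits (closedBall (y a) r) (g a) ≤ k} :=
  measurableSet_le (measurable_hits_closedBall hy hg r) measurable_const

lemma measurable_lowCount (r : ℝ) (k m : ℕ) :
    Measurable (lowCount r k : (Fin m → F) → ℕ) :=
  Finset.measurable_sum _ fun l _ => Measurable.ite
    (measurableSet_hits_closedBall (measurable_pi_apply l) measurable_pi_apply r _)
    measurable_const measurable_const

lemma measurable_lowCountFar (r : ℝ) (k m : ℕ) :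
    Measurable fun p : F × (Fin m → F) => lowCountFar r k p.1 p.2 := by
  refine Finset.measurable_sum _ fun l _ => Measurable.ite (MeasurableSet.inter ?_ ?_)
    measurable_const measurable_const
  · exact measurableSet_lt measurable_const (Measurable.dist (by fun_prop) measurable_fst)
  · exact measurableSet_hits_closedBall (y := fun p : F × (Fin m → F) => p.2 l)
      (g := fun p => p.2) (by fun_prop) (fun i => by fun_prop) r _

/-- The Palm formula for the number of low degree points. -/
lemma succ_mul_iidLaw_lowCount_eq (ρ : Measure F) [IsProbabilityMeasure ρ] {r : ℝ} (hr : 0 ≤ r)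
    (k m j : ℕ) :
    (j + 1 : ℝ≥0∞) * iidLaw ρ (m + 1) {X | lowCount r k X = j + 1} =
      (m + 1) * ∫⁻ x,
        iidLaw ρ m {X | hits (closedBall x r) X ≤ k ∧ lowCountAdd r k x X = j} ∂ρ := by
  have hN : MeasurableSet {X : Fin (m + 1) → F | lowCount r k X = j + 1} :=
    measurable_lowCount r k _ (measurableSet_singleton _)
  have hlow : ∀ i, MeasurableSet {X : Fin (m + 1) → F | hits (closedBall (X i) r) X ≤ k + 1} :=
    fun i => measurableSet_hits_closedBall (measurable_pi_apply i) measurable_pi_apply r _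
  have hS : ∀ i : Fin (m + 1), iidLaw ρ (m + 1)
      ({X | hits (closedBall (X i) r) X ≤ k + 1} ∩ {X | lowCount r k X = j + 1}) =
      ∫⁻ x, iidLaw ρ m {X | hits (closedBall x r) X ≤ k ∧ lowCountAdd r k x X = j} ∂ρ := by
    intro i
    rw [iidLaw_succ_apply ρ i ((hlow i).inter hN)]
    refine lintegral_congr fun x => congrArg _ ?_
    ext X
    simp only [Set.mem_inter_iff, Set.mem_ofPred_eq, Fin.insertNth_apply_same,
      hits_closedBall_insertNth_self_le hr, lowCount_insertNth hr]
    refine and_congr_right fun h => ?_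
    rw [if_pos h]
    omega
  calc _ = ∫⁻ X, ∑ i, ({X | hits (closedBall (X i) r) X ≤ k + 1} ∩
        {X | lowCount r k X = j + 1}).indicator 1 X ∂iidLaw ρ (m + 1) := by
        rw [← lintegral_indicator_one hN, ← lintegral_const_mul _ (measurable_one.indicator hN)]
        refine lintegral_congr fun X => ?_
        by_cases hX : lowCount r k X = j + 1
        · have h1 : ∀ i, ({X | hits (closedBall (X i) r) X ≤ k + 1} ∩
              {X | lowCount r k X = j + 1}).indicator (1 : (Fin (m + 1) → F) → ℝ≥0∞) X =
              ((if hits (closedBall (X i) r) X ≤ k + 1 then 1 else 0 : ℕ) : ℝ≥0∞) := fun i => by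
            by_cases hi : hits (closedBall (X i) r) X ≤ k + 1 <;> simp [hi, hX]
          simp only [h1]
          rw [← Nat.cast_sum, ← lowCount, hX]
          simp [hX]
        · simp [hX]
    _ = _ := by
        rw [lintegral_finsetSum _ fun i _ => measurable_one.indicator ((hlow i).inter hN)]
        simp_rw [lintegral_indicator_one ((hlow _).inter hN), hS]
        simp

end LowDegree

section Near

/-- Two extended nonnegative reals differ by at most `e`. -/
def ENear (a b e : ℝ≥0∞) : Prop :=
  a ≤ b + e ∧ b ≤ a + e

lemma ENear.trans {a b c d e : ℝ≥0∞} (h : ENear a b d) (h' : ENear b c e) :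
    ENear a c (d + e) := by
  constructor
  · exact h.1.trans ((add_le_add_left h'.1 d).trans_eq (by ring))
  · exact h'.2.trans ((add_le_add_left h.2 e).trans_eq (by ring))

lemma ENear.mono {a b d e : ℝ≥0∞} (h : ENear a b d) (hde : d ≤ e) : ENear a b e :=
  ⟨h.1.trans (by gcongr), h.2.trans (by gcongr)⟩

lemma ENear.mul_left {a b e : ℝ≥0∞} (h : ENear a b e) (c : ℝ≥0∞) :
    ENear (c * a) (c * b) (c * e) :=
  ⟨(mul_le_mul_right h.1 c).trans_eq (mul_add _ _ _),
    (mul_le_mul_right h.2 c).trans_eq (mul_add _ _ _)⟩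

lemma ENear.measure {α : Type*} [MeasurableSpace α] (μ : Measure α) {A B C : Set α}
    (h : A ⊆ B ∪ C) (h' : B ⊆ A ∪ C) : ENear (μ A) (μ B) (μ C) :=
  ⟨(measure_mono h).trans (measure_union_le _ _), (measure_mono h').trans (measure_union_le _ _)⟩

lemma ENear.lintegral {α : Type*} [MeasurableSpace α] {μ : Measure α} {f g e : α → ℝ≥0∞}
    (he : Measurable e) (h : ∀ x, ENear (f x) (g x) (e x)) :
    ENear (∫⁻ x, f x ∂μ) (∫⁻ x, g x ∂μ) (∫⁻ x, e x ∂μ) := by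
  constructor <;> rw [← lintegral_add_right _ he]
  · exact lintegral_mono fun x => (h x).1
  · exact lintegral_mono fun x => (h x).2

lemma ENear.abs_toReal_sub_le {a b e : ℝ≥0∞} (h : ENear a b e) (ha : a ≠ ∞) (hb : b ≠ ∞)
    (he : e ≠ ∞) : |a.toReal - b.toReal| ≤ e.toReal := by
  have h1 := ENNReal.toReal_mono (by finiteness) h.1
  have h2 := ENNReal.toReal_mono (by finiteness) h.2
  rw [ENNReal.toReal_add (by finiteness) (by finiteness)] at h1 h2
  rw [abs_le]
  constructor <;> linarith

end Near

section Swap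

variable {F : Type*} [MeasurableSpace F]

lemma iidLaw_exists_le (ρ : Measure F) [SigmaFinite ρ] {m : ℕ}
    {A : Fin (m + 1) → Set (Fin (m + 1) → F)} (hA : ∀ l, MeasurableSet (A l)) {c : F → ℝ≥0∞}
    (h : ∀ l x, iidLaw ρ m {W | l.insertNth x W ∈ A l} ≤ c x) :
    iidLaw ρ (m + 1) {W | ∃ l, W ∈ A l} ≤ (m + 1) * ∫⁻ x, c x ∂ρ := by
  calc _ = iidLaw ρ (m + 1) (⋃ l, A l) := by congr 1; ext; simp
    _ ≤ ∑ l, iidLaw ρ (m + 1) (A l) := measure_iUnion_fintype_le _ _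
    _ ≤ ∑ l : Fin (m + 1), ∫⁻ x, c x ∂ρ := by
        gcongr with l
        rw [iidLaw_succ_apply ρ l (hA l)]
        exact lintegral_mono fun x => h l x
    _ = _ := by simp

open Classical in
/-- Exchange the coordinates of a pair as soon as one of them lies in `A`. -/
noncomputable def swapOn (A : Set F) (z : F × F) : F × F :=
  if z.1 ∈ A ∨ z.2 ∈ A then z.swap else z

omit [MeasurableSpace F] in
lemma swapOn_swapOn (A : Set F) (z : F × F) : swapOn A (swapOn A z) = z := by
  by_cases h : z.1 ∈ A ∨ z.2 ∈ A
  · have h' : z.swap.1 ∈ A ∨ z.swap.2 ∈ A := h.symm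
    rw [show swapOn A z = z.swap from if_pos h, show swapOn A z.swap = z.swap.swap from if_pos h',
      Prod.swap_swap]
  · rw [show swapOn A z = z from if_neg h, show swapOn A z = z from if_neg h]

omit [MeasurableSpace F] in
lemma swapOn_snd_mem (A : Set F) (z : F × F) : (swapOn A z).2 ∈ A ↔ z.1 ∈ A := by
  unfold swapOn
  split_ifs with h
  · rfl
  · push Not at h
    simp [h]

lemma measurePreserving_swapOn (μ : Measure F) [SFinite μ] {A : Set F} (hA : MeasurableSet A) :
    MeasurePreserving (swapOn A) (μ.prod μ) (μ.prod μ) := by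
  classical
  set C : Set (F × F) := {z | z.1 ∈ A ∨ z.2 ∈ A} with hC
  have hCm : MeasurableSet C := (measurable_fst hA).union (measurable_snd hA)
  have hm : Measurable (swapOn A) := Measurable.ite hCm measurable_swap measurable_id
  refine ⟨hm, Measure.ext fun S hS => ?_⟩
  rw [Measure.map_apply hm hS, ← measure_inter_add_sdiff _ hCm, ← measure_inter_add_sdiff S hCm]
  congr 1
  · rw [← (Measure.measurePreserving_swap (μ := μ) (ν := μ)).measure_preimage
      (hS.inter hCm).nullMeasurableSet]
    congr 1
    ext z
    simp only [hC, Set.mem_inter_iff, Set.mem_preimage, Set.mem_ofPred_eq, Prod.fst_swap,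
      Prod.snd_swap, or_comm (a := z.2 ∈ A)]
    refine and_congr_left fun h => ?_
    rw [show swapOn A z = z.swap from if_pos h]
  · congr 1
    ext z
    simp only [Set.mem_sdiff, Set.mem_preimage]
    refine and_congr_left fun h => ?_
    rw [show swapOn A z = z from if_neg h]

end Swap

section Independence

lemma exists_ne_of_sum_univ_ne {ι : Type*} [Fintype ι] {f g : ι → ℕ}
    (h : ∑ i, f i ≠ ∑ i, g i) : ∃ i, f i ≠ g i := by
  by_contra! hn
  exact h (Finset.sum_congr rfl fun i _ => hn i)

variable {F : Type*} [PseudoMetricSpace F]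

lemma exists_of_hits_swapOn_lt {m : ℕ} {r : ℝ} {x y : F} {W : Fin m → F × F} {l : Fin m}
    (hxy : Disjoint (closedBall x r) (closedBall y r)) (hl : (W l).1 ∉ closedBall x r)
    (hl' : (W l).2 ∉ closedBall x r)
    (h : hits (closedBall y r) (fun i => (W i).1) ≠
      hits (closedBall y r) fun i => (swapOn (closedBall x r) (W i)).1) :
    ∃ i, i ≠ l ∧ ((W i).1 ∈ closedBall x r ∧ (W i).2 ∈ closedBall y r ∨
      (W i).1 ∈ closedBall y r ∧ (W i).2 ∈ closedBall x r) := by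
  obtain ⟨i, hi⟩ := exists_ne_of_sum_univ_ne h
  beta_reduce at hi
  have hsw : (W i).1 ∈ closedBall x r ∨ (W i).2 ∈ closedBall x r := by
    by_contra hn
    exact hi (by rw [show swapOn (closedBall x r) (W i) = W i from if_neg hn])
  rw [show swapOn (closedBall x r) (W i) = (W i).swap from if_pos hsw, Prod.fst_swap] at hi
  refine ⟨i, ?_, ?_⟩
  · rintro rfl
    exact hsw.elim hl hl'
  · by_cases h1 : (W i).1 ∈ closedBall y r
    · exact .inr ⟨h1, hsw.resolve_left (Set.disjoint_right.1 hxy h1)⟩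
    · by_cases h2 : (W i).2 ∈ closedBall y r
      · exact .inl ⟨hsw.resolve_right (Set.disjoint_right.1 hxy h2), h2⟩
      · simp [h1, h2] at hi

lemma disjoint_closedBall_of_two_mul_lt {r : ℝ} {x y : F} (h : 2 * r < dist y x) :
    Disjoint (closedBall x r) (closedBall y r) := by
  rw [Set.disjoint_left]
  intro z hz hz'
  rw [mem_closedBall] at hz hz'
  have := dist_triangle_left y x z
  linarith

/-- The configurations of pairs where a point far from `x` may change status when the sample is
modified inside the ball around `x`. -/
def swapSensitive (r : ℝ) (k : ℕ) (x : F) {m : ℕ} (l : Fin m) : Set (Fin m → F × F) :=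
  {W | 2 * r < dist (W l).1 x ∧ hits (Prod.fst ⁻¹' closedBall (W l).1 r) W ≤ k + 1 ∧
    ((W l).2 ∈ closedBall x r ∨ ∃ i, i ≠ l ∧
      ((W i).1 ∈ closedBall x r ∧ (W i).2 ∈ closedBall (W l).1 r ∨
        (W i).1 ∈ closedBall (W l).1 r ∧ (W i).2 ∈ closedBall x r))}

lemma mem_swapSensitive {r : ℝ} (hr : 0 ≤ r) {k : ℕ} {x : F} {m : ℕ} {l : Fin m}
    {W : Fin m → F × F}
    (h : 2 * r < dist (W l).1 x ∧ hits (closedBall (W l).1 r) (fun i => (W i).1) ≤ k + 1)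
    (h' : ¬ (2 * r < dist (swapOn (closedBall x r) (W l)).1 x ∧
      hits (closedBall (swapOn (closedBall x r) (W l)).1 r)
        (fun i => (swapOn (closedBall x r) (W i)).1) ≤ k + 1)) :
    W ∈ swapSensitive r k x l := by
  refine ⟨h.1, h.2, or_iff_not_imp_left.2 fun hl' => ?_⟩
  have hl : (W l).1 ∉ closedBall x r := by
    rw [mem_closedBall]; linarith [h.1]
  have hs : swapOn (closedBall x r) (W l) = W l := if_neg (by simp only [hl, hl', or_self,
    not_false_eq_true])
  rw [hs] at h'
  refine exists_of_hits_swapOn_lt (disjoint_closedBall_of_two_mul_lt h.1) hl hl' fun heq => h' ?_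
  exact ⟨h.1, heq ▸ h.2⟩

lemma mem_swapSensitive_of_lowCountFar_ne {r : ℝ} (hr : 0 ≤ r) {k : ℕ} {x : F} {m : ℕ}
    {W : Fin m → F × F}
    (h : lowCountFar r k x (fun i => (W i).1) ≠
      lowCountFar r k x fun i => (swapOn (closedBall x r) (W i)).1) :
    (∃ l, W ∈ swapSensitive r k x l) ∨
      ∃ l, (fun i => swapOn (closedBall x r) (W i)) ∈ swapSensitive r k x l := by
  obtain ⟨l, hl⟩ := exists_ne_of_sum_univ_ne h
  by_cases h1 : 2 * r < dist (W l).1 x ∧ hits (closedBall (W l).1 r) (fun i => (W i).1) ≤ k + 1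
  · refine .inl ⟨l, mem_swapSensitive hr h1 fun h2 => hl ?_⟩
    rw [if_pos h1, if_pos h2]
  · by_cases h2 : 2 * r < dist (swapOn (closedBall x r) (W l)).1 x ∧
      hits (closedBall (swapOn (closedBall x r) (W l)).1 r)
        (fun i => (swapOn (closedBall x r) (W i)).1) ≤ k + 1
    · refine .inr ⟨l, mem_swapSensitive hr h2 ?_⟩
      simpa only [swapOn_swapOn] using h1
    · exact absurd (by rw [if_neg h1, if_neg h2]) hl

end Independence

section LowBound

variable {F : Type*} [PseudoMetricSpace F] [MeasurableSpace F]

/-- A Chernoff bound for the probability that at most `k` among `M` sample points fall in the ball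
of radius `r` around `x`. -/
noncomputable def lowBound (μ : Measure F) (r s : ℝ) (k M : ℕ) (x : F) : ℝ≥0∞ :=
  ENNReal.ofReal ((s ^ k)⁻¹ * exp (-(M * (1 - s) * μ.real (closedBall x r))))

lemma iidLaw_hits_le_hits_le_lowBound {μ : Measure F} {G : Type*} [MeasurableSpace G]
    (ρ : Measure G)
    [IsProbabilityMeasure ρ] {U V : Set G} (hU : MeasurableSet U) (hV : MeasurableSet V) {x y : F}
      {r : ℝ}
    (hUx : ρ U = μ (closedBall x r)) (hVy : ρ V = μ (closedBall y r))
    (hUV : ρ (U ∩ V) ≤ ρ U * ρ V) {s : ℝ} (hs : 0 < s) (hs1 : s ≤ 1) (k : ℕ) {M m : ℕ}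
    (hm : M ≤ m) :
    iidLaw ρ m {W | hits U W ≤ k ∧ hits V W ≤ k} ≤
      lowBound μ r s k M x * lowBound μ r s k M y := by
  have hr : ρ.real (U ∩ V) ≤ ρ.real U * ρ.real V := by
    rw [measureReal_def, measureReal_def, measureReal_def, ← ENNReal.toReal_mul]
    exact ENNReal.toReal_mono (by finiteness) hUV
  refine (iidLaw_hits_le_hits_le ρ hU hV hr hs hs hs1 hs1 m k).trans ?_
  rw [lowBound, lowBound, ← ENNReal.ofReal_mul (by positivity)]
  have h1 : ρ.real U = μ.real (closedBall x r) := by rw [measureReal_def, hUx, measureReal_def]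
  have h2 : ρ.real V = μ.real (closedBall y r) := by rw [measureReal_def, hVy, measureReal_def]
  rw [h1, h2]
  have hs' : 0 ≤ 1 - s := by linarith
  gcongr

lemma iidLaw_hits_le_lowBound {μ : Measure F} {G : Type*} [MeasurableSpace G] (ρ : Measure G)
    [IsProbabilityMeasure ρ] {U : Set G} (hU : MeasurableSet U) {x : F} {r : ℝ}
      (hUx : ρ U = μ (closedBall x r))
    {s : ℝ} (hs : 0 < s) (hs1 : s ≤ 1) (k : ℕ) {M m : ℕ} (hm : M ≤ m) :
    iidLaw ρ m {W | hits U W ≤ k} ≤ lowBound μ r s k M x := by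
  have h := iidLaw_hits_le_hits_le ρ hU MeasurableSet.empty (by simp) hs one_pos hs1 le_rfl m k
  have h0 : ∀ W : Fin m → G, hits ∅ W = 0 := fun W => by simp [hits]
  simp only [h0, zero_le, and_true] at h
  refine h.trans ?_
  have h1 : ρ.real U = μ.real (closedBall x r) := by rw [measureReal_def, hUx, measureReal_def]
  rw [lowBound, h1]
  have hs' : 0 ≤ 1 - s := by linarith
  simp only [one_pow, inv_one, sub_self, mul_zero, zero_mul, neg_zero, exp_zero, mul_one]
  gcongr

variable [OpensMeasurableSpace F] [SecondCountableTopology F]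

lemma measurableSet_dist_le (r : ℝ) : MeasurableSet {p : F × F | dist p.2 p.1 ≤ r} :=
  measurableSet_le (measurable_snd.dist measurable_fst) measurable_const

lemma measurable_lowBound (μ : Measure F) [SFinite μ] (r s : ℝ) (k M : ℕ) :
    Measurable (lowBound μ r s k M) := by
  have h : Measurable fun x => μ (closedBall x r) :=
    measurable_measure_prodMk_left (measurableSet_dist_le r)
  unfold lowBound
  have h' : Measurable fun x => μ.real (closedBall x r) := h.ennreal_toReal
  fun_prop

lemma measurableSet_swapSensitive (r : ℝ) (k : ℕ) (x : F) {m : ℕ} (l : Fin m) :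
    MeasurableSet (swapSensitive r k x l) := by
  have h1 : ∀ i : Fin m, Measurable fun W : Fin m → F × F => (W i).1 := fun i => by fun_prop
  have h2 : ∀ i : Fin m, Measurable fun W : Fin m → F × F => (W i).2 := fun i => by fun_prop
  have hle : ∀ f g : (Fin m → F × F) → F, Measurable f → Measurable g →
      MeasurableSet {W | f W ∈ closedBall (g W) r} := fun f g hf hg => by
    simp only [mem_closedBall]
    exact measurableSet_le (hf.dist hg) measurable_const
  refine MeasurableSet.inter ?_ (MeasurableSet.inter ?_ (MeasurableSet.union ?_ ?_))
  · exact measurableSet_lt measurable_const ((h1 l).dist measurable_const)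
  · exact measurableSet_hits_closedBall (y := fun W : Fin m → F × F => (W l).1)
      (g := fun W i => (W i).1) (h1 l) h1 r _
  · exact hle _ _ (h2 l) measurable_const
  · refine measurableSet_setOfPred.2 (Measurable.exists fun i => measurableSet_setOfPred.1 ?_)
    refine (MeasurableSet.const _).inter (MeasurableSet.union ?_ ?_)
    · exact (hle _ _ (h1 i) measurable_const).inter (hle _ _ (h2 i) (h1 l))
    · exact (hle _ _ (h1 i) (h1 l)).inter (hle _ _ (h2 i) measurable_const)

lemma measure_swapSensitive_le {μ : Measure F} [IsProbabilityMeasure μ] {r : ℝ} (hr : 0 ≤ r)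
    {s : ℝ} (hs : 0 < s) (hs1 : s ≤ 1) (k M : ℕ) (x : F) {V : ℝ≥0∞}
    (hV : ∀ y, μ (closedBall y r) ≤ V) {U : Set (F × F)} (hU : MeasurableSet U)
    (hUx : μ.prod μ U = μ (closedBall x r))
    (hUV : ∀ y, 2 * r < dist y x → μ.prod μ (U ∩ Prod.fst ⁻¹' closedBall y r) ≤
      μ (closedBall x r) * μ (closedBall y r)) :
    iidLaw (μ.prod μ) (M + 2) {W | hits U W ≤ k ∧ ∃ l, W ∈ swapSensitive r k x l} ≤
      (M + 2) * (V + (M + 1) * (2 * V ^ 2)) * (∫⁻ y, lowBound μ r s k M y ∂μ) *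
        lowBound μ r s k M x := by
  set q := lowBound μ r s k M with hq
  have hqm : Measurable q := measurable_lowBound μ r s k M
  have hball : ∀ y : F, MeasurableSet (closedBall y r) := fun y => isClosed_closedBall.measurableSet
  have hfst : ∀ y, MeasurableSet (Prod.fst ⁻¹' closedBall y r : Set (F × F)) :=
    fun y => measurable_fst (hball y)
  have hfst' : ∀ y, μ.prod μ (Prod.fst ⁻¹' closedBall y r) = μ (closedBall y r) := fun y =>
    measurePreserving_fst.measure_preimage (hball y).nullMeasurableSet
  have hpair : ∀ y, 2 * r < dist y x → ∀ m, M ≤ m → iidLaw (μ.prod μ) m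
      {W | hits U W ≤ k ∧ hits (Prod.fst ⁻¹' closedBall y r) W ≤ k} ≤ q x * q y :=
    fun y hy m hm => iidLaw_hits_le_hits_le_lowBound _ hU (hfst y) hUx (hfst' y)
      (by rw [hUx, hfst']; exact hUV y hy) hs hs1 k hm
  have hUm : ∀ m, MeasurableSet {W : Fin m → F × F | hits U W ≤ k} := fun m =>
    measurableSet_le (measurable_hits fun i => measurable_pi_apply i hU) measurable_const
  have hfm : ∀ y m, MeasurableSet
      {W : Fin m → F × F | hits (Prod.fst ⁻¹' closedBall y r) W ≤ k} := fun y m =>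
    measurableSet_le (measurable_hits fun i => measurable_pi_apply i (hfst y)) measurable_const
  have hmono : ∀ {m : ℕ} (A : Set (F × F)) (i : Fin (m + 1)) z (W : Fin m → F × F),
      hits A W ≤ hits A (i.insertNth z W : Fin (m + 1) → F × F) := fun A i z W => by
    rw [hits_insertNth]; omega
  set c : F × F → ℝ≥0∞ := fun z => (closedBall x r).indicator 1 z.2 * (q x * q z.1) +
    (M + 1) * (2 * V ^ 2 * (q x * q z.1)) with hc
  have hcint : ∫⁻ z, c z ∂μ.prod μ ≤ (V + (M + 1) * (2 * V ^ 2)) * (∫⁻ y, q y ∂μ) * q x := by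
    have e1 : ∫⁻ z : F × F, (closedBall x r).indicator 1 z.2 * (q x * q z.1) ∂μ.prod μ =
        μ (closedBall x r) * (∫⁻ y, q y ∂μ) * q x := by
      have := lintegral_prod_mul (μ := μ) (ν := μ) (f := fun y => q x * q y)
        (g := (closedBall x r).indicator 1) (by fun_prop)
        (measurable_one.indicator (hball x)).aemeasurable
      rw [lintegral_indicator_one (hball x), lintegral_const_mul _ hqm] at this
      rw [show μ (closedBall x r) * (∫⁻ y, q y ∂μ) * q x =
        (q x * ∫⁻ y, q y ∂μ) * μ (closedBall x r) by ring, ← this]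
      exact lintegral_congr fun z => mul_comm _ _
    have e2 : ∫⁻ z : F × F, (M + 1) * (2 * V ^ 2 * (q x * q z.1)) ∂μ.prod μ =
        (M + 1) * (2 * V ^ 2) * (∫⁻ y, q y ∂μ) * q x := by
      have h2 : ∫⁻ z : F × F, q z.1 ∂μ.prod μ = ∫⁻ y, q y ∂μ :=
        measurePreserving_fst.lintegral_comp hqm
      rw [lintegral_const_mul _ (by fun_prop), lintegral_const_mul _ (by fun_prop),
        lintegral_const_mul _ (by fun_prop), h2]
      ring
    rw [lintegral_add_left (by
      refine .mul ?_ (by fun_prop)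
      exact (measurable_one.indicator (hball x)).comp measurable_snd), e1, e2,
      show (V + (M + 1) * (2 * V ^ 2)) * (∫⁻ y, q y ∂μ) * q x = V * (∫⁻ y, q y ∂μ) * q x + (M + 1) *
          (2 * V ^ 2) * (∫⁻ y, q y ∂μ) * q x by ring]
    gcongr
    exact hV x
  calc _ = iidLaw (μ.prod μ) (M + 2) {W | ∃ l, W ∈ {W | hits U W ≤ k} ∩ swapSensitive r k x l} := by
        congr 1; ext W; simp
    _ ≤ ((M + 1 : ℕ) + 1) * ∫⁻ z, c z ∂μ.prod μ := by
        refine iidLaw_exists_le _ (fun l => (hUm _).inter (measurableSet_swapSensitive r k x l)) ?_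
        intro l z
        by_cases hz : 2 * r < dist z.1 x
        swap
        · refine (measure_mono_null (t := ∅) (fun W hW => ?_) measure_empty).trans_le zero_le
          have := hW.2.1
          rw [Fin.insertNth_apply_same] at this
          exact hz this
        have hlow : ∀ W : Fin (M + 1) → F × F, (l.insertNth z W : Fin (M + 2) → F × F) ∈
            {W | hits U W ≤ k} ∩ swapSensitive r k x l →
            hits U W ≤ k ∧ hits (Prod.fst ⁻¹' closedBall z.1 r) W ≤ k := fun W hW => by
          refine ⟨(hmono U l z W).trans hW.1, ?_⟩
          have h := hW.2.2.1
          rw [Fin.insertNth_apply_same, hits_insertNth, Set.indicator_of_mem] at h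
          · omega
          · exact mem_closedBall_self hr
        by_cases hz2 : z.2 ∈ closedBall x r
        · calc _ ≤ q x * q z.1 :=
                (measure_mono fun W hW => hlow W hW).trans (hpair z.1 hz _ (Nat.le_succ M))
            _ ≤ c z := by simp [hc, hz2]
        · set D : Set (F × F) := closedBall x r ×ˢ closedBall z.1 r ∪
            closedBall z.1 r ×ˢ closedBall x r with hD
          have hDm : MeasurableSet D := ((hball x).prod (hball z.1)).union
            ((hball z.1).prod (hball x))
          have hDV : μ.prod μ D ≤ 2 * V ^ 2 := by
            refine (measure_union_le _ _).trans ?_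
            rw [Measure.prod_prod, Measure.prod_prod, two_mul, pow_two]
            gcongr <;> exact hV _
          calc _ ≤ iidLaw (μ.prod μ) (M + 1) {W | ∃ i, W ∈ {W | hits U W ≤ k} ∩
                {W | hits (Prod.fst ⁻¹' closedBall z.1 r) W ≤ k} ∩ {W | W i ∈ D}} := by
                refine measure_mono fun W hW => ?_
                have h := hW.2.2.2
                rw [Fin.insertNth_apply_same] at h
                obtain ⟨i, hil, hi⟩ := h.resolve_left hz2
                obtain ⟨i, rfl⟩ := Fin.exists_succAbove_eq hil
                rw [Fin.insertNth_apply_succAbove] at hi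
                exact ⟨i, hlow W hW, hi⟩
            _ ≤ (M + 1) * ∫⁻ w, D.indicator (fun _ => q x * q z.1) w ∂μ.prod μ := by
                refine iidLaw_exists_le _ (fun i => ((hUm _).inter (hfm _ _)).inter
                  (measurable_pi_apply i hDm)) fun i w => ?_
                by_cases hw : w ∈ D
                · rw [Set.indicator_of_mem hw]
                  refine (measure_mono fun W hW => ?_).trans (hpair z.1 hz M le_rfl)
                  exact ⟨(hmono U i w W).trans hW.1.1, (hmono _ i w W).trans hW.1.2⟩
                · refine (measure_mono_null (t := ∅) (fun W hW => ?_) measure_empty).trans_le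
                    zero_le
                  have := hW.2
                  rw [Set.mem_preimage, Fin.insertNth_apply_same] at this
                  exact hw this
            _ ≤ (M + 1) * (2 * V ^ 2 * (q x * q z.1)) := by
                rw [lintegral_indicator_const hDm, mul_comm (q x * q z.1)]
                gcongr
            _ ≤ c z := le_add_self
    _ ≤ _ := by
        have : ((M + 1 : ℕ) + 1 : ℝ≥0∞) = M + 2 := by push_cast; ring
        rw [this, mul_assoc, mul_assoc, ← mul_assoc (V + _)]
        gcongr

end LowBound

section Recursion

variable {F : Type*} [PseudoMetricSpace F] [MeasurableSpace F] [OpensMeasurableSpace F]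
  [SecondCountableTopology F]

lemma enear_hits_lowCountFar {μ : Measure F} [IsProbabilityMeasure μ] {r : ℝ} (hr : 0 ≤ r)
    {s : ℝ} (hs : 0 < s) (hs1 : s ≤ 1) (k M j : ℕ) (x : F) {V : ℝ≥0∞}
    (hV : ∀ y, μ (closedBall y r) ≤ V) :
    ENear (iidLaw μ (M + 2) {X | hits (closedBall x r) X ≤ k ∧ lowCountFar r k x X = j})
      (iidLaw μ (M + 2) {X | hits (closedBall x r) X ≤ k} *
        iidLaw μ (M + 2) {X | lowCountFar r k x X = j})
      (2 * ((M + 2) * (V + (M + 1) * (2 * V ^ 2)) * (∫⁻ y, lowBound μ r s k M y ∂μ) *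
        lowBound μ r s k M x)) := by
  set B := closedBall x r with hB
  have hball : ∀ y : F, MeasurableSet (closedBall y r) := fun y => isClosed_closedBall.measurableSet
  have hA : MeasurableSet {X : Fin (M + 2) → F | hits B X ≤ k} :=
    measurableSet_le (measurable_hits fun i => measurable_pi_apply i (hball x)) measurable_const
  have hN : MeasurableSet {X : Fin (M + 2) → F | lowCountFar r k x X = j} :=
    (measurable_lowCountFar r k (M + 2)).comp measurable_prodMk_left (measurableSet_singleton j)
  have hfst : MeasurePreserving (fun (W : Fin (M + 2) → F × F) i => (W i).1)
      (iidLaw (μ.prod μ) (M + 2)) (iidLaw μ (M + 2)) :=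
    measurePreserving_pi _ _ fun _ => measurePreserving_fst
  have hT : MeasurePreserving (fun (W : Fin (M + 2) → F × F) i => swapOn B (W i))
      (iidLaw (μ.prod μ) (M + 2)) (iidLaw (μ.prod μ) (M + 2)) :=
    measurePreserving_pi _ _ fun _ => measurePreserving_swapOn μ (hball x)
  have hpair : MeasurePreserving
      (fun W : Fin (M + 2) → F × F => ((fun i => (W i).1), fun i => (W i).2))
      (iidLaw (μ.prod μ) (M + 2)) ((iidLaw μ (M + 2)).prod (iidLaw μ (M + 2))) :=
    measurePreserving_arrowProdEquivProdArrow F F (Fin (M + 2)) (fun _ => μ) fun _ => μ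
  have e1 : iidLaw μ (M + 2) {X | hits B X ≤ k ∧ lowCountFar r k x X = j} =
      iidLaw (μ.prod μ) (M + 2) {W | hits B (fun i => (W i).1) ≤ k ∧
        lowCountFar r k x (fun i => (W i).1) = j} :=
    (hfst.measure_preimage (hA.inter hN).nullMeasurableSet).symm
  have e2 : iidLaw μ (M + 2) {X | hits B X ≤ k} *
        iidLaw μ (M + 2) {X | lowCountFar r k x X = j} =
      iidLaw (μ.prod μ) (M + 2) {W | hits B (fun i => (W i).1) ≤ k ∧
        lowCountFar r k x (fun i => (swapOn B (W i)).1) = j} := by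
    rw [mul_comm, ← Measure.prod_prod, ← hpair.measure_preimage (hN.prod hA).nullMeasurableSet,
      ← hT.measure_preimage (hpair.measurable (hN.prod hA)).nullMeasurableSet]
    congr 1
    ext W
    have : hits B (fun i => (swapOn B (W i)).2) = hits B fun i => (W i).1 := by
      classical
      simp only [hits, Set.indicator_apply, swapOn_snd_mem]
    simp only [Set.mem_preimage, Set.mem_prod, Set.mem_ofPred_eq, this]
    exact and_comm
  rw [e1, e2]
  refine (ENear.measure (C := {W | hits B (fun i => (W i).1) ≤ k ∧
    lowCountFar r k x (fun i => (W i).1) ≠ lowCountFar r k x fun i => (swapOn B (W i)).1}) _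
      ?_ ?_).mono ?_
  · intro W hW
    by_cases h : lowCountFar r k x (fun i => (W i).1) =
      lowCountFar r k x fun i => (swapOn B (W i)).1
    · exact .inl ⟨hW.1, h ▸ hW.2⟩
    · exact .inr ⟨hW.1, h⟩
  · intro W hW
    by_cases h : lowCountFar r k x (fun i => (W i).1) =
      lowCountFar r k x fun i => (swapOn B (W i)).1
    · exact .inl ⟨hW.1, h.trans hW.2⟩
    · exact .inr ⟨hW.1, h⟩
  have hprodV : ∀ y, 2 * r < dist y x → μ.prod μ (Prod.snd ⁻¹' B ∩ Prod.fst ⁻¹' closedBall y r) ≤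
      μ B * μ (closedBall y r) := fun y _ => by
    rw [mul_comm, ← Measure.prod_prod, Set.prod_eq, Set.inter_comm]
  have hdisj : ∀ y, 2 * r < dist y x → μ.prod μ (Prod.fst ⁻¹' B ∩ Prod.fst ⁻¹' closedBall y r) ≤
      μ B * μ (closedBall y r) := fun y hy => by
    rw [← Set.preimage_inter, (disjoint_closedBall_of_two_mul_lt hy).inter_eq]
    simp
  have b1 := measure_swapSensitive_le hr hs hs1 k M x hV (measurable_fst (hball x))
    (measurePreserving_fst.measure_preimage (hball x).nullMeasurableSet) hdisj
  have b2 := measure_swapSensitive_le hr hs hs1 k M x hV (measurable_snd (hball x))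
    (measurePreserving_snd.measure_preimage (hball x).nullMeasurableSet) hprodV
  have hE : MeasurableSet {W : Fin (M + 2) → F × F |
      hits (Prod.snd ⁻¹' B) W ≤ k ∧ ∃ l, W ∈ swapSensitive r k x l} := by
    refine MeasurableSet.inter ?_ ?_
    · exact measurableSet_le (measurable_hits fun i => measurable_pi_apply i
        (measurable_snd (hball x))) measurable_const
    · exact measurableSet_setOfPred.2 <| Measurable.exists fun l =>
        measurableSet_setOfPred.1 <| measurableSet_swapSensitive r k x l
  rw [← hT.measure_preimage hE.nullMeasurableSet] at b2
  rw [two_mul]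
  refine (measure_mono fun W hW => ?_).trans ((measure_union_le _ _).trans (add_le_add b1 b2))
  rcases mem_swapSensitive_of_lowCountFar_ne hr hW.2 with h | h
  · exact .inl ⟨hW.1, h⟩
  · refine .inr ⟨?_, h⟩
    have : hits (Prod.snd ⁻¹' B) (fun i => swapOn B (W i)) = hits B fun i => (W i).1 := by
      classical
      simp only [hits, Set.indicator_apply, Set.mem_preimage, swapOn_snd_mem]
    exact this.trans_le hW.1

lemma measure_exists_near_le {μ : Measure F} [IsProbabilityMeasure μ] {r t : ℝ} (hr : 0 ≤ r)
    {A : Set F} (hA : MeasurableSet A) (k k' M : ℕ) (x : F) :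
    iidLaw μ (M + 1) {X | hits A X ≤ k' ∧
      ∃ l, dist (X l) x ≤ t ∧ hits (closedBall (X l) r) X ≤ k + 1} ≤
      (M + 1) * ∫⁻ y in closedBall x t,
        iidLaw μ M {X | hits A X ≤ k' ∧ hits (closedBall y r) X ≤ k} ∂μ := by
  have hAm : MeasurableSet {X : Fin (M + 1) → F | hits A X ≤ k'} :=
    measurableSet_le (measurable_hits fun i => measurable_pi_apply i hA) measurable_const
  rw [← lintegral_indicator isClosed_closedBall.measurableSet]
  calc _ = iidLaw μ (M + 1) {X | ∃ l, X ∈ {X | hits A X ≤ k'} ∩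
        ({X | dist (X l) x ≤ t} ∩ {X | hits (closedBall (X l) r) X ≤ k + 1})} := by
        congr 1; ext X; simp
    _ ≤ _ := by
      refine iidLaw_exists_le _ (fun l => hAm.inter ((measurableSet_le
        ((measurable_pi_apply l).dist measurable_const) measurable_const).inter
        (measurableSet_hits_closedBall (measurable_pi_apply l) measurable_pi_apply r _))) ?_
      intro l y
      by_cases hy : y ∈ closedBall x t
      · rw [Set.indicator_of_mem hy]
        refine measure_mono fun X hX => ⟨?_, ?_⟩
        · have := hX.1
          rw [Set.mem_ofPred_eq, hits_insertNth] at this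
          omega
        · have := hX.2.2
          rwa [Set.mem_ofPred_eq, Fin.insertNth_apply_same,
            hits_closedBall_insertNth_self_le hr] at this
      · refine (measure_mono_null (t := ∅) (fun X hX => ?_) measure_empty).trans_le zero_le
        have := hX.2.1
        rw [Set.mem_ofPred_eq, Fin.insertNth_apply_same] at this
        exact hy this

lemma measure_exists_near_le_lowBound {μ : Measure F} [IsProbabilityMeasure μ] {r : ℝ}
    (hr : 0 ≤ r) {s : ℝ} (hs : 0 < s) (hs1 : s ≤ 1) (k M : ℕ) {R : ℝ≥0∞}
    (hR : ∀ x, ∫⁻ y in closedBall x (2 * r), lowBound μ r s k M y ∂μ ≤ R) (x : F) :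
    iidLaw μ (M + 2) {X | ∃ l, dist (X l) x ≤ 2 * r ∧ hits (closedBall (X l) r) X ≤ k + 1} ≤
      (M + 2) * R := by
  have h := measure_exists_near_le (μ := μ) (t := 2 * r) hr MeasurableSet.empty k k (M + 1) x
  have h0 : ∀ (m : ℕ) (W : Fin m → F), hits ∅ W = 0 := fun m W => by simp [hits]
  simp only [h0, zero_le, true_and] at h
  refine h.trans ?_
  rw [show ((M + 1 : ℕ) + 1 : ℝ≥0∞) = M + 2 by push_cast; ring]
  gcongr
  refine (lintegral_mono fun y => ?_).trans (hR x)
  exact iidLaw_hits_le_lowBound μ isClosed_closedBall.measurableSet rfl hs hs1 k (Nat.le_succ M)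

lemma enear_hits_lowCountAdd {μ : Measure F} [IsProbabilityMeasure μ] {r : ℝ} (hr : 0 ≤ r)
    {s : ℝ} (hs : 0 < s) (hs1 : s ≤ 1) (k M j : ℕ) {V R : ℝ≥0∞}
    (hV : ∀ y, μ (closedBall y r) ≤ V)
    (hR : ∀ x, ∫⁻ y in closedBall x (2 * r), lowBound μ r s k M y ∂μ ≤ R) (x : F) :
    ENear (iidLaw μ (M + 2) {X | hits (closedBall x r) X ≤ k ∧ lowCountAdd r k x X = j})
      (iidLaw μ (M + 2) {X | hits (closedBall x r) X ≤ k} *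
        iidLaw μ (M + 2) {X | lowCount r k X = j})
      ((M + 2) * (∫⁻ y in closedBall x (2 * r), iidLaw μ (M + 1)
          {X | hits (closedBall x r) X ≤ k ∧ hits (closedBall y r) X ≤ k} ∂μ) +
        2 * ((M + 2) * (V + (M + 1) * (2 * V ^ 2)) * (∫⁻ y, lowBound μ r s k M y ∂μ) *
          lowBound μ r s k M x) + lowBound μ r s k M x * ((M + 2) * R)) := by
  have h1 : ENear (iidLaw μ (M + 2) {X | hits (closedBall x r) X ≤ k ∧ lowCountAdd r k x X = j})
      (iidLaw μ (M + 2) {X | hits (closedBall x r) X ≤ k ∧ lowCountFar r k x X = j})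
      ((M + 2) * (∫⁻ y in closedBall x (2 * r), iidLaw μ (M + 1)
          {X | hits (closedBall x r) X ≤ k ∧ hits (closedBall y r) X ≤ k} ∂μ)) := by
    have h := measure_exists_near_le (μ := μ) (t := 2 * r) hr
      (isClosed_closedBall (x := x) (ε := r)).measurableSet k k (M + 1) x
    rw [show ((M + 1 : ℕ) + 1 : ℝ≥0∞) = M + 2 by push_cast; ring] at h
    refine (ENear.measure _ ?_ ?_).mono h
    all_goals
      intro X hX
      by_cases hl : ∃ l, dist (X l) x ≤ 2 * r ∧ hits (closedBall (X l) r) X ≤ k + 1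
      · exact .inr ⟨hX.1, hl⟩
      · push Not at hl
        have := lowCountAdd_eq_lowCountFar (k := k) hr fun l h => (hl l h).not_ge
        refine .inl ⟨hX.1, ?_⟩
        exact this ▸ hX.2
  have h3 : ENear (iidLaw μ (M + 2) {X | lowCountFar r k x X = j})
      (iidLaw μ (M + 2) {X | lowCount r k X = j}) ((M + 2) * R) := by
    refine (ENear.measure _ ?_ ?_).mono (measure_exists_near_le_lowBound hr hs hs1 k M hR x)
    all_goals
      intro X hX
      by_cases hl : ∃ l, dist (X l) x ≤ 2 * r ∧ hits (closedBall (X l) r) X ≤ k + 1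
      · exact .inr hl
      · push Not at hl
        have := lowCount_eq_lowCountFar (k := k) (r := r) fun l h => (hl l h).not_ge
        first | exact .inl (this.trans hX) | exact .inl (this.symm.trans hX)
  refine (h1.trans (enear_hits_lowCountFar hr hs hs1 k M j x hV)).trans
    ((h3.mul_left _).mono ?_)
  gcongr
  exact iidLaw_hits_le_lowBound μ isClosed_closedBall.measurableSet rfl hs hs1 k (by omega)

lemma measurable_pairLow (μ : Measure F) [IsProbabilityMeasure μ] (r t : ℝ) (k m : ℕ) :
    Measurable fun x => ∫⁻ y in closedBall x t, iidLaw μ m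
      {X | hits (closedBall x r) X ≤ k ∧ hits (closedBall y r) X ≤ k} ∂μ := by
  have h1 : Measurable fun p : F × F => iidLaw μ m
      {X | hits (closedBall p.1 r) X ≤ k ∧ hits (closedBall p.2 r) X ≤ k} := by
    have hm : MeasurableSet {p : (F × F) × (Fin m → F) |
        hits (closedBall p.1.1 r) p.2 ≤ k ∧ hits (closedBall p.1.2 r) p.2 ≤ k} :=
      (measurableSet_hits_closedBall (y := fun p : (F × F) × (Fin m → F) => p.1.1)
        (g := fun p => p.2) (by fun_prop) (fun i => by fun_prop) r k).inter
      (measurableSet_hits_closedBall (y := fun p : (F × F) × (Fin m → F) => p.1.2)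
        (g := fun p => p.2) (by fun_prop) (fun i => by fun_prop) r k)
    exact measurable_measure_prodMk_left hm
  have h2 := (h1.indicator (measurableSet_dist_le t)).lintegral_prod_right' (ν := μ)
  convert h2 using 2 with x
  rw [← lintegral_indicator isClosed_closedBall.measurableSet]
  rfl

/-- Approximate recursion satisfied by the law of the number of low degree points. -/
lemma enear_succ_mul_lowCount {μ : Measure F} [IsProbabilityMeasure μ] {r : ℝ} (hr : 0 ≤ r)
    {s : ℝ} (hs : 0 < s) (hs1 : s ≤ 1) (k M j : ℕ) {V R : ℝ≥0∞}
    (hV : ∀ y, μ (closedBall y r) ≤ V)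
    (hR : ∀ x, ∫⁻ y in closedBall x (2 * r), lowBound μ r s k M y ∂μ ≤ R) :
    ENear ((j + 1) * iidLaw μ (M + 3) {X | lowCount r k X = j + 1})
      ((M + 3) * (∫⁻ x, iidLaw μ (M + 2) {X | hits (closedBall x r) X ≤ k} ∂μ) *
        iidLaw μ (M + 2) {X | lowCount r k X = j})
      ((M + 3) * ((M + 2) * (∫⁻ x, ∫⁻ y in closedBall x (2 * r), iidLaw μ (M + 1)
          {X | hits (closedBall x r) X ≤ k ∧ hits (closedBall y r) X ≤ k} ∂μ ∂μ) +
        2 * ((M + 2) * (V + (M + 1) * (2 * V ^ 2)) * (∫⁻ y, lowBound μ r s k M y ∂μ)) *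
          (∫⁻ y, lowBound μ r s k M y ∂μ) + (∫⁻ y, lowBound μ r s k M y ∂μ) * ((M + 2) * R))) := by
  have hq := measurable_lowBound μ r s k M
  have hp := measurable_pairLow μ r (2 * r) k (M + 1)
  have hA : Measurable fun x => iidLaw μ (M + 2) {X | hits (closedBall x r) X ≤ k} :=
    measurable_measure_prodMk_left (measurableSet_hits_closedBall
      (y := fun p : F × (Fin (M + 2) → F) => p.1) (g := fun p => p.2) (by fun_prop)
      (fun i => by fun_prop) r k)
  rw [succ_mul_iidLaw_lowCount_eq μ hr, show ((M + 2 : ℕ) + 1 : ℝ≥0∞) = M + 3 by push_cast; ring,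
    mul_assoc, ← lintegral_mul_const _ hA]
  refine ((ENear.lintegral ?_ fun x => enear_hits_lowCountAdd hr hs hs1 k M j hV hR x).mul_left
    _).mono ?_
  · fun_prop
  · rw [lintegral_add_left (by fun_prop), lintegral_add_left (by fun_prop),
      lintegral_const_mul _ hp, lintegral_const_mul _ (by fun_prop),
      lintegral_const_mul _ (by fun_prop), lintegral_mul_const _ (by fun_prop)]
    simp only [mul_assoc, le_refl]

/-- Adding one point hardly changes the law of the number of low degree points. -/
lemma enear_lowCount_succ {μ : Measure F} [IsProbabilityMeasure μ] {r : ℝ} (hr : 0 ≤ r)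
    {s : ℝ} (hs : 0 < s) (hs1 : s ≤ 1) (k M j : ℕ) {R : ℝ≥0∞}
    (hR : ∀ x, ∫⁻ y in closedBall x (2 * r), lowBound μ r s k M y ∂μ ≤ R) :
    ENear (iidLaw μ (M + 3) {X | lowCount r k X = j}) (iidLaw μ (M + 2) {X | lowCount r k X = j})
      ((∫⁻ y, lowBound μ r s k M y ∂μ) + (M + 2) * R) := by
  have hN : MeasurableSet {X : Fin (M + 3) → F | lowCount r k X = j} :=
    measurable_lowCount r k _ (measurableSet_singleton _)
  have hconst : iidLaw μ (M + 2) {X | lowCount r k X = j} =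
      ∫⁻ _, iidLaw μ (M + 2) {X | lowCount r k X = j} ∂μ := by simp
  have hq := measurable_lowBound μ r s k M
  rw [iidLaw_succ_apply μ 0 hN, hconst]
  refine (ENear.lintegral (e := fun x => lowBound μ r s k M x + (M + 2) * R) (by fun_prop)
    fun x => ?_).mono ?_
  · refine (ENear.measure (C := {X | hits (closedBall x r) X ≤ k} ∪
      {X | ∃ l, dist (X l) x ≤ 2 * r ∧ hits (closedBall (X l) r) X ≤ k + 1}) _ ?_ ?_).mono
      ((measure_union_le _ _).trans (add_le_add
        (iidLaw_hits_le_lowBound μ isClosed_closedBall.measurableSet rfl hs hs1 k (by omega))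
        (measure_exists_near_le_lowBound hr hs hs1 k M hR x)))
    all_goals
      intro X hX
      by_cases h1 : hits (closedBall x r) X ≤ k
      · exact .inr (.inl h1)
      by_cases hl : ∃ l, dist (X l) x ≤ 2 * r ∧ hits (closedBall (X l) r) X ≤ k + 1
      · exact .inr (.inr hl)
      · push Not at hl
        have := lowCountAdd_eq_lowCount (k := k) (r := r) (x := x) (X := X)
          fun l h => (hl l (by linarith)).not_ge
        have h2 := lowCount_insertNth hr (k := k) 0 x X
        rw [if_neg h1, zero_add, this] at h2
        first | exact .inl (h2.symm.trans hX) | exact .inl (h2.trans hX)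
  · rw [lintegral_add_left hq]
    simp

end Recursion

section PoissonLimit

lemma tendsto_exp_neg_of_recursion {a : ℕ → ℕ → ℝ} {L : ℕ → ℝ} {l C : ℝ}
    (ha : ∀ n, 0 ≤ a n 0) (ha1 : ∀ n, a n 0 ≤ 1) (hL : Tendsto L atTop (𝓝 l))
    (hrec : ∀ j, Tendsto (fun n => (j + 1) * a n (j + 1) - L n * a n j) atTop (𝓝 0))
    (hsum : ∀ J, ∀ᶠ n in atTop, |∑ j ∈ Finset.range (J + 1), a n j - 1| ≤ C / (J + 1)) :
    Tendsto (fun n => a n 0) atTop (𝓝 (exp (-l))) := by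
  have hb : ∀ u : ℕ → ℝ, Tendsto u atTop (𝓝 0) →
      Tendsto (fun n => u n * a n 0) atTop (𝓝 0) := fun u hu => by
    refine squeeze_zero_norm (fun n => ?_) (tendsto_zero_iff_norm_tendsto_zero.1 hu)
    rw [norm_mul, Real.norm_of_nonneg (ha n)]
    exact mul_le_of_le_one_right (norm_nonneg _) (ha1 n)
  have hj : ∀ j : ℕ, Tendsto (fun n => a n j - l ^ j / j.factorial * a n 0) atTop (𝓝 0) := by
    intro j
    induction j with
    | zero => simp
    | succ j ih =>
      have h1 := ((hrec j).add (hL.mul ih)).add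
        ((hb _ (tendsto_sub_nhds_zero_iff.2 hL)).mul_const (l ^ j / j.factorial))
      have h2 := h1.div_const (j + 1 : ℝ)
      have h3 : (0 + l * 0 + 0 * (l ^ j / j.factorial)) / (j + 1 : ℝ) = 0 := by simp
      rw [h3] at h2
      refine h2.congr fun n => ?_
      have : (j + 1 : ℝ) ≠ 0 := by positivity
      rw [Nat.factorial_succ]
      push_cast
      field_simp
      ring
  have hS : ∀ J, Tendsto (fun n => ∑ j ∈ Finset.range (J + 1), a n j -
      (∑ j ∈ Finset.range (J + 1), l ^ j / j.factorial) * a n 0) atTop (𝓝 0) := fun J => by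
    have := tendsto_finsetSum (Finset.range (J + 1)) fun j _ => hj j
    simpa only [Finset.sum_sub_distrib, Finset.sum_const_zero, Finset.sum_mul] using this
  have hmain : Tendsto (fun n => exp l * a n 0) atTop (𝓝 1) := by
    rw [Metric.tendsto_atTop']
    intro ε hε
    have hexp : Tendsto (fun J => ∑ j ∈ Finset.range (J + 1), l ^ j / j.factorial) atTop
        (𝓝 (exp l)) := by
      rw [Real.exp_eq_exp_ℝ, NormedSpace.exp_eq_tsum_div]
      exact ((NormedSpace.expSeries_div_summable (𝔸 := ℝ) l).hasSum.tendsto_sum_nat).comp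
        (tendsto_add_atTop_nat 1)
    have hC : Tendsto (fun J : ℕ => C / ((J : ℝ) + 1)) atTop (𝓝 0) :=
      tendsto_const_div_atTop_nhds_zero_nat C |>.comp (tendsto_add_atTop_nat 1) |>.congr
        fun J => by simp
    obtain ⟨J, hJ1, hJ2⟩ := ((Metric.tendsto_nhds.1 hexp (ε / 3) (by positivity)).and
      (Metric.tendsto_nhds.1 hC (ε / 3) (by positivity))).exists
    obtain ⟨N, hN⟩ := eventually_atTop.1 ((hsum J).and
      (Metric.tendsto_nhds.1 (hS J) (ε / 3) (by positivity)))
    refine ⟨N, fun n hn => ?_⟩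
    obtain ⟨h1, h2⟩ := hN n hn.le
    rw [Real.dist_eq, sub_zero] at hJ2 h2
    rw [Real.dist_eq] at hJ1 ⊢
    set S := ∑ j ∈ Finset.range (J + 1), l ^ j / (j.factorial : ℝ)
    set A := ∑ j ∈ Finset.range (J + 1), a n j
    have h4 : |(S - exp l) * a n 0| < ε / 3 := by
      rw [abs_mul, abs_of_nonneg (ha n)]
      exact (mul_le_of_le_one_right (abs_nonneg _) (ha1 n)).trans_lt hJ1
    have h5 := le_abs_self (C / ((J : ℝ) + 1))
    rw [abs_lt] at h2 h4 ⊢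
    rw [abs_le] at h1
    constructor <;> nlinarith
  have := hmain.const_mul (exp (-l))
  rw [mul_one] at this
  refine this.congr fun n => ?_
  rw [← mul_assoc, ← exp_add, neg_add_cancel, exp_zero, one_mul]

variable {F : Type*} [PseudoMetricSpace F] [MeasurableSpace F] [OpensMeasurableSpace F]
  [SecondCountableTopology F]

lemma lintegral_lowCount (μ : Measure F) [IsProbabilityMeasure μ] {r : ℝ} (hr : 0 ≤ r)
    (k m : ℕ) :
    ∫⁻ X, (lowCount r k X : ℝ≥0∞) ∂iidLaw μ (m + 1) =
      (m + 1) * ∫⁻ x, iidLaw μ m {X | hits (closedBall x r) X ≤ k} ∂μ := by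
  have hlow : ∀ i, MeasurableSet {X : Fin (m + 1) → F | hits (closedBall (X i) r) X ≤ k + 1} :=
    fun i => measurableSet_hits_closedBall (measurable_pi_apply i) measurable_pi_apply r _
  have h : ∀ X : Fin (m + 1) → F, (lowCount r k X : ℝ≥0∞) =
      ∑ i, {X : Fin (m + 1) → F | hits (closedBall (X i) r) X ≤ k + 1}.indicator
        (1 : (Fin (m + 1) → F) → ℝ≥0∞) X := fun X => by
    simp only [lowCount, Nat.cast_sum]
    refine Finset.sum_congr rfl fun i _ => ?_
    by_cases hi : hits (closedBall (X i) r) X ≤ k + 1 <;> simp [hi]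
  simp_rw [h]
  rw [lintegral_finsetSum _ fun i _ => measurable_one.indicator (hlow i)]
  have h' : ∀ i, iidLaw μ (m + 1) {X | hits (closedBall (X i) r) X ≤ k + 1} =
      ∫⁻ x, iidLaw μ m {X | hits (closedBall x r) X ≤ k} ∂μ := fun i => by
    rw [iidLaw_succ_apply μ i (hlow i)]
    simp [hits_closedBall_insertNth_self_le hr]
  simp_rw [lintegral_indicator_one (hlow _), h']
  simp

lemma abs_sum_lowCount_sub_one_le (μ : Measure F) [IsProbabilityMeasure μ] {r : ℝ} (hr : 0 ≤ r)
    (k m J : ℕ) {C : ℝ}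
    (hC : (m + 1) * ∫⁻ x, iidLaw μ m {X | hits (closedBall x r) X ≤ k} ∂μ ≤ ENNReal.ofReal C)
    (hC0 : 0 ≤ C) :
    |∑ j ∈ Finset.range (J + 1), (iidLaw μ (m + 1)).real {X | lowCount r k X = j} - 1| ≤
      C / (J + 1) := by
  have hmeas : ∀ S : Set ℕ, MeasurableSet {X : Fin (m + 1) → F | lowCount r k X ∈ S} := fun S =>
    measurable_lowCount r k _ (MeasurableSpace.measurableSet_top)
  have h1 : ∑ j ∈ Finset.range (J + 1), (iidLaw μ (m + 1)).real {X | lowCount r k X = j} =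
      (iidLaw μ (m + 1)).real {X | lowCount r k X < J + 1} := by
    have h := sum_measureReal_preimage_singleton (μ := iidLaw μ (m + 1)) (f := lowCount r k)
      (Finset.range (J + 1)) (fun j _ => hmeas {j})
    refine h.trans (congrArg _ ?_)
    ext X
    simp
  have h2 := probReal_compl_eq_one_sub (μ := iidLaw μ (m + 1)) (hmeas (Set.Iio (J + 1)))
  have h3 : iidLaw μ (m + 1) {X | lowCount r k X ∈ Set.Iio (J + 1)}ᶜ ≤
      ENNReal.ofReal (C / (J + 1)) := by
    have := mul_meas_ge_le_lintegral₀ (μ := iidLaw μ (m + 1))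
      (f := fun X : Fin (m + 1) → F => (lowCount r k X : ℝ≥0∞))
      (measurable_from_top.comp (measurable_lowCount r k _)).aemeasurable ((J : ℝ≥0∞) + 1)
    rw [lintegral_lowCount μ hr] at this
    rw [ENNReal.ofReal_div_of_pos (by positivity), ENNReal.le_div_iff_mul_le
      (.inl (by simp; positivity)) (.inl (by simp)), mul_comm]
    refine le_trans (le_of_eq ?_) (this.trans hC)
    congr 1
    · rw [ENNReal.ofReal_add (by positivity) zero_le_one, ENNReal.ofReal_natCast,
        ENNReal.ofReal_one]
    · congr 1
      ext X
      simp only [Set.mem_compl_iff, Set.mem_ofPred_eq, Set.mem_Iio, not_lt]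
      norm_cast
  have h4 : (iidLaw μ (m + 1)).real {X | lowCount r k X ∈ Set.Iio (J + 1)}ᶜ ≤ C / (J + 1) :=
    ENNReal.toReal_le_of_le_ofReal (by positivity) h3
  have h5 : (iidLaw μ (m + 1)).real {X | lowCount r k X ∈ Set.Iio (J + 1)} ≤ 1 :=
    measureReal_le_one
  simp only [Set.mem_Iio] at h2 h4 h5
  rw [h1, abs_of_nonpos (sub_nonpos.2 h5)]
  linarith

/-- Poisson convergence of the number of low degree points, along samples of size `M + 3`. -/
theorem tendsto_iidLaw_lowCount_eq_zero (μ : Measure F) [IsProbabilityMeasure μ] (k : ℕ)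
    {r s : ℕ → ℝ} (hr : ∀ M, 0 ≤ r M) (hs : ∀ M, 0 < s M) (hs1 : ∀ M, s M ≤ 1)
    {l : ℝ} (hl : 0 ≤ l) {V R : ℕ → ℝ≥0∞} {K : ℝ≥0∞} (hK : K ≠ ∞)
    (hV : ∀ M y, μ (closedBall y (r M)) ≤ V M)
    (hR : ∀ M x, ∫⁻ y in closedBall x (2 * r M), lowBound μ (r M) (s M) k M y ∂μ ≤ R M)
    (hmean : Tendsto (fun M : ℕ => (M + 3) *
      ∫⁻ x, iidLaw μ (M + 2) {X | hits (closedBall x (r M)) X ≤ k} ∂μ) atTop (𝓝 (ENNReal.ofReal l)))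
    (hQ : ∀ᶠ M : ℕ in atTop, (M + 3) * ∫⁻ x, lowBound μ (r M) (s M) k M x ∂μ ≤ K)
    (hV2 : Tendsto (fun M : ℕ => (M + 3) * V M ^ 2) atTop (𝓝 0))
    (hV1 : Tendsto V atTop (𝓝 0))
    (hRlim : Tendsto (fun M : ℕ => (M + 3) * R M) atTop (𝓝 0))
    (hpair : Tendsto (fun M : ℕ => (M + 3) ^ 2 * ∫⁻ x, ∫⁻ y in closedBall x (2 * r M),
      iidLaw μ (M + 1) {X | hits (closedBall x (r M)) X ≤ k ∧ hits (closedBall y (r M)) X ≤ k}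
        ∂μ ∂μ) atTop (𝓝 0)) :
    Tendsto (fun M => (iidLaw μ (M + 3)).real {X | lowCount (r M) k X = 0}) atTop
      (𝓝 (exp (-l))) := by
  set p : ℕ → ℝ≥0∞ := fun M => (M + 3) *
      ∫⁻ x, iidLaw μ (M + 2) {X | hits (closedBall x (r M)) X ≤ k} ∂μ with hp
  set Q : ℕ → ℝ≥0∞ := fun M => ∫⁻ x, lowBound μ (r M) (s M) k M x ∂μ with hQdef
  have hptop : ∀ M, p M ≠ ∞ := fun M => by
    refine ENNReal.mul_ne_top (by finiteness) ((lintegral_mono fun x => prob_le_one).trans_lt ?_).ne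
    simp
  have hQ0 : Tendsto Q atTop (𝓝 0) := by
    have h1 : Tendsto (fun M : ℕ => K / (M : ℝ≥0∞)) atTop (𝓝 0) := by
      have := ENNReal.Tendsto.const_div (a := K) ENNReal.tendsto_nat_nhds_top (.inr hK)
      simpa using this
    refine tendsto_of_tendsto_of_tendsto_of_le_of_le' tendsto_const_nhds h1
      (.of_forall fun _ => zero_le) ?_
    filter_upwards [hQ, eventually_gt_atTop 0] with M hM hM0
    rw [ENNReal.le_div_iff_mul_le (.inl (by simp; omega)) (.inl (by simp)), mul_comm]
    refine le_trans ?_ hM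
    gcongr
    exact le_self_add
  have hstep : Tendsto (fun M : ℕ => Q M + (M + 2) * R M) atTop (𝓝 0) := by
    have := hQ0.add hRlim
    rw [add_zero] at this
    refine tendsto_of_tendsto_of_tendsto_of_le_of_le tendsto_const_nhds this
      (fun _ => zero_le) fun M => ?_
    dsimp only
    gcongr
    norm_num
  have herr : Tendsto (fun M : ℕ => (M + 3) * ((M + 2) * (∫⁻ x, ∫⁻ y in closedBall x (2 * r M),
      iidLaw μ (M + 1) {X | hits (closedBall x (r M)) X ≤ k ∧ hits (closedBall y (r M)) X ≤ k}
        ∂μ ∂μ) + 2 * ((M + 2) * (V M + (M + 1) * (2 * V M ^ 2)) * Q M) * Q M +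
      Q M * ((M + 2) * R M))) atTop (𝓝 0) := by
    have h1 : Tendsto (fun M : ℕ => 2 * K ^ 2 * (V M + 2 * ((M + 3) * V M ^ 2))) atTop (𝓝 0) := by
      have := ENNReal.Tendsto.const_mul (a := 2 * K ^ 2)
        (hV1.add (ENNReal.Tendsto.const_mul (a := 2) hV2 (.inr (by simp)))) (.inr (by finiteness))
      simpa using this
    have h2 : Tendsto (fun M : ℕ => K * ((M + 3) * R M)) atTop (𝓝 0) := by
      have := ENNReal.Tendsto.const_mul (a := K) hRlim (.inr hK)
      simpa using this
    have h3 := (hpair.add h1).add h2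
    simp only [add_zero] at h3
    refine tendsto_of_tendsto_of_tendsto_of_le_of_le' tendsto_const_nhds h3
      (.of_forall fun _ => zero_le) ?_
    filter_upwards [hQ] with M hM
    have hle : ((M : ℝ≥0∞) + 2) ≤ M + 3 := by gcongr; norm_num
    have hle1 : ((M : ℝ≥0∞) + 1) ≤ M + 3 := by gcongr; norm_num
    rw [mul_add, mul_add]
    gcongr ?_ + ?_ + ?_
    · rw [← mul_assoc, pow_two]
      gcongr
    · calc _ = 2 * (((M + 3) * Q M) * ((M + 2) * Q M)) * (V M + 2 * ((M + 1) * V M ^ 2)) := by ring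
        _ ≤ 2 * (K * K) * (V M + 2 * ((M + 3) * V M ^ 2)) := by
            gcongr
            exact (mul_le_mul_left hle _).trans hM
        _ = _ := by ring
    · rw [← mul_assoc]
      gcongr
  set a : ℕ → ℕ → ℝ := fun M j => (iidLaw μ (M + 3)).real {X | lowCount (r M) k X = j} with ha
  set b : ℕ → ℕ → ℝ := fun M j => (iidLaw μ (M + 2)).real {X | lowCount (r M) k X = j} with hb
  have hab : ∀ j, Tendsto (fun M => a M j - b M j) atTop (𝓝 0) := fun j => by
    have h0 : Tendsto (fun M : ℕ => (Q M + (M + 2) * R M).toReal) atTop (𝓝 0) :=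
      (ENNReal.tendsto_toReal ENNReal.zero_ne_top).comp hstep
    refine squeeze_zero_norm' ?_ h0
    filter_upwards [hstep.eventually_lt_const ENNReal.zero_lt_top] with M hM
    exact (enear_lowCount_succ (hr M) (hs M) (hs1 M) k M j (hR M)).abs_toReal_sub_le
      (by finiteness) (by finiteness) hM.ne
  have hrec : ∀ j : ℕ, Tendsto (fun M => (j + 1) * a M (j + 1) - (p M).toReal * b M j) atTop
      (𝓝 0) := fun j => by
    refine squeeze_zero_norm' ?_ ((ENNReal.tendsto_toReal ENNReal.zero_ne_top).comp herr)
    filter_upwards [herr.eventually_lt_const ENNReal.zero_lt_top] with M hM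
    have := (enear_succ_mul_lowCount (hr M) (hs M) (hs1 M) k M j (hV M)
      (hR M)).abs_toReal_sub_le (by finiteness)
      (ENNReal.mul_ne_top (hptop M) (by finiteness)) hM.ne
    have hj : ((j : ℝ≥0∞) + 1).toReal = (j : ℝ) + 1 := by
      rw [ENNReal.toReal_add (by finiteness) (by finiteness)]
      simp
    change |_ * _ - (p M).toReal * _| ≤ _
    rw [← hj]
    exact le_of_eq_of_le (congrArg abs (congrArg₂ (· - ·) ENNReal.toReal_mul.symm
      ENNReal.toReal_mul.symm)) this
  have hp' : Tendsto (fun M => (p M).toReal) atTop (𝓝 l) := by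
    have := (ENNReal.tendsto_toReal (ENNReal.ofReal_ne_top (r := l))).comp hmean
    rwa [ENNReal.toReal_ofReal hl] at this
  refine tendsto_exp_neg_of_recursion (a := a) (C := l + 1)
    (fun _ => measureReal_nonneg)
    (fun _ => measureReal_le_one) hp' (fun j => ?_) fun J => ?_
  · have h := (hrec j).sub (hp'.mul (hab j))
    simp only [mul_zero, sub_zero] at h
    refine h.congr fun M => ?_
    ring
  · have hlt : ENNReal.ofReal l < ENNReal.ofReal (l + 1) :=
      (ENNReal.ofReal_lt_ofReal_iff (by linarith)).2 (by linarith)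
    filter_upwards [hmean.eventually_le_const hlt] with M hM
    refine abs_sum_lowCount_sub_one_le μ (hr M) k (M + 2) J ?_ (by linarith)
    rwa [show ((M + 2 : ℕ) + 1 : ℝ≥0∞) = M + 3 by push_cast; ring]

end PoissonLimit

section Binomial

variable {F : Type*} [MeasurableSpace F]

lemma iidLaw_succ_real_hits_mem (ρ : Measure F) [IsProbabilityMeasure ρ] {U : Set F}
    (hU : MeasurableSet U) (m : ℕ) (S : Set ℕ) :
    (iidLaw ρ (m + 1)).real {W | hits U W ∈ S} =
      ρ.real U * (iidLaw ρ m).real {W | 1 + hits U W ∈ S} +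
        (1 - ρ.real U) * (iidLaw ρ m).real {W | hits U W ∈ S} := by
  have hm : ∀ (m : ℕ) (S : Set ℕ), MeasurableSet {W : Fin m → F | hits U W ∈ S} := fun m S =>
    (Finset.measurable_sum _ fun i _ => (measurable_const.indicator hU).comp
      (measurable_pi_apply i))
      (MeasurableSpace.measurableSet_top : MeasurableSet S)
  have h1 := iidLaw_succ_apply ρ 0 (hm (m + 1) S)
  have h2 : ∀ x, iidLaw ρ m {W | (0 : Fin (m + 1)).insertNth x W ∈
      {W : Fin (m + 1) → F | hits U W ∈ S}} =
      U.indicator (fun _ => iidLaw ρ m {W | 1 + hits U W ∈ S}) x +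
        Uᶜ.indicator (fun _ => iidLaw ρ m {W | hits U W ∈ S}) x := fun x => by
    simp only [Set.mem_ofPred_eq, hits_insertNth]
    by_cases hx : x ∈ U <;> simp [hx]
  simp_rw [h2] at h1
  rw [lintegral_add_left (measurable_const.indicator hU), lintegral_indicator hU,
    lintegral_indicator hU.compl, setLIntegral_const, setLIntegral_const] at h1
  rw [measureReal_def, h1, ENNReal.toReal_add (by finiteness) (by finiteness), ENNReal.toReal_mul,
    ENNReal.toReal_mul, ← measureReal_def, ← measureReal_def, ← measureReal_def, ← measureReal_def,
    probReal_compl_eq_one_sub hU]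
  ring

lemma iidLaw_real_hits_eq (ρ : Measure F) [IsProbabilityMeasure ρ] {U : Set F}
    (hU : MeasurableSet U) (m i : ℕ) :
    (iidLaw ρ m).real {W | hits U W = i} =
      m.choose i * ρ.real U ^ i * (1 - ρ.real U) ^ (m - i) := by
  induction m generalizing i with
  | zero =>
    cases i with
    | zero => simp [hits]
    | succ i => simp [hits]
  | succ m ih =>
    have h := iidLaw_succ_real_hits_mem ρ hU m {i}
    simp only [Set.mem_singleton_iff] at h
    rw [h, ih]
    cases i with
    | zero => simp [pow_succ]; ring
    | succ i =>
      have : ∀ W : Fin m → F, 1 + hits U W = i + 1 ↔ hits U W = i := fun W => by omega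
      simp_rw [this]
      rw [ih, Nat.choose_succ_succ]
      rcases le_or_gt m i with hi | hi
      · rw [Nat.choose_eq_zero_of_lt (by omega : m < i + 1)]
        simp
        ring
      · rw [show m + 1 - (i + 1) = (m - (i + 1)) + 1 by omega, show m - i = (m - (i + 1)) +
          1 by omega]
        push_cast
        ring

lemma iidLaw_real_hits_le (ρ : Measure F) [IsProbabilityMeasure ρ] {U : Set F}
    (hU : MeasurableSet U) (m k : ℕ) :
    (iidLaw ρ m).real {W | hits U W ≤ k} =
      ∑ i ∈ Finset.range (k + 1), m.choose i * ρ.real U ^ i * (1 - ρ.real U) ^ (m - i) := by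
  have hf : Measurable (hits U : (Fin m → F) → ℕ) :=
    Finset.measurable_sum _ fun i _ => (measurable_const.indicator hU).comp (measurable_pi_apply i)
  simp_rw [← iidLaw_real_hits_eq ρ hU]
  rw [show {W : Fin m → F | hits U W ≤ k} = {W | hits U W ∈ Finset.range (k + 1)} by
    ext W; simp]
  exact (sum_measureReal_preimage_singleton (Finset.range (k + 1))
    fun j _ => hf (measurableSet_singleton j)).symm

end Binomial

/-- The probability that a Poisson variable of mean `a` is at most `k`. -/
noncomputable def poissonTail (k : ℕ) (a : ℝ) : ℝ :=
  exp (-a) * ∑ i ∈ Finset.range (k + 1), a ^ i / i.factorial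

section PoissonTail

lemma poissonTail_nonneg (k : ℕ) {a : ℝ} (ha : 0 ≤ a) : 0 ≤ poissonTail k a := by
  unfold poissonTail; positivity

lemma continuous_poissonTail (k : ℕ) : Continuous (poissonTail k) := by
  unfold poissonTail; fun_prop

lemma hasDerivAt_poissonTail (k : ℕ) (a : ℝ) :
    HasDerivAt (poissonTail k) (-(exp (-a) * (a ^ k / k.factorial))) a := by
  induction k with
  | zero =>
    have h : poissonTail 0 = fun a => exp (-a) := by
      ext a
      simp [poissonTail]
    simpa [h] using (hasDerivAt_neg a).exp
  | succ k ih =>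
    have h1 : poissonTail (k + 1) =
        fun a => poissonTail k a + exp (-a) * (a ^ (k + 1) / (k + 1).factorial) := by
      ext a
      rw [poissonTail, Finset.sum_range_succ, mul_add]
      rfl
    rw [h1]
    have h2 : HasDerivAt (fun a : ℝ => a ^ (k + 1) / (k + 1).factorial) (a ^ k / k.factorial)
        a := by
      refine ((hasDerivAt_pow (k + 1) a).div_const _).congr_deriv ?_
      rw [Nat.factorial_succ]
      push_cast
      field_simp
    refine (ih.add ((hasDerivAt_neg a).exp.mul h2)).congr_deriv ?_
    ring

lemma antitoneOn_poissonTail (k : ℕ) : AntitoneOn (poissonTail k) (Set.Ici 0) := by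
  refine antitoneOn_of_hasDerivWithinAt_nonpos (convex_Ici 0)
      (continuous_poissonTail k).continuousOn
    (fun x _ => (hasDerivAt_poissonTail k x).hasDerivWithinAt) fun x hx => ?_
  rw [interior_Ici] at hx
  have : 0 ≤ x := le_of_lt hx
  have : 0 ≤ exp (-x) * (x ^ k / k.factorial) := by positivity
  linarith

lemma poissonTail_sub_le (k : ℕ) {a h : ℝ} (hh : 0 ≤ h) (ha : h ≤ a) :
    poissonTail k (a - h) ≤ exp h * poissonTail k a := by
  unfold poissonTail
  rw [← mul_assoc, ← exp_add, show h + -a = -(a - h) by ring]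
  have : 0 ≤ a - h := by linarith
  gcongr
  linarith

lemma exp_mul_pow_le_poissonTail (k : ℕ) {a : ℝ} (ha : 0 ≤ a) :
    exp (-a) * (a ^ k / k.factorial) ≤ poissonTail k a := by
  unfold poissonTail
  gcongr
  exact Finset.single_le_sum (f := fun i : ℕ => a ^ i / (i.factorial : ℝ))
    (fun i _ => by positivity) (Finset.self_mem_range_succ k)

variable {F : Type*} [MeasurableSpace F]

lemma iidLaw_real_hits_le_poissonTail (ρ : Measure F) [IsProbabilityMeasure ρ] {U : Set F}
    (hU : MeasurableSet U) (m k : ℕ) :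
    (iidLaw ρ m).real {W | hits U W ≤ k} ≤
      exp ((k + 1) * ρ.real U) * poissonTail k ((m + 1) * ρ.real U) := by
  rw [iidLaw_real_hits_le ρ hU, poissonTail, ← mul_assoc, Finset.mul_sum]
  refine Finset.sum_le_sum fun i hi => ?_
  rw [Finset.mem_range, Nat.lt_succ_iff] at hi
  set q := ρ.real U with hq
  have hq0 : 0 ≤ q := measureReal_nonneg
  have hq1 : q ≤ 1 := measureReal_le_one
  rcases lt_or_ge m i with hmi | hmi
  · rw [Nat.choose_eq_zero_of_lt hmi]
    simp only [Nat.cast_zero, zero_mul]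
    positivity
  have h1 : (m.choose i : ℝ) ≤ (m + 1) ^ i / i.factorial :=
    (Nat.choose_le_pow_div i m).trans (by gcongr; linarith)
  have h2 : (1 - q) ^ (m - i) ≤ exp ((k + 1) * q) * exp (-((m + 1) * q)) := by
    calc (1 - q) ^ (m - i) ≤ exp (-q) ^ (m - i) := by
          have := add_one_le_exp (-q)
          gcongr
          linarith
      _ = exp ((m - i : ℕ) * -q) := by rw [← exp_nat_mul]
      _ ≤ _ := by
          rw [← exp_add, Nat.cast_sub hmi]
          gcongr
          have : (i : ℝ) * q ≤ k * q := by gcongr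
          nlinarith
  calc m.choose i * q ^ i * (1 - q) ^ (m - i) ≤
      (m + 1) ^ i / i.factorial * q ^ i * (exp ((k + 1) * q) * exp (-((m + 1) * q))) := by
        have : 0 ≤ 1 - q := by linarith
        gcongr
    _ = _ := by rw [mul_pow]; ring

lemma exp_neg_sub_le_one_sub {q : ℝ} (hq : q ≤ 1 / 2) :
    exp (-q - 2 * q ^ 2) ≤ 1 - q := by
  have h0 : 0 < 1 - q := by linarith
  rw [← Real.exp_log h0]
  gcongr
  refine le_trans ?_ (one_sub_inv_le_log_of_pos h0)
  rw [← sub_nonneg]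
  have : 1 - (1 - q)⁻¹ - (-q - 2 * q ^ 2) = q ^ 2 * (1 - 2 * q) / (1 - q) := by
    field_simp
    ring
  rw [this]
  have : 0 ≤ 1 - 2 * q := by linarith
  positivity

lemma poissonTail_le_iidLaw_real_hits_le (ρ : Measure F) [IsProbabilityMeasure ρ] {U : Set F}
    (hU : MeasurableSet U) {m k : ℕ} (hmk : k ≤ m) (hq : ρ.real U ≤ 1 / 2) :
    (1 - k / (m + 1)) ^ k * exp (-(2 * (m * ρ.real U ^ 2))) * poissonTail k ((m + 1) * ρ.real U) ≤
      (iidLaw ρ m).real {W | hits U W ≤ k} := by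
  rw [iidLaw_real_hits_le ρ hU, poissonTail, ← mul_assoc, Finset.mul_sum]
  refine Finset.sum_le_sum fun i hi => ?_
  rw [Finset.mem_range, Nat.lt_succ_iff] at hi
  set q := ρ.real U with hqdef
  have hq0 : 0 ≤ q := measureReal_nonneg
  have hk : (0 : ℝ) ≤ 1 - k / (m + 1) := by
    rw [sub_nonneg, div_le_one (by positivity)]
    exact_mod_cast hmk.trans (Nat.le_succ m)
  have hk1 : (1 : ℝ) - k / (m + 1) ≤ 1 := by
    have : (0 : ℝ) ≤ k / (m + 1) := by positivity
    linarith
  have h1 : (1 - k / (m + 1)) ^ k * ((m + 1 : ℝ) ^ i / i.factorial) ≤ m.choose i := by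
    refine le_trans ?_ (Nat.pow_le_choose i m)
    rw [← mul_div_assoc]
    gcongr
    calc (1 - k / (m + 1)) ^ k * (m + 1 : ℝ) ^ i ≤ (1 - k / (m + 1)) ^ i * (m + 1 : ℝ) ^ i := by
          gcongr ?_ * _
          exact pow_le_pow_of_le_one hk hk1 hi
      _ = (m + 1 - k : ℝ) ^ i := by
          rw [← mul_pow]
          congr 1
          field_simp
      _ ≤ _ := by
          have : (k : ℝ) ≤ m := by exact_mod_cast hmk
          have : (i : ℝ) ≤ k := by exact_mod_cast hi
          rw [Nat.cast_sub (by omega)]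
          push_cast
          gcongr
          linarith
  have h2 : exp (-(2 * (m * q ^ 2))) * exp (-((m + 1) * q)) ≤ (1 - q) ^ (m - i) := by
    calc exp (-(2 * (m * q ^ 2))) * exp (-((m + 1) * q)) ≤ exp (m * (-q - 2 * q ^ 2)) := by
          rw [← exp_add]
          gcongr
          nlinarith
      _ = exp (-q - 2 * q ^ 2) ^ m := by rw [← exp_nat_mul]
      _ ≤ (1 - q) ^ m := by
          have := exp_neg_sub_le_one_sub hq
          gcongr
      _ ≤ (1 - q) ^ (m - i) :=
          pow_le_pow_of_le_one (by linarith) (by linarith) (Nat.sub_le _ _)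
  calc _ = ((1 - k / (m + 1)) ^ k * ((m + 1 : ℝ) ^ i / i.factorial)) * q ^ i *
        (exp (-(2 * (m * q ^ 2))) * exp (-((m + 1) * q))) := by rw [mul_pow]; ring
    _ ≤ _ := by gcongr

end PoissonTail

/-- The mean number of neighbours of an interior point at the critical radius. -/
noncomputable def critMean (k : ℕ) (ξ x : ℝ) : ℝ :=
  log x + (2 * k - 1) * log (log x) + ξ

/-- The critical radius for samples of size `x`. -/
noncomputable def critRadius (k : ℕ) (ξ x : ℝ) : ℝ :=
  √(critMean k ξ x / (π * x))

section CriticalRadius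

variable (k : ℕ) (ξ : ℝ)

lemma tendsto_critMean_div_log : Tendsto (fun x => critMean k ξ x / log x) atTop (𝓝 1) := by
  have h1 : Tendsto (fun y : ℝ => 1 + (2 * k - 1) * (log y / y) + ξ / y) atTop (𝓝 1) := by
    have h2 : Tendsto (fun y : ℝ => log y / y) atTop (𝓝 0) :=
      isLittleO_log_id_atTop.tendsto_div_nhds_zero
    simpa using ((h2.const_mul (2 * (k : ℝ) - 1)).const_add 1).add (tendsto_id.const_div_atTop ξ)
  refine (h1.comp tendsto_log_atTop).congr' ?_
  filter_upwards [tendsto_log_atTop.eventually_gt_atTop 0] with x hx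
  simp only [Function.comp, critMean]
  field_simp

lemma tendsto_critMean : Tendsto (critMean k ξ) atTop atTop := by
  have h := (tendsto_critMean_div_log k ξ).pos_mul_atTop one_pos tendsto_log_atTop
  refine h.congr' ?_
  filter_upwards [tendsto_log_atTop.eventually_gt_atTop 0] with x hx
  field_simp

variable {k}

lemma exp_neg_critMean (hk : 1 ≤ k) {x : ℝ} (hx : 0 < x) (hl : 0 < log x) :
    exp (-critMean k ξ x) = x⁻¹ * (log x ^ (2 * k - 1))⁻¹ * exp (-ξ) := by
  have h : ((2 * k - 1 : ℕ) : ℝ) = 2 * k - 1 := by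
    rw [Nat.cast_sub (by omega)]
    push_cast
    ring
  rw [critMean, neg_add, neg_add, exp_add, exp_add, exp_neg (log x), exp_log hx, ← h,
    exp_neg (_ * _), exp_nat_mul, exp_log hl]

lemma tendsto_mul_poissonTail_critMean (hk : 1 ≤ k) :
    Tendsto (fun x => x * poissonTail k (critMean k ξ x)) atTop
      (𝓝 (if k = 1 then exp (-ξ) else 0)) := by
  have hterm : ∀ i ∈ Finset.range (k + 1), Tendsto
      (fun x => exp (-ξ) * ((critMean k ξ x / log x) ^ i *
      (log x ^ i / log x ^ (2 * k - 1)) / i.factorial)) atTop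
      (𝓝 (if i = 1 ∧ k = 1 then exp (-ξ) else 0)) := fun i hi => by
    rw [Finset.mem_range] at hi
    have h1 := (tendsto_critMean_div_log k ξ).pow i
    by_cases h : i = 1 ∧ k = 1
    · rw [if_pos h, h.1, h.2]
      rw [h.1, h.2] at h1
      have h2 : Tendsto (fun x : ℝ => log x ^ 1 / log x ^ (2 * 1 - 1)) atTop (𝓝 1) := by
        refine tendsto_const_nhds.congr' ?_
        filter_upwards [tendsto_log_atTop.eventually_gt_atTop 0] with x hx
        simp [hx.ne']
      simpa using (h1.mul h2).const_mul (exp (-ξ))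
    · rw [if_neg h]
      have hlt : i < 2 * k - 1 := by omega
      have h2 : Tendsto (fun x : ℝ => log x ^ i / log x ^ (2 * k - 1)) atTop (𝓝 0) :=
        (tendsto_pow_div_pow_atTop_zero hlt).comp tendsto_log_atTop
      simpa using ((h1.mul h2).div_const (i.factorial : ℝ)).const_mul (exp (-ξ))
  have h := tendsto_finsetSum _ hterm
  have hsum : (∑ i ∈ Finset.range (k + 1), if i = 1 ∧ k = 1 then exp (-ξ) else 0) =
      if k = 1 then exp (-ξ) else 0 := by
    by_cases h : k = 1
    · simp [h]
    · simp [h]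
  rw [hsum] at h
  refine h.congr' ?_
  filter_upwards [tendsto_log_atTop.eventually_gt_atTop 0, eventually_gt_atTop 0] with x hx hx0
  rw [poissonTail, exp_neg_critMean ξ hk hx0 hx, Finset.mul_sum, Finset.mul_sum]
  refine Finset.sum_congr rfl fun i _ => ?_
  rw [div_pow]
  field_simp

lemma critRadius_sq {x : ℝ} (hx : 0 < x) (hL : 0 ≤ critMean k ξ x) :
    π * x * critRadius k ξ x ^ 2 = critMean k ξ x := by
  rw [critRadius, sq_sqrt (by positivity)]
  field_simp

lemma tendsto_inv_critRadius_mul_exp (hk : 1 ≤ k) :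
    Tendsto (fun x => (2 * critRadius k ξ x)⁻¹ * exp (-(critMean k ξ x / 2)) * log x ^ k) atTop
      (𝓝 (√π * exp (-(ξ / 2)) / 2)) := by
  have h1 : Tendsto (fun x => 2⁻¹ * √(π * exp (-ξ) * (critMean k ξ x / log x)⁻¹)) atTop
      (𝓝 (2⁻¹ * √(π * exp (-ξ) * 1⁻¹))) :=
    ((((tendsto_critMean_div_log k ξ).inv₀ one_ne_zero).const_mul _).sqrt).const_mul _
  have h2 : 2⁻¹ * √(π * exp (-ξ) * 1⁻¹) = √π * exp (-(ξ / 2)) / 2 := by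
    rw [inv_one, mul_one, sqrt_mul pi_pos.le, ← neg_div, exp_half]
    ring
  rw [h2] at h1
  refine h1.congr' ?_
  filter_upwards [tendsto_log_atTop.eventually_gt_atTop 0, eventually_gt_atTop 0,
    (tendsto_critMean k ξ).eventually_gt_atTop 0] with x hx hx0 hL
  rw [show (2 * critRadius k ξ x)⁻¹ * exp (-(critMean k ξ x / 2)) * log x ^ k =
    2⁻¹ * ((critRadius k ξ x)⁻¹ * exp (-(critMean k ξ x / 2)) * log x ^ k) by rw [mul_inv]; ring]
  congr 1
  rw [critRadius, ← sqrt_inv, ← neg_div, exp_half]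
  rw [show log x ^ k = √(log x ^ (2 * k)) by rw [pow_mul', sqrt_sq (by positivity)]]
  rw [← sqrt_mul (by positivity), ← sqrt_mul (by positivity), exp_neg_critMean ξ hk hx0 hx]
  congr 1
  have : log x ^ (2 * k) = log x ^ (2 * k - 1) * log x := by
    rw [← pow_succ]; congr 1; omega
  rw [this]
  field_simp

lemma one_add_pow_le_exp (k : ℕ) {u : ℝ} (hu : 0 ≤ u) :
    (1 + u) ^ k ≤ 8 ^ k * k.factorial * exp ((1 + u) / 8) := by
  have h := pow_div_factorial_le_exp ((1 + u) / 8) (by positivity) k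
  rw [div_pow, div_div, div_le_iff₀ (by positivity)] at h
  linarith

/-- The boundary contribution to the mean number of low degree points. -/
lemma tendsto_lintegral_poissonTail (hk : 1 ≤ k) {H : ℝ → ℝ → ℝ} (hm : ∀ x, Measurable (H x))
    (hle : ∀ᶠ x in atTop, ∀ u, 0 ≤ u → u < 2 / π * critMean k ξ x → H x u ≤ u)
    (hge : ∀ᶠ x in atTop, ∀ u, 0 ≤ u → u < 2 / π * critMean k ξ x →
      u * (1 - u / (2 / π * critMean k ξ x)) ≤ H x u)
    (hge' : ∀ᶠ x in atTop, ∀ u, 0 ≤ u → u < 2 / π * critMean k ξ x → u / 4 ≤ H x u) :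
    Tendsto (fun x => ENNReal.ofReal (2 * critRadius k ξ x)⁻¹ *
      ∫⁻ u in Set.Ico 0 (2 / π * critMean k ξ x),
        ENNReal.ofReal (poissonTail k (critMean k ξ x / 2 + H x u))) atTop
      (𝓝 (ENNReal.ofReal (√π * exp (-(ξ / 2)) / (2 ^ (k + 1) * k.factorial)))) := by
  set W : ℝ → ℝ := fun x => 2 / π * critMean k ξ x with hW
  have hWtop : Tendsto W atTop atTop := (tendsto_critMean k ξ).const_mul_atTop (by positivity)
  set f : ℝ → ℝ → ℝ := fun x u => exp (-H x u) *
    ((∑ i ∈ Finset.range (k + 1), (critMean k ξ x / 2 + H x u) ^ i / i.factorial) / log x ^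
      k) with hf
  have hfm : ∀ x, Measurable (f x) := fun x => by
    have := hm x
    simp only [hf]
    fun_prop
  have hlim : Tendsto (fun x => ∫⁻ u, (Set.Ico 0 (W x)).indicator (fun u => ENNReal.ofReal (f x u))
      u)
      atTop (𝓝 (∫⁻ u, (Set.Ici 0).indicator
        (fun u => ENNReal.ofReal (exp (-u) * ((1 / 2) ^ k / k.factorial))) u)) := by
    refine tendsto_lintegral_filter_of_dominated_convergence
      ((Set.Ici 0).indicator fun u : ℝ => ENNReal.ofReal
        ((k + 1) * (8 ^ k * k.factorial * exp (1 / 8)) * exp ((-1 / 8) * u))) ?_ ?_ ?_ ?_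
    · exact .of_forall fun x => (hfm x).ennreal_ofReal.indicator measurableSet_Ico
    · filter_upwards [hle, hge', tendsto_log_atTop.eventually_ge_atTop 1,
        (tendsto_critMean_div_log k ξ).eventually_le_const one_lt_two,
        (tendsto_critMean k ξ).eventually_ge_atTop 0] with x h1 h2 h3 h4 h5
      refine .of_forall fun u => ?_
      by_cases hu : u ∈ Set.Ico 0 (W x)
      swap
      · rw [Set.indicator_of_notMem hu]; exact zero_le
      have hu0 : 0 ≤ u := hu.1
      rw [Set.indicator_of_mem hu, Set.indicator_of_mem (show u ∈ Set.Ici 0 from hu.1)]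
      have hH1 := h1 u hu.1 hu.2
      have hH2 := h2 u hu.1 hu.2
      have hH0 : 0 ≤ H x u := le_trans (by positivity) hH2
      refine ENNReal.ofReal_le_ofReal ?_
      have hsum : (∑ i ∈ Finset.range (k + 1),
          (critMean k ξ x / 2 + H x u) ^ i / i.factorial) / log x ^ k ≤ (k + 1) * (1 + u) ^ k := by
        rw [Finset.sum_div]
        refine (Finset.sum_le_card_nsmul _ _ ((1 + u) ^ k) fun i hi => ?_).trans (by simp)
        rw [Finset.mem_range, Nat.lt_succ_iff] at hi
        rw [div_le_iff₀ (by positivity : 0 < log x) ] at h4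
        have hb : critMean k ξ x / 2 + H x u ≤ (1 + u) * log x := by nlinarith
        calc (critMean k ξ x / 2 + H x u) ^ i / i.factorial / log x ^ k ≤
            ((1 + u) * log x) ^ i / 1 / log x ^ k := by
              gcongr
              exact_mod_cast i.factorial_pos
          _ ≤ (1 + u) ^ k * log x ^ k / 1 / log x ^ k := by
              rw [mul_pow]
              gcongr
              linarith
          _ = _ := by field_simp
      calc f x u ≤ exp (-(u / 4)) * ((k + 1) * (1 + u) ^ k) := by
            simp only [hf]
            gcongr
        _ ≤ exp (-(u / 4)) * ((k + 1) * (8 ^ k * k.factorial * exp ((1 + u) / 8))) := by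
            gcongr
            exact one_add_pow_le_exp k hu0
        _ = _ := by
            rw [show (1 + u) / 8 = 1 / 8 + u / 8 by ring, exp_add,
              show -1 / 8 * u = -(u / 4) + u / 8 by ring, exp_add]
            ring
    · rw [lintegral_indicator measurableSet_Ici, ← restrict_Ioi_eq_restrict_Ici]
      exact ((integrableOn_exp_mul_Ioi (by norm_num : (-1 / 8 : ℝ) < 0) 0).const_mul
          _).lintegral_lt_top.ne
    · refine .of_forall fun u => ?_
      by_cases hu : 0 ≤ u
      swap
      · refine tendsto_const_nhds.congr fun x => ?_
        rw [Set.indicator_of_notMem (by simp [hu]), Set.indicator_of_notMem (by simp [hu])]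
      rw [Set.indicator_of_mem (show u ∈ Set.Ici 0 from hu)]
      have hHu : Tendsto (fun x => H x u) atTop (𝓝 u) := by
        have hl : Tendsto (fun x => u * (1 - u / W x)) atTop (𝓝 u) := by
          simpa using ((hWtop.const_div_atTop u).const_sub 1).const_mul u
        refine tendsto_of_tendsto_of_tendsto_of_le_of_le' hl tendsto_const_nhds ?_ ?_
        · filter_upwards [hge, hWtop.eventually_gt_atTop u] with x hx hx' using hx u hu hx'
        · filter_upwards [hle, hWtop.eventually_gt_atTop u] with x hx hx' using hx u hu hx'
      have hterm : ∀ i ∈ Finset.range (k + 1), Tendsto (fun x =>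
          (critMean k ξ x / log x / 2 + H x u / log x) ^ i * (log x ^ i / log x ^ k) / i.factorial)
          atTop (𝓝 (if i = k then (1 / 2) ^ k / k.factorial else 0)) := fun i hi => by
        rw [Finset.mem_range, Nat.lt_succ_iff] at hi
        have h1 : Tendsto (fun x => critMean k ξ x / log x / 2 + H x u / log x) atTop
            (𝓝 (1 / 2)) := by
          simpa using ((tendsto_critMean_div_log k ξ).div_const 2).add
            (hHu.div_atTop tendsto_log_atTop)
        rcases hi.lt_or_eq with hi | hi
        · have h2 : Tendsto (fun x : ℝ => log x ^ i / log x ^ k) atTop (𝓝 0) :=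
            (tendsto_pow_div_pow_atTop_zero hi).comp tendsto_log_atTop
          rw [if_neg hi.ne]
          simpa using ((h1.pow i).mul h2).div_const (i.factorial : ℝ)
        · subst hi
          have h2 : Tendsto (fun x : ℝ => log x ^ i / log x ^ i) atTop (𝓝 1) := by
            refine tendsto_const_nhds.congr' ?_
            filter_upwards [tendsto_log_atTop.eventually_gt_atTop 0] with x hx
            rw [div_self (by positivity)]
          rw [if_pos rfl]
          have h3 := ((h1.pow i).mul h2).div_const (i.factorial : ℝ)
          rwa [mul_one] at h3
      have hs := tendsto_finsetSum _ hterm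
      rw [Finset.sum_ite_eq' (Finset.range (k + 1)) k, if_pos (by simp)] at hs
      have hE : Tendsto (fun x => exp (-H x u)) atTop (𝓝 (exp (-u))) :=
        (continuous_exp.tendsto _).comp hHu.neg
      refine (ENNReal.tendsto_ofReal (hE.mul hs)).congr' ?_
      filter_upwards [hWtop.eventually_gt_atTop u, tendsto_log_atTop.eventually_gt_atTop 0] with x
          hx hx'
      rw [Set.indicator_of_mem (Set.mem_Ico.2 ⟨hu, hx⟩)]
      simp only [hf]
      congr 2
      rw [Finset.sum_div]
      refine Finset.sum_congr rfl fun i _ => ?_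
      rw [show critMean k ξ x / log x / 2 + H x u / log x = (critMean k ξ x / 2 + H x u) / log x by
        field_simp, div_pow]
      field_simp
  have hconst : ∫⁻ u, (Set.Ici 0).indicator
        (fun u => ENNReal.ofReal (exp (-u) * ((1 / 2) ^ k / k.factorial))) u =
        ENNReal.ofReal ((1 / 2) ^ k / k.factorial) := by
    rw [lintegral_indicator measurableSet_Ici, ← restrict_Ioi_eq_restrict_Ici,
      ← ofReal_integral_eq_lintegral_ofReal ((integrableOn_exp_neg_Ioi 0).mul_const _)
        (.of_forall fun u => by positivity), integral_mul_const, integral_exp_neg_Ioi_zero, one_mul]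
  rw [hconst] at hlim
  have hc := ENNReal.tendsto_ofReal (tendsto_inv_critRadius_mul_exp ξ hk)
  have hmul := ENNReal.Tendsto.mul hc (.inr ENNReal.ofReal_ne_top) hlim (.inr ENNReal.ofReal_ne_top)
  rw [← ENNReal.ofReal_mul (by positivity)] at hmul
  have heq : √π * exp (-(ξ / 2)) / 2 * ((1 / 2) ^ k / k.factorial) =
      √π * exp (-(ξ / 2)) / (2 ^ (k + 1) * k.factorial) := by
    rw [one_div, inv_pow, pow_succ]
    field_simp
  rw [heq] at hmul
  refine hmul.congr' ?_
  filter_upwards [tendsto_log_atTop.eventually_gt_atTop 0] with x hx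
  have hr : 0 ≤ critRadius k ξ x := sqrt_nonneg _
  rw [mul_assoc, ENNReal.ofReal_mul (by positivity), mul_assoc]
  congr 1
  rw [← lintegral_const_mul _ ((hfm x).ennreal_ofReal.indicator measurableSet_Ico),
    ← lintegral_indicator measurableSet_Ico]
  refine lintegral_congr fun u => ?_
  by_cases hu : u ∈ Set.Ico 0 (W x)
  · rw [Set.indicator_of_mem hu, Set.indicator_of_mem hu, ← ENNReal.ofReal_mul (by positivity)]
    congr 1
    simp only [hf]
    rw [poissonTail, neg_add, exp_add]
    field_simp
  · rw [Set.indicator_of_notMem hu, Set.indicator_of_notMem hu, mul_zero]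

end CriticalRadius

/-- Integrals of antitone functions are monotone with respect to the masses of the initial
intervals. -/
lemma setLIntegral_le_of_antitoneOn {ν₁ ν₂ : Measure ℝ} {φ : ℝ → ℝ} {w : ℝ} (hm : Measurable φ)
    (hφ : AntitoneOn φ (Set.Ico 0 w)) (h0 : ∀ u ∈ Set.Ico 0 w, 0 ≤ φ u)
    (hIcc : ∀ a, 0 ≤ a → a < w → ν₁ (Set.Icc 0 a) ≤ ν₂ (Set.Icc 0 a))
    (hIco : ∀ a, 0 ≤ a → a ≤ w → ν₁ (Set.Ico 0 a) ≤ ν₂ (Set.Ico 0 a)) :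
    ∫⁻ u in Set.Ico 0 w, ENNReal.ofReal (φ u) ∂ν₁ ≤ ∫⁻ u in Set.Ico 0 w, ENNReal.ofReal
        (φ u) ∂ν₂ := by
  rw [lintegral_eq_lintegral_meas_lt _ ((ae_restrict_iff' measurableSet_Ico).2 (.of_forall h0))
      hm.aemeasurable,
    lintegral_eq_lintegral_meas_lt _ ((ae_restrict_iff' measurableSet_Ico).2 (.of_forall h0))
      hm.aemeasurable]
  refine lintegral_mono fun s => ?_
  have hs : MeasurableSet {a | s < φ a} := measurableSet_lt measurable_const hm
  rw [Measure.restrict_apply hs, Measure.restrict_apply hs]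
  set S := {a | s < φ a} ∩ Set.Ico 0 w with hS
  have hlow : ∀ a ∈ S, ∀ b, 0 ≤ b → b ≤ a → b ∈ S := fun a ha b hb hba =>
    ⟨lt_of_lt_of_le ha.1 (hφ ⟨hb, hba.trans_lt ha.2.2⟩ ha.2 hba), hb, hba.trans_lt ha.2.2⟩
  rcases S.eq_empty_or_nonempty with he | hne
  · simp [he]
  have hbdd : BddAbove S := ⟨w, fun a ha => ha.2.2.le⟩
  obtain ⟨a₀, ha₀⟩ := hne
  have hsup0 : 0 ≤ sSup S := ha₀.2.1.trans (le_csSup hbdd ha₀)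
  by_cases hmem : sSup S ∈ S
  · have : S = Set.Icc 0 (sSup S) := by
      ext b
      exact ⟨fun hb => ⟨hb.2.1, le_csSup hbdd hb⟩, fun hb => hlow _ hmem b hb.1 hb.2⟩
    rw [this]
    exact hIcc _ hsup0 hmem.2.2
  · have : S = Set.Ico 0 (sSup S) := by
      ext b
      refine ⟨fun hb => ⟨hb.2.1, (le_csSup hbdd hb).lt_of_ne fun h => hmem (h ▸ hb)⟩, fun hb => ?_⟩
      obtain ⟨a, ha, hab⟩ := exists_lt_of_lt_csSup ⟨a₀, ha₀⟩ hb.2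
      exact hlow a ha b hb.1 hab.le
    rw [this]
    exact hIco _ hsup0 (csSup_le ⟨a₀, ha₀⟩ fun b hb => hb.2.2.le)

/-- The Euclidean plane. -/
abbrev Plane := EuclideanSpace ℝ (Fin 2)

/-- The coordinate of `x` along the unit vector of angle `θ`. -/
noncomputable def height (θ : ℝ) (x : Plane) : ℝ := x 0 * cos θ + x 1 * sin θ

/-- The coordinate of `x` along the unit vector of angle `θ + π / 2`. -/
noncomputable def side (θ : ℝ) (x : Plane) : ℝ := x 1 * cos θ - x 0 * sin θ

/-- The point with prescribed `side θ` and `height θ`. -/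
noncomputable def planePoint (θ a b : ℝ) : Plane :=
  !₂[b * cos θ - a * sin θ, b * sin θ + a * cos θ]

section Coordinates

variable (θ : ℝ)

@[simp] lemma height_sub (x y : Plane) : height θ (x - y) = height θ x - height θ y := by
  simp [height]; ring

@[simp] lemma height_add (x y : Plane) : height θ (x + y) = height θ x + height θ y := by
  simp [height]; ring

@[simp] lemma height_smul (a : ℝ) (x : Plane) : height θ (a • x) = a * height θ x := by
  simp [height]; ring

@[simp] lemma side_sub (x y : Plane) : side θ (x - y) = side θ x - side θ y := by
  simp [side]; ring

@[simp] lemma side_add (x y : Plane) : side θ (x + y) = side θ x + side θ y := by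
  simp [side]; ring

@[simp] lemma side_smul (a : ℝ) (x : Plane) : side θ (a • x) = a * side θ x := by
  simp [side]; ring

@[simp] lemma height_planePoint (a b : ℝ) : height θ (planePoint θ a b) = b := by
  simp [height, planePoint]
  linear_combination b * sin_sq_add_cos_sq θ

@[simp] lemma side_planePoint (a b : ℝ) : side θ (planePoint θ a b) = a := by
  simp [side, planePoint]
  linear_combination a * sin_sq_add_cos_sq θ

lemma continuous_height : Continuous (height θ) := by
  unfold height; fun_prop

lemma continuous_side : Continuous (side θ) := by
  unfold side; fun_prop

lemma continuous_height_uncurry : Continuous fun p : ℝ × Plane => height p.1 p.2 := by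
  unfold height; fun_prop

lemma continuous_planePoint_uncurry : Continuous fun p : ℝ × ℝ × ℝ => planePoint p.1 p.2.1
    p.2.2 := by
  refine (PiLp.continuous_toLp 2 _).comp (continuous_pi fun i => ?_)
  fin_cases i <;> simp <;> fun_prop

lemma norm_sq_eq_side_height (x : Plane) : ‖x‖ ^ 2 = side θ x ^ 2 + height θ x ^ 2 := by
  rw [EuclideanSpace.real_norm_sq_eq, Fin.sum_univ_two, side, height]
  linear_combination (-(x 0 ^ 2 + x 1 ^ 2)) * sin_sq_add_cos_sq θ

lemma abs_side_le_norm (x : Plane) : |side θ x| ≤ ‖x‖ :=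
  abs_le_of_sq_le_sq (by nlinarith [norm_sq_eq_side_height θ x, sq_nonneg (height θ x)])
      (norm_nonneg _)

lemma abs_height_le_norm (x : Plane) : |height θ x| ≤ ‖x‖ :=
  abs_le_of_sq_le_sq (by nlinarith [norm_sq_eq_side_height θ x, sq_nonneg (side θ x)])
      (norm_nonneg _)

lemma norm_le_abs_side_add_abs_height (x : Plane) : ‖x‖ ≤ |side θ x| + |height θ x| := by
  refine abs_le_of_sq_le_sq' ?_ (by positivity) |>.2
  rw [norm_sq_eq_side_height θ, add_sq, sq_abs, sq_abs]
  have : 0 ≤ 2 * |side θ x| * |height θ x| := by positivity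
  linarith

variable {θ} in
lemma plane_ext {x y : Plane} (hs : side θ x = side θ y) (hh : height θ x = height θ y) : x =
    y := by
  have h := norm_sq_eq_side_height θ (x - y)
  rw [side_sub, height_sub, hs, hh, sub_self, sub_self] at h
  exact sub_eq_zero.1 (norm_eq_zero.1 (by nlinarith))

lemma planePoint_side_height (x : Plane) : planePoint θ (side θ x) (height θ x) = x :=
  plane_ext (θ := θ) (by simp) (by simp)

lemma height_eq_cos_mul_add (φ : ℝ) (x : Plane) :
    height φ x = cos (φ - θ) * height θ x + sin (φ - θ) * side θ x := by
  rw [cos_sub, sin_sub, height, height, side]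
  linear_combination (-(x 0 * cos φ + x 1 * sin φ)) * sin_sq_add_cos_sq θ

lemma side_eq_cos_mul_sub (φ : ℝ) (x : Plane) :
    side φ x = cos (φ - θ) * side θ x - sin (φ - θ) * height θ x := by
  rw [cos_sub, sin_sub, height, side, side]
  linear_combination (-(x 1 * cos φ - x 0 * sin φ)) * sin_sq_add_cos_sq θ

/-- Every vector has a direction. -/
lemma exists_eq_planePoint (x : Plane) : ∃ φ, x = planePoint φ 0 ‖x‖ := by
  refine ⟨Complex.arg ⟨x 0, x 1⟩, ?_⟩
  have hn : ‖(⟨x 0, x 1⟩ : ℂ)‖ = ‖x‖ := by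
    rw [Complex.norm_eq_sqrt_sq_add_sq, EuclideanSpace.norm_eq, Fin.sum_univ_two]
    simp
  have h1 := Complex.norm_mul_cos_arg ⟨x 0, x 1⟩
  have h2 := Complex.norm_mul_sin_arg ⟨x 0, x 1⟩
  rw [hn] at h1 h2
  ext i
  fin_cases i
  · simp [planePoint, h1]
  · simp [planePoint, h2]

/-- The coordinates `(side θ, height θ)` preserve area. -/
lemma measurePreserving_side_height :
    MeasurePreserving (fun x : Plane => (side θ x, height θ x)) volume volume := by
  set A : Matrix (Fin 2) (Fin 2) ℝ := !![-sin θ, cos θ; cos θ, sin θ] with hA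
  have hdet : A.det = -1 := by
    rw [hA, Matrix.det_fin_two_of]
    linear_combination -sin_sq_add_cos_sq θ
  have h1 : MeasurePreserving (Matrix.toLin' A) volume volume := by
    refine ⟨(LinearMap.continuous_of_finiteDimensional _).measurable, ?_⟩
    rw [Real.map_matrix_volume_pi_eq_smul_volume_pi (by rw [hdet]; norm_num), hdet]
    norm_num
  have h := (volume_preserving_finTwoArrow ℝ).comp
    (h1.comp (EuclideanSpace.volume_preserving_symm_measurableEquiv_toLp (Fin 2)))
  have heq : (fun x : Plane => (side θ x, height θ x)) = MeasurableEquiv.finTwoArrow ∘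
      Matrix.toLin' A ∘ (MeasurableEquiv.toLp 2 (Fin 2 → ℝ)).symm := by
    funext x
    have h0 : (Matrix.toLin' A (WithLp.ofLp x)) 0 = side θ x := by
      simp [hA, side, Matrix.toLin'_apply, Matrix.mulVec, dotProduct, Fin.sum_univ_two]
      ring
    have h1 : (Matrix.toLin' A (WithLp.ofLp x)) 1 = height θ x := by
      simp [hA, height, Matrix.toLin'_apply, Matrix.mulVec, dotProduct, Fin.sum_univ_two]
      ring
    exact Prod.ext h0.symm h1.symm
  rw [heq]
  exact h

lemma volume_preimage_side_height {S : Set (ℝ × ℝ)} (hS : MeasurableSet S) :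
    volume {x : Plane | (side θ x, height θ x) ∈ S} = volume S :=
  (measurePreserving_side_height θ).measure_preimage hS.nullMeasurableSet

end Coordinates

/-- The part of the disc of radius `r` below height `t`. -/
def discBelow (r t : ℝ) : Set (ℝ × ℝ) := {p | p.1 ^ 2 + p.2 ^ 2 ≤ r ^ 2 ∧ p.2 ≤ t}

/-- The area of `discBelow r t`. -/
noncomputable def capArea (r t : ℝ) : ℝ := (volume (discBelow r t)).toReal

section CapArea

lemma measurableSet_discBelow (r t : ℝ) : MeasurableSet (discBelow r t) :=
  (measurableSet_le (f := fun p : ℝ × ℝ => p.1 ^ 2 + p.2 ^ 2) (by fun_prop)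
    measurable_const).inter (measurableSet_le measurable_snd measurable_const)

lemma volume_closedBall_height_le (θ r t : ℝ) (hr : 0 ≤ r) (x : Plane) :
    volume {z ∈ closedBall x r | height θ (z - x) ≤ t} = volume (discBelow r t) := by
  rw [← volume_preimage_side_height θ (measurableSet_discBelow r t)]
  rw [← (measurePreserving_sub_right volume x).measure_preimage_emb
    (MeasurableEquiv.subRight x).measurableEmbedding
    {z : Plane | (side θ z, height θ z) ∈ discBelow r t}]
  congr 1
  ext z
  simp only [Set.mem_ofPred_eq, mem_closedBall, dist_eq_norm, discBelow, Set.mem_preimage]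
  rw [← norm_sq_eq_side_height, sq_le_sq₀ (norm_nonneg _) hr]

lemma volume_discBelow_self {r : ℝ} (hr : 0 ≤ r) {t : ℝ} (ht : r ≤ t) :
    volume (discBelow r t) = ENNReal.ofReal (π * r ^ 2) := by
  rw [← volume_closedBall_height_le 0 r t hr 0]
  have : {z ∈ closedBall (0 : Plane) r | height 0 (z - 0) ≤ t} = closedBall 0 r := by
    ext z
    simp only [Set.mem_ofPred_eq, and_iff_left_iff_imp, mem_closedBall, dist_eq_norm]
    exact fun h => ((le_abs_self _).trans (abs_height_le_norm 0 _)).trans (h.trans ht)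
  rw [this, EuclideanSpace.volume_closedBall_fin_two]
  rw [mul_comm π, ENNReal.ofReal_mul (by positivity), ENNReal.ofReal_pow hr]

lemma volume_discBelow_ne_top {r : ℝ} (hr : 0 ≤ r) (t : ℝ) : volume (discBelow r t) ≠ ∞ := by
  refine ((measure_mono (t := discBelow r (max r t)) fun p hp => ?_).trans_lt
    ((volume_discBelow_self hr (le_max_left r t)).trans_lt ENNReal.ofReal_lt_top)).ne
  exact ⟨hp.1, hp.2.trans (le_max_right _ _)⟩

lemma capArea_mono {r : ℝ} (hr : 0 ≤ r) : Monotone (capArea r) := fun _ t hst =>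
  ENNReal.toReal_mono (volume_discBelow_ne_top hr t)
    (measure_mono fun _ hp => ⟨hp.1, hp.2.trans hst⟩)

lemma capArea_self {r : ℝ} (hr : 0 ≤ r) {t : ℝ} (ht : r ≤ t) : capArea r t = π * r ^ 2 := by
  rw [capArea, volume_discBelow_self hr ht, ENNReal.toReal_ofReal (by positivity)]

lemma capArea_sub_eq {r : ℝ} (hr : 0 ≤ r) {s t : ℝ} (hst : s ≤ t) :
    capArea r t = capArea r s +
      (volume {p : ℝ × ℝ | p.1 ^ 2 + p.2 ^ 2 ≤ r ^ 2 ∧ s < p.2 ∧ p.2 ≤ t}).toReal := by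
  have h : discBelow r t =
      discBelow r s ∪ {p : ℝ × ℝ | p.1 ^ 2 + p.2 ^ 2 ≤ r ^ 2 ∧ s < p.2 ∧ p.2 ≤ t} := by
    ext p
    simp only [discBelow, Set.mem_ofPred_eq, Set.mem_union]
    constructor
    · rintro ⟨h1, h2⟩
      rcases le_or_gt p.2 s with h | h
      · exact .inl ⟨h1, h⟩
      · exact .inr ⟨h1, h, h2⟩
    · rintro (⟨h1, h2⟩ | ⟨h1, h2, h3⟩)
      · exact ⟨h1, h2.trans hst⟩
      · exact ⟨h1, h3⟩
  have hd : Disjoint (discBelow r s) {p : ℝ × ℝ | p.1 ^ 2 + p.2 ^ 2 ≤ r ^ 2 ∧ s < p.2 ∧ p.2 ≤ t} :=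
    Set.disjoint_left.2 fun p hp hp' => absurd hp.2 (not_le.2 hp'.2.1)
  have htop := volume_discBelow_ne_top hr t
  rw [capArea, h] at *
  rw [measure_union' hd (measurableSet_discBelow r s)] at *
  rw [ENNReal.toReal_add (ENNReal.add_ne_top.1 htop).1 (ENNReal.add_ne_top.1 htop).2, capArea]

lemma capArea_sub_le {r : ℝ} (hr : 0 ≤ r) {s t : ℝ} (hst : s ≤ t) :
    capArea r t ≤ capArea r s + 2 * r * (t - s) := by
  rw [capArea_sub_eq hr hst]
  gcongr
  refine ENNReal.toReal_le_of_le_ofReal (by have := sub_nonneg.2 hst; positivity) ?_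
  refine (measure_mono (t := Set.Icc (-r) r ×ˢ Set.Ioc s t) fun p hp => ?_).trans ?_
  · exact ⟨abs_le.1 (abs_le_of_sq_le_sq (by nlinarith [hp.1, sq_nonneg p.2]) hr), hp.2⟩
  · rw [Measure.volume_eq_prod, Measure.prod_prod, Real.volume_Icc, Real.volume_Ioc,
      ← ENNReal.ofReal_mul (by linarith)]
    refine ENNReal.ofReal_le_ofReal (le_of_eq (by ring))

lemma le_capArea {r : ℝ} (hr : 0 ≤ r) {t : ℝ} (ht : 0 ≤ t) (htr : t ≤ r) :
    capArea r 0 + 2 * t * (r - t) ≤ capArea r t := by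
  rw [capArea_sub_eq hr ht]
  gcongr
  have htop : volume {p : ℝ × ℝ | p.1 ^ 2 + p.2 ^ 2 ≤ r ^ 2 ∧ 0 < p.2 ∧ p.2 ≤ t} ≠ ∞ :=
    measure_ne_top_of_subset (s := discBelow r t) (fun p hp => ⟨hp.1, hp.2.2⟩)
      (volume_discBelow_ne_top hr t)
  rw [← ENNReal.ofReal_le_iff_le_toReal htop]
  refine le_trans (le_of_eq ?_) (measure_mono (s := Set.Icc (-(r - t)) (r - t) ×ˢ Set.Ioc 0 t)
    (t := {p : ℝ × ℝ | p.1 ^ 2 + p.2 ^ 2 ≤ r ^ 2 ∧ 0 < p.2 ∧ p.2 ≤ t}) fun p hp => ⟨?_, hp.2⟩)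
  · rw [Measure.volume_eq_prod, Measure.prod_prod, Real.volume_Icc, Real.volume_Ioc,
      ← ENNReal.ofReal_mul (by linarith)]
    congr 1
    ring
  · have h1 : p.1 ^ 2 ≤ (r - t) ^ 2 := sq_le_sq' hp.1.1 hp.1.2
    have h2 : p.2 ^ 2 ≤ t ^ 2 := pow_le_pow_left₀ hp.2.1.le hp.2.2 2
    nlinarith

lemma le_capArea' {r : ℝ} (hr : 0 ≤ r) {t : ℝ} (ht : 0 ≤ t) (htr : t ≤ r) :
    capArea r 0 + r * t / 2 ≤ capArea r t := by
  rcases le_total t (r / 2) with h | h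
  · refine le_trans ?_ (le_capArea hr ht htr)
    nlinarith
  · refine le_trans ?_ (capArea_mono hr h)
    refine le_trans ?_ (le_capArea hr (by linarith) (by linarith))
    nlinarith

lemma capArea_zero {r : ℝ} (hr : 0 ≤ r) : capArea r 0 = π * r ^ 2 / 2 := by
  have h1 := capArea_sub_eq hr hr
  rw [capArea_self hr le_rfl] at h1
  have h2 : volume {p : ℝ × ℝ | p.1 ^ 2 + p.2 ^ 2 ≤ r ^ 2 ∧ 0 < p.2 ∧ p.2 ≤ r} =
      volume (discBelow r 0) := by
    have hmp : MeasurePreserving (fun p : ℝ × ℝ => (p.1, -p.2)) volume volume :=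
      (MeasurePreserving.id volume).prod (Measure.measurePreserving_neg volume)
    have hnull : volume {p : ℝ × ℝ | p.2 = 0} = 0 := by
      have : {p : ℝ × ℝ | p.2 = 0} = Set.univ ×ˢ {0} := by ext; simp
      rw [this, Measure.volume_eq_prod, Measure.prod_prod]
      simp
    rw [← hmp.measure_preimage (measurableSet_discBelow r 0).nullMeasurableSet]
    refine le_antisymm (measure_mono fun p hp => ?_) ?_
    · refine ⟨by simpa using hp.1, by simpa using hp.2.1.le⟩
    · rw [← add_zero (volume {p : ℝ × ℝ | p.1 ^ 2 + p.2 ^ 2 ≤ r ^ 2 ∧ 0 < p.2 ∧ p.2 ≤ r}), ← hnull]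
      refine (measure_mono fun p hp => ?_).trans (measure_union_le _ _)
      have h3 : p.1 ^ 2 + p.2 ^ 2 ≤ r ^ 2 := by simpa using hp.1
      have h4 : 0 ≤ p.2 := by simpa using hp.2
      rcases h4.eq_or_lt with h | h
      · exact .inr h.symm
      · exact .inl ⟨h3, h, abs_le_of_sq_le_sq' (by nlinarith [sq_nonneg p.1]) hr |>.2⟩
  rw [h2] at h1
  change π * r ^ 2 = capArea r 0 + capArea r 0 at h1
  linarith

end CapArea

/-- `b` is a highest point of `Ω` in the direction of angle `φ`. -/
def IsHighest (Ω : Set Plane) (φ : ℝ) (b : Plane) : Prop :=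
  b ∈ Ω ∧ ∀ x ∈ Ω, height φ x ≤ height φ b

section Support

variable {Ω : Set Plane}

lemma exists_angle_mem_Ico (φ : ℝ) :
    ∃ φ' ∈ Set.Ico 0 (2 * π), height φ' = height φ ∧ side φ' = side φ := by
  have hp : (0 : ℝ) < 2 * π := by positivity
  refine ⟨toIcoMod hp 0 φ, by simpa using toIcoMod_mem_Ico hp 0 φ, ?_⟩
  have h := toIcoMod_add_toIcoDiv_zsmul hp 0 φ
  rw [zsmul_eq_mul] at h
  have hc := cos_add_int_mul_two_pi (toIcoMod hp 0 φ) (toIcoDiv hp 0 φ)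
  have hs := sin_add_int_mul_two_pi (toIcoMod hp 0 φ) (toIcoDiv hp 0 φ)
  rw [h] at hc hs
  constructor
  · funext x
    rw [height, height, hc, hs]
  · funext x
    rw [side, side, hc, hs]

lemma height_add_two_pi (φ : ℝ) : height (φ + 2 * π) = height φ := by
  funext x; simp [height]

lemma side_add_two_pi (φ : ℝ) : side (φ + 2 * π) = side φ := by
  funext x; simp [side]

lemma exists_eq_mul_height (f : Plane →L[ℝ] ℝ) : ∃ φ a, 0 ≤ a ∧ ∀ x, f x = a * height φ x := by
  obtain ⟨φ, hφ⟩ := exists_eq_planePoint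
    (!₂[f (EuclideanSpace.single 0 1), f (EuclideanSpace.single 1 1)] : Plane)
  refine ⟨φ, ‖(!₂[f (EuclideanSpace.single 0 1), f (EuclideanSpace.single 1 1)] : Plane)‖,
    norm_nonneg _, fun x => ?_⟩
  have h0 := congrArg (fun v : Plane => v 0) hφ
  have h1 := congrArg (fun v : Plane => v 1) hφ
  simp only [planePoint] at h0 h1
  have hx : x = x 0 • EuclideanSpace.single 0 (1 : ℝ) + x 1 • EuclideanSpace.single 1 (1 : ℝ) := by
    ext i
    fin_cases i <;> simp
  have hf : f x = x 0 * f (EuclideanSpace.single 0 1) + x 1 * f (EuclideanSpace.single 1 1) := by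
    conv_lhs => rw [hx]
    simp
  rw [hf, height]
  simp at h0 h1
  linear_combination x 0 * h0 + x 1 * h1

/-- A frontier point of a convex body has an outer normal. -/
lemma exists_isHighest_of_mem_frontier (hconv : Convex ℝ Ω) (hcl : IsClosed Ω)
    (hint : (interior Ω).Nonempty) {y : Plane} (hy : y ∈ frontier Ω) : ∃ φ, IsHighest Ω φ y := by
  obtain ⟨f, hf⟩ := geometric_hahn_banach_open_point hconv.interior isOpen_interior hy.2
  obtain ⟨φ, a, ha, hfa⟩ := exists_eq_mul_height f
  obtain ⟨z, hz⟩ := hint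
  have ha' : 0 < a := by
    refine ha.lt_of_ne fun h => ?_
    have := hf z hz
    rw [hfa, hfa, ← h] at this
    simp at this
  refine ⟨φ, hcl.frontier_subset hy, ?_⟩
  have hsub : interior Ω ⊆ {x | height φ x ≤ height φ y} := fun x hx => by
    have := hf x hx
    rw [hfa, hfa] at this
    exact (lt_of_mul_lt_mul_left this ha).le
  have hcl' : IsClosed {x | height φ x ≤ height φ y} :=
    isClosed_le (continuous_height φ) continuous_const
  intro x hx
  have := closure_minimal hsub hcl'
  rw [hconv.closure_interior_eq_closure_of_nonempty_interior ⟨z, hz⟩, hcl.closure_eq] at this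
  exact this hx

lemma nonempty_compl_of_isCompact (hcomp : IsCompact Ω) : Ωᶜ.Nonempty := by
  rw [Set.nonempty_compl]
  exact hcomp.ne_univ

lemma closedBall_subset_of_le_infDist (hcl : IsClosed Ω) {x : Plane} (hx : x ∈ Ω) {t : ℝ}
    (ht : t ≤ infDist x Ωᶜ) : closedBall x t ⊆ Ω := by
  rcases eq_or_ne t 0 with h0 | h0
  · rw [h0, closedBall_zero]
    exact Set.singleton_subset_iff.2 hx
  · rw [← closure_ball x h0]
    exact closure_minimal ((ball_subset_ball ht).trans ball_infDist_compl_subset) hcl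

lemma le_infDist_of_closedBall_subset (hcomp : IsCompact Ω) {x : Plane} {t : ℝ}
    (h : closedBall x t ⊆ Ω) : t ≤ infDist x Ωᶜ := by
  rw [le_infDist (nonempty_compl_of_isCompact hcomp)]
  intro y hy
  by_contra! hlt
  exact hy (h (by rw [mem_closedBall, dist_comm]; exact hlt.le))

/-- A point of a convex body lies below its nearest frontier point, along an outer normal. -/
lemma exists_isHighest_eq_sub (hconv : Convex ℝ Ω) (hcomp : IsCompact Ω)
    (hint : (interior Ω).Nonempty)
    {x : Plane} (hx : x ∈ Ω) :
    ∃ φ b, IsHighest Ω φ b ∧ b ∈ frontier Ω ∧ x = b - planePoint φ 0 (infDist x Ωᶜ) := by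
  obtain ⟨y, hy, hxy⟩ := isClosed_closure.exists_infDist_eq_dist
    (nonempty_compl_of_isCompact hcomp).closure x
  rw [infDist_closure] at hxy
  have hyΩ : y ∈ Ω := closedBall_subset_of_le_infDist hcomp.isClosed hx le_rfl
    (by rw [mem_closedBall, dist_comm, hxy])
  have hyf : y ∈ frontier Ω := by
    rw [closure_compl] at hy
    exact ⟨subset_closure hyΩ, hy⟩
  obtain ⟨φ, hφ⟩ := exists_isHighest_of_mem_frontier hconv hcomp.isClosed hint hyf
  refine ⟨φ, y, hφ, hyf, ?_⟩
  set d := infDist x Ωᶜ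
  have hd : 0 ≤ d := infDist_nonneg
  have hnorm : ‖planePoint φ 0 d‖ = d := by
    have := norm_sq_eq_side_height φ (planePoint φ 0 d)
    rw [side_planePoint, height_planePoint] at this
    exact (pow_left_inj₀ (norm_nonneg _) hd two_ne_zero).1 (by linarith)
  have hmem : x + planePoint φ 0 d ∈ Ω :=
    closedBall_subset_of_le_infDist hcomp.isClosed hx le_rfl (by
      rw [mem_closedBall, dist_eq_norm, add_sub_cancel_left, hnorm])
  have h1 := hφ.2 _ hmem
  rw [height_add, height_planePoint] at h1
  have h2 := norm_sq_eq_side_height φ (y - x)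
  rw [← dist_eq_norm, dist_comm, ← hxy, side_sub, height_sub] at h2
  have h3 : side φ y - side φ x = 0 := by
    have h4 : d ^ 2 ≤ (height φ y - height φ x) ^ 2 := by
      gcongr; linarith
    nlinarith [sq_nonneg (side φ y - side φ x)]
  have h5 : height φ y - height φ x = d := by
    rw [h3] at h2
    exact (pow_left_inj₀ (by linarith) hd two_ne_zero).1 (by linarith)
  refine plane_ext (θ := φ) ?_ ?_
  · rw [side_sub, side_planePoint]; linarith
  · rw [height_sub, height_planePoint]; linarith

end Support

section Nodes

/-- The highest point of `Ω` in direction `θ`; when there are several, the first one. -/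
def IsFirstHighest (Ω : Set Plane) (θ : ℝ) (b : Plane) : Prop :=
  IsHighest Ω θ b ∧ ∀ x, IsHighest Ω θ x → side θ b ≤ side θ x

variable {Ω : Set Plane}

lemma exists_isFirstHighest (hcomp : IsCompact Ω) (hne : Ω.Nonempty) (θ : ℝ) :
    ∃ b, IsFirstHighest Ω θ b := by
  obtain ⟨a, ha, hmax⟩ := hcomp.exists_isMaxOn hne (continuous_height θ).continuousOn
  have hc : IsCompact (Ω ∩ {x | height θ a ≤ height θ x}) :=
    hcomp.inter_right (isClosed_le continuous_const (continuous_height θ))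
  obtain ⟨b, hb, hmin⟩ := hc.exists_isMinOn ⟨a, ha, (le_refl (height θ a) : _)⟩
      (continuous_side θ).continuousOn
  refine ⟨b, ⟨hb.1, fun x hx => (hmax hx).trans hb.2⟩, fun x hx => hmin ⟨hx.1, hx.2 a ha⟩⟩

lemma IsFirstHighest.unique {θ : ℝ} {a b : Plane} (ha : IsFirstHighest Ω θ a)
    (hb : IsFirstHighest Ω θ b) :
    a = b :=
  plane_ext (θ := θ) (le_antisymm (ha.2 b hb.1) (hb.2 a ha.1))
    (le_antisymm (hb.1.2 a ha.1.1) (ha.1.2 b hb.1.1))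

lemma isFirstHighest_congr {θ φ : ℝ} {b : Plane} (hh : height θ = height φ) (hs : side θ = side φ) :
    IsFirstHighest Ω θ b ↔ IsFirstHighest Ω φ b := by
  simp only [IsFirstHighest, IsHighest, hh, hs]

lemma isHighest_congr {θ φ : ℝ} {b : Plane} (hh : height θ = height φ) :
    IsHighest Ω θ b ↔ IsHighest Ω φ b := by
  simp only [IsHighest, hh]

lemma sin_mul_height_eq (α β γ : ℝ) (x : Plane) :
    sin (γ - α) * height β x = sin (γ - β) * height α x + sin (β - α) * height γ x := by
  simp only [sin_sub, height]
  ring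

lemma sin_mul_side_eq (α β γ : ℝ) (x : Plane) :
    sin (β - α) * side γ x = cos (γ - α) * height β x - cos (β - γ) * height α x := by
  rw [height_eq_cos_mul_add γ α, height_eq_cos_mul_add γ β, ← cos_neg (γ - α), neg_sub,
    show β - α = (β - γ) - (α - γ) by ring, sin_sub]
  ring

/-- Highest points advance with the direction. -/
lemma IsHighest.side_le_side {α β γ : ℝ} {a b : Plane} (ha : IsHighest Ω α a) (hb : IsHighest Ω β b)
    (hαβ : α < β) (hβα : β < α + π) (hγα : |γ - α| ≤ π / 2) (hγβ : |β - γ| ≤ π / 2) :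
    side γ a ≤ side γ b := by
  have h := sin_mul_side_eq α β γ (b - a)
  have h1 : 0 ≤ height β (b - a) := by rw [height_sub]; linarith [hb.2 a ha.1]
  have h2 : height α (b - a) ≤ 0 := by rw [height_sub]; linarith [ha.2 b hb.1]
  have h3 : 0 < sin (β - α) := sin_pos_of_pos_of_lt_pi (by linarith) (by linarith)
  have h4 : 0 ≤ cos (γ - α) := cos_nonneg_of_mem_Icc (abs_le.1 hγα)
  have h5 : 0 ≤ cos (β - γ) := cos_nonneg_of_mem_Icc (abs_le.1 hγβ)
  have h6 : 0 ≤ sin (β - α) * side γ (b - a) := by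
    rw [h]; nlinarith [mul_nonneg h4 h1, mul_nonneg h5 (neg_nonneg.2 h2)]
  have := nonneg_of_mul_nonneg_right h6 h3
  rw [side_sub] at this
  linarith

/-- A highest point in a direction outside `(α, β)` lies below the chord between the highest points
in directions `α` and `β`. -/
lemma IsHighest.height_le_of_le {ν β ψ : ℝ} {b z : Plane} (hb : IsHighest Ω β b)
    (hz : IsHighest Ω ψ z)
    (hνβ : ν ≤ β) (hβψ : β < ψ) (hψ : ψ ≤ ν + π) : height ν z ≤ height ν b := by
  have h := sin_mul_height_eq ν β ψ (z - b)
  have h1 : height β (z - b) ≤ 0 := by rw [height_sub]; linarith [hb.2 z hz.1]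
  have h2 : 0 ≤ height ψ (z - b) := by rw [height_sub]; linarith [hz.2 b hb.1]
  rcases hνβ.eq_or_lt with rfl | hlt
  · exact hb.2 z hz.1
  have h3 : 0 < sin (ψ - β) := sin_pos_of_pos_of_lt_pi (by linarith) (by linarith)
  have h4 : 0 ≤ sin (β - ν) := sin_nonneg_of_nonneg_of_le_pi (by linarith) (by linarith)
  have h5 : 0 ≤ sin (ψ - ν) := sin_nonneg_of_nonneg_of_le_pi (by linarith) (by linarith)
  have h6 : sin (ψ - β) * height ν (z - b) ≤ 0 := by
    nlinarith [mul_nonneg h4 h2, mul_nonneg h5 (neg_nonneg.2 h1)]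
  have := nonpos_of_mul_nonpos_right h6 h3
  rw [height_sub] at this
  linarith

lemma IsHighest.height_le_of_ge {ν α ψ : ℝ} {a z : Plane} (ha : IsHighest Ω α a)
    (hz : IsHighest Ω ψ z)
    (hαν : α ≤ ν) (hψα : ψ < α) (hψ : ν - π ≤ ψ) : height ν z ≤ height ν a := by
  have h := sin_mul_height_eq ψ α ν (z - a)
  have h1 : height α (z - a) ≤ 0 := by rw [height_sub]; linarith [ha.2 z hz.1]
  have h2 : 0 ≤ height ψ (z - a) := by rw [height_sub]; linarith [hz.2 a ha.1]
  rcases hαν.eq_or_lt with rfl | hlt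
  · exact ha.2 z hz.1
  have h3 : 0 < sin (α - ψ) := sin_pos_of_pos_of_lt_pi (by linarith) (by linarith)
  have h4 : 0 ≤ sin (ν - α) := sin_nonneg_of_nonneg_of_le_pi (by linarith) (by linarith)
  have h5 : 0 ≤ sin (ν - ψ) := sin_nonneg_of_nonneg_of_le_pi (by linarith) (by linarith)
  have h6 : sin (α - ψ) * height ν (z - a) ≤ 0 := by
    nlinarith [mul_nonneg h4 h2, mul_nonneg h5 (neg_nonneg.2 h1)]
  have := nonpos_of_mul_nonpos_right h6 h3
  rw [height_sub] at this
  linarith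

end Nodes

section Upper

variable {Ω : Set Plane}

/-- The arc of frontier points with a normal of angle in `[α, β]` between `a` and `b`. -/
def arc (Ω : Set Plane) (α β : ℝ) (a b : Plane) : Set (ℝ × Plane) :=
  {p | p.1 ∈ Set.Icc α β ∧ IsHighest Ω p.1 p.2 ∧ side α p.2 ∈ Set.Icc (side α a) (side α b)}

lemma isClosed_isHighest (hcl : IsClosed Ω) : IsClosed {p : ℝ × Plane | IsHighest Ω p.1 p.2} := by
  have : {p : ℝ × Plane | IsHighest Ω p.1 p.2} =
      Prod.snd ⁻¹' Ω ∩ ⋂ x ∈ Ω, {p | height p.1 x ≤ height p.1 p.2} := by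
    ext p
    simp [IsHighest]
  rw [this]
  refine (hcl.preimage continuous_snd).inter (isClosed_biInter fun x _ => isClosed_le ?_ ?_)
  · exact continuous_height_uncurry.comp (continuous_fst.prodMk continuous_const)
  · exact continuous_height_uncurry

lemma isCompact_arc (hcomp : IsCompact Ω) (α β : ℝ) (a b : Plane) :
    IsCompact (arc Ω α β a b) := by
  have hcl : IsClosed (arc Ω α β a b) := by
    refine (isClosed_Icc.preimage continuous_fst).inter
      ((isClosed_isHighest hcomp.isClosed).inter
        (isClosed_Icc.preimage ((continuous_side α).comp continuous_snd)))
  exact (isCompact_Icc.prod hcomp).of_isClosed_subset hcl fun p hp => ⟨hp.1, hp.2.1.1⟩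

lemma half_le_cos {t : ℝ} (ht : |t| ≤ π / 4) : 1 / 2 ≤ cos t := by
  rw [← cos_abs, ← cos_pi_div_three]
  exact cos_le_cos_of_nonneg_of_le_pi (abs_nonneg t) (by linarith [pi_pos]) (by linarith [pi_pos])

lemma height_le_of_rotated_nonpos {α φ δ : ℝ} (hδ : δ ≤ π / 4) (hφ : |φ - α| ≤ δ)
    {v : Plane} (hv : height φ v ≤ 0) : height α v ≤ 2 * δ * |side α v| := by
  have h1 := half_le_cos (hφ.trans hδ)
  have h2 : |sin (φ - α)| ≤ δ := abs_sin_le_abs.trans hφ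
  rw [height_eq_cos_mul_add α] at hv
  have h3 : -(sin (φ - α) * side α v) ≤ δ * |side α v| := by
    refine (neg_le_abs _).trans ?_
    rw [abs_mul]
    gcongr
  rcases le_total (height α v) 0 with h | h
  · refine h.trans ?_
    have : 0 ≤ δ := (abs_nonneg _).trans hφ
    positivity
  · nlinarith [mul_le_mul_of_nonneg_right h1 h]

/-- Arcs are flat graphs. -/
lemma abs_height_sub_le {α φ φ' δ : ℝ} (hδ : δ ≤ π / 4) (hφ : φ ∈ Set.Icc α (α + δ))
    (hφ' : φ' ∈ Set.Icc α (α + δ)) {x y : Plane} (hx : IsHighest Ω φ x) (hy : IsHighest Ω φ' y) :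
    |height α x - height α y| ≤ 2 * δ * |side α x - side α y| := by
  rw [abs_le]
  have h1 := height_le_of_rotated_nonpos (α := α) (φ := φ) hδ
    (abs_le.2 ⟨by linarith [hφ.1, hφ.2], by linarith [hφ.2]⟩) (v := y - x)
      (by rw [height_sub]; linarith [hx.2 y hy.1])
  have h2 := height_le_of_rotated_nonpos (α := α) (φ := φ') hδ
    (abs_le.2 ⟨by linarith [hφ'.1, hφ'.2], by linarith [hφ'.2]⟩) (v := x - y)
      (by rw [height_sub]; linarith [hy.2 x hx.1])
  rw [height_sub, side_sub] at h1 h2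
  rw [abs_sub_comm] at h1
  constructor <;> linarith

lemma hausdorffMeasure_arc_le {α δ : ℝ} (hδ0 : 0 ≤ δ) (hδ : δ ≤ π / 4) (a b : Plane) :
    μH[1] (Prod.snd '' arc Ω α (α + δ) a b) ≤
      ENNReal.ofReal (1 + 2 * δ) * ENNReal.ofReal (side α b - side α a) := by
  set Γ := Prod.snd '' arc Ω α (α + δ) a b
  have hdist : ∀ x ∈ Γ, ∀ y ∈ Γ, dist x y ≤ (1 + 2 * δ) * dist (side α x) (side α y) := by
    rintro _ ⟨p, hp, rfl⟩ _ ⟨q, hq, rfl⟩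
    rw [dist_eq_norm, Real.dist_eq]
    refine (norm_le_abs_side_add_abs_height α _).trans ?_
    rw [side_sub, height_sub]
    linarith [abs_height_sub_le hδ hp.1 hq.1 hp.2.1 hq.2.1]
  have hinj : Set.InjOn (side α) Γ := fun x hx y hy h => by
    have := hdist x hx y hy
    rw [h, dist_self, mul_zero] at this
    exact dist_le_zero.1 this
  have hlip : LipschitzOnWith (1 + 2 * δ).toNNReal (Function.invFunOn (side α) Γ)
      (side α '' Γ) := by
    refine LipschitzOnWith.of_dist_le_mul ?_
    rintro _ ⟨x, hx, rfl⟩ _ ⟨y, hy, rfl⟩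
    rw [hinj.leftInvOn_invFunOn hx, hinj.leftInvOn_invFunOn hy, Real.coe_toNNReal _ (by linarith)]
    exact hdist x hx y hy
  have h := hlip.hausdorffMeasure_image_le (d := 1) zero_le_one
  rw [hinj.leftInvOn_invFunOn.image_image, ENNReal.rpow_one, hausdorffMeasure_real] at h
  refine h.trans ?_
  gcongr
  · exact le_rfl
  · rw [← Real.volume_Icc]
    refine measure_mono ?_
    rintro _ ⟨_, ⟨p, hp, rfl⟩, rfl⟩
    exact hp.2.2

/-- The inner strip of width `t` along an arc. -/
def innerStrip (Ω : Set Plane) (α β : ℝ) (a b : Plane) (t : ℝ) : Set Plane :=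
  (fun q : (ℝ × Plane) × ℝ => q.1.2 - planePoint q.1.1 0 q.2) '' (arc Ω α β a b ×ˢ Set.Icc 0 t)

lemma isCompact_innerStrip (hcomp : IsCompact Ω) (α β : ℝ) (a b : Plane) (t : ℝ) :
    IsCompact (innerStrip Ω α β a b t) := by
  refine ((isCompact_arc hcomp α β a b).prod isCompact_Icc).image ?_
  refine (continuous_snd.comp continuous_fst).sub
    (continuous_planePoint_uncurry.comp ((continuous_fst.comp continuous_fst).prodMk
      (continuous_const.prodMk continuous_snd)))

lemma volume_innerStrip_le (hcomp : IsCompact Ω) {α δ : ℝ} (hδ0 : 0 ≤ δ) (hδ : δ ≤ π / 4)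
    (a b : Plane) {t : ℝ} (ht : 0 ≤ t) (hab : side α a ≤ side α b) :
    volume (innerStrip Ω α (α + δ) a b t) ≤
      ENNReal.ofReal ((side α b - side α a + 2 * δ * t) * (t * (1 + 2 * δ ^ 2))) := by
  have hc := isCompact_innerStrip hcomp α (α + δ) a b t
  set S := (fun x => (side α x, height α x)) '' innerStrip Ω α (α + δ) a b t with hS
  have hSm : MeasurableSet S :=
    (hc.image ((continuous_side α).prodMk (continuous_height α))).isClosed.measurableSet
  have hpre : {x : Plane | (side α x, height α x) ∈ S} = innerStrip Ω α (α + δ) a b t := by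
    ext x
    constructor
    · rintro ⟨y, hy, hxy⟩
      rwa [← plane_ext (congrArg Prod.fst hxy) (congrArg Prod.snd hxy)]
    · exact fun hx => ⟨x, hx, rfl⟩
  rw [← hpre, volume_preimage_side_height α hSm, Measure.volume_eq_prod, Measure.prod_apply hSm]
  have hsin : ∀ {φ s}, φ ∈ Set.Icc α (α + δ) → s ∈ Set.Icc 0 t → 0 ≤ s * sin (φ - α) ∧
      s * sin (φ - α) ≤ δ * t := by
    intro φ s hφ hs
    have h0 : 0 ≤ φ - α := by linarith [hφ.1]
    have h1 := sin_nonneg_of_nonneg_of_le_pi h0 (by linarith [hφ.2, pi_pos])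
    have h2 := sin_le h0
    refine ⟨mul_nonneg hs.1 h1, ?_⟩
    have : sin (φ - α) ≤ δ := by linarith [hφ.2]
    nlinarith [mul_le_mul hs.2 this h1 ht]
  have hcos : ∀ {φ s}, φ ∈ Set.Icc α (α + δ) → s ∈ Set.Icc 0 t → s * cos (φ - α) ∈ Set.Icc 0 t := by
    intro φ s hφ hs
    have h0 : 0 ≤ cos (φ - α) := cos_nonneg_of_mem_Icc
      ⟨by linarith [hφ.1, pi_pos], by linarith [hφ.2, pi_pos]⟩
    exact ⟨mul_nonneg hs.1 h0, (mul_le_of_le_one_right hs.1 (cos_le_one _)).trans hs.2⟩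
  have hcoord : ∀ p : ℝ × Plane, ∀ s : ℝ,
      side α (p.2 - planePoint p.1 0 s) = side α p.2 - s * sin (p.1 - α) ∧
      height α (p.2 - planePoint p.1 0 s) = height α p.2 - s * cos (p.1 - α) := by
    intro p s
    rw [side_sub, height_sub, side_eq_cos_mul_sub p.1 α (planePoint _ _ _),
      height_eq_cos_mul_add p.1 α (planePoint _ _ _),
      side_planePoint, height_planePoint, ← neg_sub p.1 α, sin_neg, cos_neg]
    constructor <;> ring
  have hfib : ∀ u, volume (Prod.mk u ⁻¹' S) ≤
      (Set.Icc (side α a - δ * t) (side α b)).indicator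
        (fun _ => ENNReal.ofReal (t * (1 + 2 * δ ^ 2))) u := by
    intro u
    by_cases hu : u ∈ Set.Icc (side α a - δ * t) (side α b)
    · rw [Set.indicator_of_mem hu]
      refine (Real.volume_le_diam _).trans (ediam_le fun h hh h' hh' => ?_)
      rw [edist_dist]
      refine ENNReal.ofReal_le_ofReal ?_
      obtain ⟨_, ⟨⟨p, s⟩, ⟨hp, hs⟩, rfl⟩, hx⟩ := hh
      obtain ⟨_, ⟨⟨q, s'⟩, ⟨hq, hs'⟩, rfl⟩, hy⟩ := hh'
      simp only [Prod.mk.injEq, (hcoord _ _).1, (hcoord _ _).2] at hx hy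
      have h1 := abs_height_sub_le hδ hp.1 hq.1 hp.2.1 hq.2.1
      have h2 : |side α p.2 - side α q.2| ≤ δ * t := by
        rw [abs_le]
        have := hsin hp.1 hs
        have := hsin hq.1 hs'
        constructor <;> linarith
      have h3 : 2 * δ * |side α p.2 - side α q.2| ≤ 2 * δ * (δ * t) := by gcongr
      have h4 := abs_le.1 (h1.trans h3)
      have h5 := hcos hp.1 hs
      have h6 := hcos hq.1 hs'
      rw [Real.dist_eq, abs_le]
      constructor <;> linarith [h5.1, h5.2, h6.1, h6.2]
    · have : Prod.mk u ⁻¹' S = ∅ := by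
        rw [Set.eq_empty_iff_forall_notMem]
        rintro h ⟨_, ⟨⟨p, s⟩, ⟨hp, hs⟩, rfl⟩, hx⟩
        simp only [Prod.mk.injEq, (hcoord _ _).1] at hx
        have := hsin hp.1 hs
        exact hu ⟨by linarith [hp.2.2.1], by linarith [hp.2.2.2]⟩
      rw [this, measure_empty]
      exact zero_le
  refine (lintegral_mono hfib).trans ?_
  rw [lintegral_indicator measurableSet_Icc, setLIntegral_const, Real.volume_Icc, mul_comm,
    ← ENNReal.ofReal_mul (by nlinarith)]
  refine ENNReal.ofReal_le_ofReal ?_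
  have : 0 ≤ t * (1 + 2 * δ ^ 2) := by positivity
  nlinarith [mul_nonneg (mul_nonneg hδ0 ht) this]

/-- `b` lists the (first) highest points of `Ω` in the directions `j * δ`, a full turn taking
`N` steps. -/
structure IsFan (Ω : Set Plane) (N : ℕ) (δ : ℝ) (b : ℕ → Plane) : Prop where
  eight_le : 8 ≤ N
  mul_eq : N * δ = 2 * π
  isFirstHighest : ∀ j : ℕ, IsFirstHighest Ω (j * δ) (b j)

namespace IsFan

variable {N : ℕ} {δ : ℝ} {b : ℕ → Plane}

lemma pos (h : IsFan Ω N δ b) : 0 < δ := by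
  have hN : (0 : ℝ) < N := by exact_mod_cast (by norm_num : 0 < 8).trans_le h.eight_le
  have := h.mul_eq
  by_contra! hδ
  nlinarith [pi_pos]

lemma le_pi_div_four (h : IsFan Ω N δ b) : δ ≤ π / 4 := by
  have hN : (8 : ℝ) ≤ N := by exact_mod_cast h.eight_le
  nlinarith [h.mul_eq, h.pos]

lemma isHighest (h : IsFan Ω N δ b) (j : ℕ) : IsHighest Ω (j * δ) (b j) :=
  (h.isFirstHighest j).1

lemma isHighest_succ (h : IsFan Ω N δ b) (j : ℕ) : IsHighest Ω (j * δ + δ) (b (j + 1)) := by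
  have := (h.isFirstHighest (j + 1)).1
  rwa [show ((j + 1 : ℕ) : ℝ) * δ = j * δ + δ by push_cast; ring] at this

lemma side_le (h : IsFan Ω N δ b) (j : ℕ) {γ : ℝ} (hγ : γ ∈ Set.Icc (j * δ) (j * δ + δ)) :
    side γ (b j) ≤ side γ (b (j + 1)) :=
  (h.isHighest j).side_le_side (h.isHighest_succ j) (by linarith [h.pos])
    (by linarith [h.le_pi_div_four, pi_pos])
    (abs_le.2 ⟨by linarith [hγ.1, pi_pos], by linarith [hγ.2, h.le_pi_div_four, pi_pos]⟩)
    (abs_le.2 ⟨by linarith [hγ.2, pi_pos], by linarith [hγ.1, h.le_pi_div_four, pi_pos]⟩)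

/-- Every normal direction falls in one of the sectors. -/
lemma exists_mem_arc (h : IsFan Ω N δ b) {φ : ℝ} {x : Plane} (hx : IsHighest Ω φ x) :
    ∃ j < N, ∃ φ', height φ' = height φ ∧ side φ' = side φ ∧
      (φ', x) ∈ arc Ω (j * δ) (j * δ + δ) (b j) (b (j + 1)) := by
  have hδ := h.pos
  have hδ4 := h.le_pi_div_four
  obtain ⟨φ', hφ', hh, hs⟩ := exists_angle_mem_Ico φ
  rw [← isHighest_congr hh] at hx
  set j := ⌊φ' / δ⌋₊ with hj
  have h1 : j * δ ≤ φ' := by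
    rw [← le_div_iff₀ hδ]
    exact Nat.floor_le (div_nonneg hφ'.1 hδ.le)
  have h2 : φ' < j * δ + δ := by
    have := Nat.lt_floor_add_one (φ' / δ)
    rw [div_lt_iff₀ hδ, ← hj] at this
    linarith
  have hjN : j < N := by
    have : (j : ℝ) * δ < N * δ := by
      rw [h.mul_eq]
      exact h1.trans_lt hφ'.2
    exact_mod_cast lt_of_mul_lt_mul_right this hδ.le
  refine ⟨j, hjN, φ', hh, hs, ⟨h1, h2.le⟩, hx, ?_, ?_⟩
  · rcases h1.eq_or_lt with he | hlt
    · exact (h.isFirstHighest j).2 x (he ▸ hx)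
    · exact (h.isHighest j).side_le_side hx hlt (by linarith [pi_pos])
        (by rw [sub_self, abs_zero]; positivity) (abs_le.2 ⟨by linarith, by linarith⟩)
  · exact hx.side_le_side (h.isHighest_succ j) h2 (by linarith [pi_pos])
      (abs_le.2 ⟨by linarith [pi_pos], by linarith [pi_pos]⟩)
      (abs_le.2 ⟨by linarith [pi_pos], by linarith [pi_pos]⟩)

/-- The total width of the arcs of a fan. -/
noncomputable def width (N : ℕ) (δ : ℝ) (b : ℕ → Plane) : ℝ :=
  ∑ j ∈ Finset.range N, (side (j * δ) (b (j + 1)) - side (j * δ) (b j))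

lemma width_nonneg (h : IsFan Ω N δ b) : 0 ≤ width N δ b :=
  Finset.sum_nonneg fun j _ =>
    sub_nonneg.2 (h.side_le j ⟨le_rfl, by linarith [h.pos]⟩)

lemma hausdorffMeasure_frontier_le (h : IsFan Ω N δ b) (hconv : Convex ℝ Ω) (hcomp : IsCompact Ω)
    (hint : (interior Ω).Nonempty) :
    μH[1] (frontier Ω) ≤ ENNReal.ofReal ((1 + 2 * δ) * width N δ b) := by
  have hsub : frontier Ω ⊆ ⋃ j ∈ Finset.range N,
      Prod.snd '' arc Ω (j * δ) (j * δ + δ) (b j) (b (j + 1)) := by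
    intro x hx
    obtain ⟨φ, hφ⟩ := exists_isHighest_of_mem_frontier hconv hcomp.isClosed hint hx
    obtain ⟨j, hj, φ', -, -, hmem⟩ := h.exists_mem_arc hφ
    exact Set.mem_biUnion (Finset.mem_coe.2 (Finset.mem_range.2 hj)) ⟨_, hmem, rfl⟩
  refine (measure_mono hsub).trans ((measure_biUnion_finset_le _ _).trans ?_)
  rw [ENNReal.ofReal_mul (by linarith [h.pos]), width, ENNReal.ofReal_sum_of_nonneg
    (fun j _ => sub_nonneg.2 (h.side_le j ⟨le_rfl, by linarith [h.pos]⟩)), Finset.mul_sum]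
  exact Finset.sum_le_sum fun j _ => hausdorffMeasure_arc_le h.pos.le h.le_pi_div_four _ _

lemma volume_infDist_le (h : IsFan Ω N δ b) (hconv : Convex ℝ Ω) (hcomp : IsCompact Ω)
    (hint : (interior Ω).Nonempty) {t : ℝ} (ht : 0 ≤ t) :
    volume {x ∈ Ω | infDist x Ωᶜ ≤ t} ≤
      ENNReal.ofReal ((width N δ b + 4 * π * t) * (t * (1 + 2 * δ ^ 2))) := by
  have hsub : {x ∈ Ω | infDist x Ωᶜ ≤ t} ⊆ ⋃ j ∈ Finset.range N,
      innerStrip Ω (j * δ) (j * δ + δ) (b j) (b (j + 1)) t := by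
    rintro x ⟨hx, hxt⟩
    obtain ⟨φ, y, hφ, -, hxy⟩ := exists_isHighest_eq_sub hconv hcomp hint hx
    obtain ⟨j, hj, φ', hh, hs, hmem⟩ := h.exists_mem_arc hφ
    refine Set.mem_biUnion (Finset.mem_coe.2 (Finset.mem_range.2 hj))
      ⟨((φ', y), infDist x Ωᶜ), ⟨hmem, infDist_nonneg, hxt⟩, ?_⟩
    refine (congrArg (y - ·) (plane_ext (θ := φ) ?_ ?_)).trans hxy.symm
    · rw [side_planePoint]; rw [← hs, side_planePoint]
    · rw [height_planePoint]; rw [← hh, height_planePoint]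
  refine (measure_mono hsub).trans ((measure_biUnion_finset_le _ _).trans ?_)
  have hnn : ∀ j : ℕ, 0 ≤ side (j * δ) (b (j + 1)) - side (j * δ) (b j) := fun j =>
    sub_nonneg.2 (h.side_le j ⟨le_rfl, by linarith [h.pos]⟩)
  refine (Finset.sum_le_sum fun j _ => volume_innerStrip_le hcomp h.pos.le h.le_pi_div_four _ _ ht
    (sub_nonneg.1 (hnn j))).trans ?_
  have hδ := h.pos
  rw [← ENNReal.ofReal_sum_of_nonneg fun j _ => by have := hnn j; positivity]
  refine ENNReal.ofReal_le_ofReal (le_of_eq ?_)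
  rw [← Finset.sum_mul, Finset.sum_add_distrib, Finset.sum_const, Finset.card_range, nsmul_eq_mul,
    width]
  linear_combination (2 * t) * (t * (1 + 2 * δ ^ 2)) * h.mul_eq

end IsFan

lemma exists_isFan (hcomp : IsCompact Ω) (hne : Ω.Nonempty) {N : ℕ} (hN : 8 ≤ N) :
    ∃ b, IsFan Ω N (2 * π / N) b := by
  choose b hb using fun j : ℕ => exists_isFirstHighest hcomp hne (j * (2 * π / N))
  have hN0 : (N : ℝ) ≠ 0 := by positivity
  exact ⟨b, hN, mul_div_cancel₀ _ hN0, hb⟩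

end Upper

section Strips

variable {Ω : Set Plane}

/-- The open half-strip above the segment from `a` to `c`, in direction `ν`. -/
def strip (ν : ℝ) (a c : Plane) : Set Plane :=
  {x | side ν a < side ν x ∧ side ν x < side ν c ∧ height ν a < height ν x}

lemma isOpen_strip (ν : ℝ) (a c : Plane) : IsOpen (strip ν a c) :=
  (isOpen_lt continuous_const (continuous_side ν)).inter
    ((isOpen_lt (continuous_side ν) continuous_const).inter
      (isOpen_lt continuous_const (continuous_height ν)))

lemma exists_mem_segment_of_side {ν u : ℝ} {a c : Plane} (h : height ν a = height ν c)
    (h1 : side ν a < u) (h2 : u < side ν c) :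
    planePoint ν u (height ν a) ∈ segment ℝ a c := by
  have h0 : 0 < side ν c - side ν a := by linarith
  refine ⟨(side ν c - u) / (side ν c - side ν a), (u - side ν a) / (side ν c - side ν a),
    div_nonneg (by linarith) h0.le, div_nonneg (by linarith) h0.le, ?_, ?_⟩
  · field_simp
    ring
  · refine plane_ext (θ := ν) ?_ ?_
    · simp only [side_add, side_smul, side_planePoint]
      field_simp
      ring
    · simp only [height_add, height_smul, height_planePoint, ← h]
      field_simp
      ring

lemma height_le_of_mem_strip {ν ν' m : ℝ} {a c x : Plane} (h : height ν a = height ν c)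
    (ha : height ν' a ≤ m) (hc : height ν' c ≤ m) (hx : x ∈ strip ν a c) :
    height ν' x - m ≤ (height ν x - height ν a) * cos (ν' - ν) := by
  obtain ⟨α, β, hα, hβ, hαβ, hp⟩ := exists_mem_segment_of_side h hx.1 hx.2.1
  have h1 : height ν' (planePoint ν (side ν x) (height ν a)) ≤ m := by
    rw [← hp, height_add, height_smul, height_smul]
    calc _ ≤ α * m + β * m := by gcongr
      _ = m := by rw [← add_mul, hαβ, one_mul]
  rw [height_eq_cos_mul_add ν, side_planePoint, height_planePoint] at h1
  rw [height_eq_cos_mul_add ν]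
  linarith

lemma disjoint_strip {ν ν' : ℝ} {a c a' c' : Plane} (h : height ν a = height ν c)
    (h' : height ν' a' = height ν' c') (h1 : height ν' a ≤ height ν' a')
    (h2 : height ν' c ≤ height ν' a') (h3 : height ν a' ≤ height ν a)
    (h4 : height ν c' ≤ height ν a) (hcos : cos (ν' - ν) ≠ 1) :
    Disjoint (strip ν a c) (strip ν' a' c') := by
  refine Set.disjoint_left.2 fun x hx hx' => hcos ?_
  have h5 := height_le_of_mem_strip h h1 h2 hx
  have h6 := height_le_of_mem_strip h' h3 h4 hx'
  rw [← cos_neg, neg_sub] at h6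
  have h7 := hx.2.2
  have h8 := hx'.2.2
  have h9 := cos_le_one (ν' - ν)
  refine le_antisymm h9 ?_
  nlinarith

lemma exists_mem_frontier_ray (hcomp : IsCompact Ω) (ν : ℝ) {p : Plane} (hp : p ∈ Ω) :
    ∃ s, 0 ≤ s ∧ p + planePoint ν 0 s ∈ frontier Ω := by
  have hcont : Continuous fun s : ℝ => p + planePoint ν 0 s :=
    continuous_const.add (continuous_planePoint_uncurry.comp
      (continuous_const.prodMk (continuous_const.prodMk continuous_id)))
  have hpre : IsPreconnected ((fun s : ℝ => p + planePoint ν 0 s) '' Set.Ici 0) :=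
    isPreconnected_Ici.image _ hcont.continuousOn
  obtain ⟨R, hR⟩ := (hcomp.image (continuous_height ν)).bddAbove
  have h0 : p + planePoint ν 0 0 = p := plane_ext (θ := ν) (by simp) (by simp)
  have hcover : (fun s : ℝ => p + planePoint ν 0 s) '' Set.Ici 0 ⊆ closure Ω ∪ closure Ωᶜ :=
    fun x _ => (em (x ∈ Ω)).imp (fun h => subset_closure h) (fun h => subset_closure h)
  obtain ⟨_, ⟨s, hs, rfl⟩, hf⟩ := isPreconnected_closed_iff.1 hpre _ _ isClosed_closure
    isClosed_closure hcover ⟨p, ⟨0, Set.self_mem_Ici, h0⟩, subset_closure hp⟩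
    ⟨p + planePoint ν 0 (max 0 (R - height ν p + 1)), ⟨_, Set.mem_Ici.2 (le_max_left _ _), rfl⟩,
      subset_closure fun hmem => by
        have := hR ⟨_, hmem, rfl⟩
        rw [height_add, height_planePoint] at this
        linarith [le_max_right 0 (R - height ν p + 1)]⟩
  exact ⟨s, hs, by rwa [frontier_eq_closure_inter_closure]⟩

lemma le_hausdorffMeasure_frontier_inter_strip (hconv : Convex ℝ Ω) (hcomp : IsCompact Ω)
    {ν : ℝ} {a c : Plane} (h : height ν a = height ν c) (ha : a ∈ interior Ω)
    (hc : c ∈ interior Ω) :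
    ENNReal.ofReal (side ν c - side ν a) ≤ μH[1] (frontier Ω ∩ strip ν a c) := by
  have hlip : LipschitzWith 1 (side ν) := LipschitzWith.of_dist_le_mul fun x y => by
    rw [Real.dist_eq, ← side_sub, NNReal.coe_one, one_mul, dist_eq_norm]
    exact abs_side_le_norm ν _
  have h1 := hlip.hausdorffMeasure_image_le (d := 1) zero_le_one (frontier Ω ∩ strip ν a c)
  rw [ENNReal.coe_one, ENNReal.one_rpow, one_mul, hausdorffMeasure_real] at h1
  refine le_trans ?_ h1
  rw [← Real.volume_Ioo]
  refine measure_mono fun u hu => ?_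
  have hp : planePoint ν u (height ν a) ∈ interior Ω :=
    hconv.interior.segment_subset ha hc (exists_mem_segment_of_side h hu.1 hu.2)
  obtain ⟨s, hs, hf⟩ := exists_mem_frontier_ray hcomp ν (interior_subset hp)
  refine ⟨_, ⟨hf, ?_⟩, by rw [side_add, side_planePoint, side_planePoint, add_zero]⟩
  simp only [strip, Set.mem_ofPred_eq, side_add, side_planePoint, height_add, height_planePoint,
    add_zero]
  refine ⟨hu.1, hu.2, ?_⟩
  rcases hs.eq_or_lt with rfl | hs
  · rw [show planePoint ν u (height ν a) + planePoint ν 0 0 = planePoint ν u (height ν a) from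
      plane_ext (θ := ν) (by simp) (by simp)] at hf
    exact absurd hp hf.2
  · linarith

lemma convex_setOf_closedBall_subset (hconv : Convex ℝ Ω) (t : ℝ) :
    Convex ℝ {x | closedBall x t ⊆ Ω} := by
  intro x hx y hy α β hα hβ hαβ z hz
  have h1 : x + (z - (α • x + β • y)) ∈ Ω := hx (by simpa [dist_eq_norm] using hz)
  have h2 : y + (z - (α • x + β • y)) ∈ Ω := hy (by simpa [dist_eq_norm] using hz)
  have h3 := hconv h1 h2 hα hβ hαβ
  rwa [smul_add, smul_add, add_add_add_comm, ← add_smul, hαβ, one_smul, add_sub_cancel] at h3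

lemma le_volume_infDist_inter_strip (hconv : Convex ℝ Ω) (hcomp : IsCompact Ω)
    {ν t : ℝ} {a c : Plane} (ht : 0 ≤ t) (h : height ν a = height ν c) (ha : closedBall a t ⊆ Ω)
    (hc : closedBall c t ⊆ Ω) :
    ENNReal.ofReal (t * (side ν c - side ν a)) ≤
      volume ({x ∈ Ω | infDist x Ωᶜ < t} ∩ strip ν a c) := by
  rcases le_or_gt (side ν c) (side ν a) with hac | hac
  · rw [ENNReal.ofReal_of_nonpos (by nlinarith)]
    exact zero_le
  have hm : MeasurableSet ({x ∈ Ω | infDist x Ωᶜ < t} ∩ strip ν a c) :=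
    (hcomp.isClosed.measurableSet.inter
      (isOpen_lt (continuous_infDist_pt _) continuous_const).measurableSet).inter
      (isOpen_strip ν a c).measurableSet
  set S := {q : ℝ × ℝ | planePoint ν q.1 q.2 ∈ {x ∈ Ω | infDist x Ωᶜ < t} ∩ strip ν a c} with hS
  have hSm : MeasurableSet S := hm.preimage (continuous_planePoint_uncurry.comp
      (continuous_const.prodMk continuous_id)).measurable
  have hpre : {x : Plane | (side ν x, height ν x) ∈ S} =
      {x ∈ Ω | infDist x Ωᶜ < t} ∩ strip ν a c := by
    ext x
    simp only [hS, Set.mem_ofPred_eq, planePoint_side_height]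
  rw [← hpre, volume_preimage_side_height ν hSm, Measure.volume_eq_prod, Measure.prod_apply hSm,
    ENNReal.ofReal_mul ht, ← Real.volume_Ioo, ← setLIntegral_const,
    ← lintegral_indicator measurableSet_Ioo]
  refine lintegral_mono fun u => ?_
  by_cases hu : u ∈ Set.Ioo (side ν a) (side ν c)
  swap
  · rw [Set.indicator_of_notMem hu]
    exact zero_le
  rw [Set.indicator_of_mem hu]
  set K := {s : ℝ | 0 ≤ s ∧ t ≤ infDist (planePoint ν u (height ν a + s)) Ωᶜ ∧
    planePoint ν u (height ν a + s) ∈ Ω} with hK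
  have hcont : Continuous fun s : ℝ => planePoint ν u (height ν a + s) :=
    continuous_planePoint_uncurry.comp (continuous_const.prodMk (continuous_const.prodMk
      (continuous_const.add continuous_id)))
  have hKcl : IsClosed K := by
    refine (isClosed_le continuous_const continuous_id).inter ((isClosed_le continuous_const
      ((continuous_infDist_pt _).comp hcont)).inter (hcomp.isClosed.preimage hcont))
  have hKb : BddAbove K := by
    obtain ⟨R, hR⟩ := (hcomp.image (continuous_height ν)).bddAbove
    refine ⟨R - height ν a, fun s hs => ?_⟩
    have := hR ⟨_, hs.2.2, rfl⟩
    rw [height_planePoint] at this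
    linarith
  have h0 : (0 : ℝ) ∈ K := by
    have hseg := (convex_setOf_closedBall_subset hconv t).segment_subset ha hc
      (exists_mem_segment_of_side h hu.1 hu.2)
    rw [hK, Set.mem_ofPred_eq, add_zero]
    exact ⟨le_rfl, le_infDist_of_closedBall_subset hcomp hseg, hseg (mem_closedBall_self ht)⟩
  set s₀ := sSup K
  have hs₀ : s₀ ∈ K := hKcl.csSup_mem ⟨0, h0⟩ hKb
  have hsub : Set.Ioc (height ν a + s₀) (height ν a + s₀ + t) ⊆ Prod.mk u ⁻¹' S := by
    intro y hy
    have hy0 : height ν a < y := by linarith [hs₀.1, hy.1]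
    have hmem : planePoint ν u y ∈ Ω := by
      refine closedBall_subset_of_le_infDist hcomp.isClosed hs₀.2.2 hs₀.2.1 ?_
      rw [mem_closedBall, dist_eq_norm]
      refine (norm_le_abs_side_add_abs_height ν _).trans ?_
      rw [side_sub, height_sub, side_planePoint, side_planePoint, height_planePoint,
        height_planePoint, sub_self, abs_zero, zero_add, abs_le]
      constructor <;> linarith [hy.1, hy.2]
    refine ⟨⟨hmem, ?_⟩, ?_⟩
    · by_contra! hle
      have hyK : y - height ν a ∈ K := by
        rw [hK, Set.mem_ofPred_eq, add_sub_cancel]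
        exact ⟨by linarith, hle, hmem⟩
      have := le_csSup hKb hyK
      linarith [hy.1]
    · simp only [strip, Set.mem_ofPred_eq, side_planePoint, height_planePoint]
      exact ⟨hu.1, hu.2, hy0⟩
  refine le_trans (le_of_eq ?_) (measure_mono hsub)
  rw [Real.volume_Ioc]
  congr 1
  ring

/-- Contraction towards `x₀`. -/
noncomputable def shrink (x₀ : Plane) (η : ℝ) (b : Plane) : Plane := (1 - η) • b + η • x₀

lemma closedBall_shrink_subset (hconv : Convex ℝ Ω) {x₀ : Plane} {ρ η : ℝ}
    (hball : closedBall x₀ ρ ⊆ Ω) (hη : 0 < η) (hη1 : η ≤ 1) {b : Plane} (hb : b ∈ Ω) :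
    closedBall (shrink x₀ η b) (η * ρ) ⊆ Ω := by
  intro z hz
  have h1 : x₀ + η⁻¹ • (z - shrink x₀ η b) ∈ Ω := by
    refine hball ?_
    rw [mem_closedBall, dist_eq_norm] at hz
    rw [mem_closedBall, dist_eq_norm, add_sub_cancel_left, norm_smul, norm_inv, Real.norm_eq_abs,
      abs_of_pos hη, inv_mul_le_iff₀ hη]
    exact hz
  have h2 := hconv hb h1 (by linarith : 0 ≤ 1 - η) hη.le (by ring)
  rw [smul_add, smul_smul, mul_inv_cancel₀ hη.ne', one_smul, ← add_assoc] at h2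
  change shrink x₀ η b + _ ∈ Ω at h2
  rwa [add_sub_cancel] at h2

namespace IsFan

variable {N : ℕ} {δ : ℝ} {b : ℕ → Plane}

lemma exists_normal (h : IsFan Ω N δ b) (j : ℕ) :
    ∃ ν ∈ Set.Icc (j * δ) (j * δ + δ), height ν (b j) = height ν (b (j + 1)) ∧
      (side ν (b j) < side ν (b (j + 1)) → ν < j * δ + δ) := by
  have hδ := h.pos
  have hcont : ContinuousOn (fun ν => height ν (b (j + 1) - b j)) (Set.Icc (j * δ) (j * δ + δ)) :=
    (continuous_height_uncurry.comp (continuous_id.prodMk continuous_const)).continuousOn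
  have h1 := (h.isHighest j).2 _ (h.isHighest (j + 1)).1
  have h2 := (h.isHighest_succ j).2 _ (h.isHighest j).1
  obtain ⟨ν, hν, h0⟩ := intermediate_value_Icc (by linarith) hcont
    (show (0 : ℝ) ∈ _ by simp only [height_sub]; constructor <;> linarith)
  simp only [height_sub] at h0
  refine ⟨ν, hν, by linarith, fun hlt => hν.2.lt_of_ne fun he => ?_⟩
  have h3 : IsHighest Ω (((j + 1 : ℕ) : ℝ) * δ) (b j) := by
    rw [show ((j + 1 : ℕ) : ℝ) * δ = ν by rw [he]; push_cast; ring]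
    refine ⟨(h.isHighest j).1, fun x hx => ?_⟩
    have := (h.isHighest_succ j).2 x hx
    rw [← he] at this
    linarith
  have h4 := (h.isFirstHighest (j + 1)).2 _ h3
  rw [show ((j + 1 : ℕ) : ℝ) * δ = ν by rw [he]; push_cast; ring] at h4
  linarith

lemma apply_self_eq (h : IsFan Ω N δ b) : b N = b 0 := by
  refine (h.isFirstHighest N).unique ?_
  have h1 := h.isFirstHighest 0
  rw [Nat.cast_zero, zero_mul] at h1
  rw [h.mul_eq, ← zero_add (2 * π)]
  exact (isFirstHighest_congr (height_add_two_pi 0) (side_add_two_pi 0)).2 h1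

/-- The points of a fan are in convex position. -/
lemma height_le (h : IsFan Ω N δ b) {i j : ℕ} (hi : i ≤ N) (hj : j < N) {ν : ℝ}
    (hν : ν ∈ Set.Icc (j * δ) (j * δ + δ)) (hh : height ν (b j) = height ν (b (j + 1))) :
    height ν (b i) ≤ height ν (b j) := by
  have hδ := h.pos
  have hδ4 := h.le_pi_div_four
  wlog hiN : i < N generalizing i
  · obtain rfl : i = N := by omega
    rw [h.apply_self_eq]
    exact this (Nat.zero_le _) (by omega)
  have hiN' : (i : ℝ) * δ < 2 * π := by
    rw [← h.mul_eq]
    gcongr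
  have hjN' : (j : ℝ) * δ + δ ≤ 2 * π := by
    rw [← h.mul_eq, ← add_one_mul]
    gcongr
    exact_mod_cast hj
  have hi0 : 0 ≤ (i : ℝ) * δ := by positivity
  have hj0 : 0 ≤ (j : ℝ) * δ := by positivity
  rcases lt_trichotomy i j with hij | rfl | hij
  · have hlt : (i : ℝ) * δ < j * δ := by gcongr
    rcases le_or_gt (ν - π) (i * δ) with hψ | hψ
    · exact (h.isHighest j).height_le_of_ge (h.isHighest i) hν.1 hlt hψ
    · rw [hh]
      by_cases h0 : (i : ℝ) = 0 ∧ (j : ℝ) + 1 = N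
      · obtain rfl : i = 0 := by exact_mod_cast h0.1
        obtain rfl : j + 1 = N := by exact_mod_cast h0.2
        rw [h.apply_self_eq]
      refine (h.isHighest_succ j).height_le_of_le (ψ := i * δ + 2 * π)
        ((isHighest_congr (height_add_two_pi _)).2 (h.isHighest i)) hν.2 ?_ (by linarith)
      rcases hjN'.lt_or_eq with hlt' | he
      · linarith
      · have := h.mul_eq
        refine lt_of_le_of_ne (by linarith) fun he' => h0 ⟨?_, ?_⟩
        · exact (mul_eq_zero.1 (show (i : ℝ) * δ = 0 by linarith)).resolve_right hδ.ne'
        · exact mul_right_cancel₀ hδ.ne' (by linarith)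
  · exact le_rfl
  · rcases (Nat.succ_le_of_lt hij).eq_or_lt with rfl | hij'
    · exact hh.ge
    have hlt : (j : ℝ) * δ + δ < i * δ := by
      rw [← add_one_mul]
      gcongr
      exact_mod_cast hij'
    rcases le_or_gt ((i : ℝ) * δ) (ν + π) with hψ | hψ
    · rw [hh]
      exact (h.isHighest_succ j).height_le_of_le (h.isHighest i) hν.2 hlt hψ
    · refine (h.isHighest j).height_le_of_ge (ψ := i * δ - 2 * π) ?_ hν.1 (by linarith)
        (by linarith)
      refine (isHighest_congr ?_).2 (h.isHighest i)
      rw [← height_add_two_pi, sub_add_cancel]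

/-- A family of disjoint half-strips carried by a shrunk fan. -/
lemma exists_strips (h : IsFan Ω N δ b) (x₀ : Plane) {η : ℝ} (hη : η ≤ 1) :
    ∃ ν : ℕ → ℝ, (∀ j < N, height (ν j) (shrink x₀ η (b j)) =
        height (ν j) (shrink x₀ η (b (j + 1)))) ∧
      (∀ j < N, (1 - η) * (side (j * δ) (b (j + 1)) - side (j * δ) (b j)) ≤
        side (ν j) (shrink x₀ η (b (j + 1))) - side (ν j) (shrink x₀ η (b j))) ∧
      (Set.Iio N).PairwiseDisjoint fun j =>
        strip (ν j) (shrink x₀ η (b j)) (shrink x₀ η (b (j + 1))) := by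
  choose ν hν hh hlt using h.exists_normal
  have hη' : 0 ≤ 1 - η := by linarith
  have hδ := h.pos
  have hstrip : ∀ j < N, height (ν j) (shrink x₀ η (b j)) =
      height (ν j) (shrink x₀ η (b (j + 1))) := fun j _ => by
    simp only [shrink, height_add, height_smul, hh j]
  have hmono : ∀ ψ, ∀ x y, height ψ x ≤ height ψ y →
      height ψ (shrink x₀ η x) ≤ height ψ (shrink x₀ η y) := fun ψ x y hxy => by
    simp only [shrink, height_add, height_smul]
    gcongr
  refine ⟨ν, hstrip, fun j _ => ?_, ?_⟩
  · have hside := h.side_le j (hν j)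
    have h1 : side (ν j) (shrink x₀ η (b (j + 1))) - side (ν j) (shrink x₀ η (b j)) =
        (1 - η) * (side (ν j) (b (j + 1)) - side (ν j) (b j)) := by
      simp only [shrink, side_add, side_smul]
      ring
    rw [h1]
    refine mul_le_mul_of_nonneg_left ?_ hη'
    have h2 := norm_sq_eq_side_height (ν j) (b (j + 1) - b j)
    rw [height_sub, hh j, sub_self] at h2
    have h3 := abs_side_le_norm (j * δ) (b (j + 1) - b j)
    rw [side_sub] at h2 h3
    refine ((le_abs_self _).trans h3).trans (abs_le_of_sq_le_sq' (by linarith) (by linarith)).2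
  · have key : ∀ i j, i < j → j < N → Disjoint
        (strip (ν i) (shrink x₀ η (b i)) (shrink x₀ η (b (i + 1))))
        (strip (ν j) (shrink x₀ η (b j)) (shrink x₀ η (b (j + 1)))) := by
      intro i j hij hj
      by_cases hcos : cos (ν j - ν i) = 1
      · have hi0 : 0 ≤ (i : ℝ) * δ := by positivity
        have hjN' : (j : ℝ) * δ + δ ≤ 2 * π := by
          rw [← h.mul_eq, ← add_one_mul]
          gcongr
          exact_mod_cast hj
        have hij' : (i : ℝ) * δ + δ ≤ j * δ := by
          rw [← add_one_mul]
          gcongr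
          exact_mod_cast hij
        refine Set.disjoint_left.2 fun x hx hx' => ?_
        have hs : ∀ l, ∀ x, x ∈ strip (ν l) (shrink x₀ η (b l)) (shrink x₀ η (b (l + 1))) →
            ν l < l * δ + δ := by
          intro l x hx
          refine hlt l ?_
          have := hx.1.trans hx.2.1
          simp only [shrink, side_add, side_smul] at this
          exact lt_of_mul_lt_mul_left (by linarith) hη'
        have h1 := hs i x hx
        have h2 := hs j x hx'
        have h3 := (hν i).1
        have h4 := (hν j).1
        rw [cos_eq_one_iff_of_lt_of_lt (by linarith) (by linarith)] at hcos
        linarith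
      · exact disjoint_strip (hstrip i (hij.trans hj)) (hstrip j hj)
          (hmono _ _ _ (h.height_le (by omega) hj (hν j) (hh j)))
          (hmono _ _ _ (h.height_le (by omega) hj (hν j) (hh j)))
          (hmono _ _ _ (h.height_le (by omega) (by omega) (hν i) (hh i)))
          (hmono _ _ _ (h.height_le (by omega) (by omega) (hν i) (hh i))) hcos
    intro i hi j hj hij
    rcases lt_or_gt_of_ne hij with hlt' | hlt'
    · exact key i j hlt' hj
    · exact (key j i hlt' hi).symm

lemma le_measure_of_forall_strip (h : IsFan Ω N δ b) (x₀ : Plane) {η : ℝ} (hη : η ≤ 1)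
    (μ : Measure Plane) {S : Set Plane} (hS : MeasurableSet S) {a : ℝ} (ha : 0 ≤ a)
    (hstrip : ∀ ν j, height ν (shrink x₀ η (b j)) = height ν (shrink x₀ η (b (j + 1))) →
      ENNReal.ofReal (a * (side ν (shrink x₀ η (b (j + 1))) - side ν (shrink x₀ η (b j)))) ≤
        μ (S ∩ strip ν (shrink x₀ η (b j)) (shrink x₀ η (b (j + 1))))) :
    ENNReal.ofReal (a * (1 - η) * width N δ b) ≤ μ S := by
  obtain ⟨ν, h1, h2, h3⟩ := h.exists_strips x₀ hη
  have hη' : 0 ≤ 1 - η := by linarith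
  have hnn : ∀ j : ℕ, 0 ≤ side (j * δ) (b (j + 1)) - side (j * δ) (b j) := fun j =>
    sub_nonneg.2 (h.side_le j ⟨le_rfl, by linarith [h.pos]⟩)
  rw [width, Finset.mul_sum, ENNReal.ofReal_sum_of_nonneg fun j _ => by
    have := hnn j; positivity]
  calc _ ≤ ∑ j ∈ Finset.range N,
        μ (S ∩ strip (ν j) (shrink x₀ η (b j)) (shrink x₀ η (b (j + 1)))) := by
        refine Finset.sum_le_sum fun j hj => le_trans (ENNReal.ofReal_le_ofReal ?_)
          (hstrip (ν j) j (h1 j (Finset.mem_range.1 hj)))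
        rw [mul_assoc]
        exact mul_le_mul_of_nonneg_left (h2 j (Finset.mem_range.1 hj)) ha
    _ = μ (⋃ j ∈ Finset.range N,
        S ∩ strip (ν j) (shrink x₀ η (b j)) (shrink x₀ η (b (j + 1)))) := by
        refine (measure_biUnion_finset ?_ fun j _ => hS.inter
            (isOpen_strip _ _ _).measurableSet).symm
        rw [Finset.coe_range]
        exact h3.mono_on fun j _ => Set.inter_subset_right
    _ ≤ μ S := measure_mono (Set.iUnion₂_subset fun j _ => Set.inter_subset_left)

lemma ofReal_width_le (h : IsFan Ω N δ b) (hconv : Convex ℝ Ω) (hcomp : IsCompact Ω)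
    (hint : (interior Ω).Nonempty) :
    ENNReal.ofReal (width N δ b) ≤ μH[1] (frontier Ω) := by
  obtain ⟨x₀, hx₀⟩ := hint
  obtain ⟨ρ, hρ, hball⟩ := nhds_basis_closedBall.mem_iff.1 (mem_interior_iff_mem_nhds.1 hx₀)
  have h1 : ∀ η ∈ Set.Ioo (0 : ℝ) 1,
      ENNReal.ofReal (1 * (1 - η) * width N δ b) ≤ μH[1] (frontier Ω) := by
    intro η hη
    refine h.le_measure_of_forall_strip x₀ hη.2.le _ isClosed_frontier.measurableSet zero_le_one
      fun ν j hj => ?_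
    have hin : ∀ i, shrink x₀ η (b i) ∈ interior Ω := fun i => mem_interior_iff_mem_nhds.2
      (mem_of_superset (closedBall_mem_nhds _ (mul_pos hη.1 hρ))
        (closedBall_shrink_subset hconv hball hη.1 hη.2.le (h.isHighest i).1))
    rw [one_mul]
    exact le_hausdorffMeasure_frontier_inter_strip hconv hcomp hj (hin j) (hin (j + 1))
  have hlim : Tendsto (fun η : ℝ => ENNReal.ofReal (1 * (1 - η) * width N δ b)) (𝓝[>] 0)
      (𝓝 (ENNReal.ofReal (width N δ b))) := by
    refine (ENNReal.tendsto_ofReal (Tendsto.mono_left ?_ nhdsWithin_le_nhds))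
    have : Continuous fun η : ℝ => 1 * (1 - η) * width N δ b := by fun_prop
    simpa using this.tendsto 0
  refine le_of_tendsto hlim ?_
  filter_upwards [Ioo_mem_nhdsGT zero_lt_one] with η hη using h1 η hη

lemma le_volume_infDist (h : IsFan Ω N δ b) (hconv : Convex ℝ Ω) (hcomp : IsCompact Ω)
    {x₀ : Plane} {ρ t : ℝ} (hball : closedBall x₀ ρ ⊆ Ω) (ht : 0 < t) (htρ : t ≤ ρ) :
    ENNReal.ofReal (t * (1 - t / ρ) * width N δ b) ≤ volume {x ∈ Ω | infDist x Ωᶜ < t} := by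
  have hρ := ht.trans_le htρ
  refine h.le_measure_of_forall_strip x₀ ((div_le_one hρ).2 htρ) volume
    (hcomp.isClosed.measurableSet.inter
      (isOpen_lt (continuous_infDist_pt _) continuous_const).measurableSet) ht.le
    fun ν j hj => ?_
  have hin : ∀ i, closedBall (shrink x₀ (t / ρ) (b i)) t ⊆ Ω := fun i => by
    have := closedBall_shrink_subset hconv hball (div_pos ht hρ) ((div_le_one hρ).2 htρ)
      (h.isHighest i).1
    rwa [div_mul_cancel₀ _ hρ.ne'] at this
  exact le_volume_infDist_inter_strip hconv hcomp ht.le hj (hin j) (hin (j + 1))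

end IsFan

end Strips

section Perimeter

variable {Ω : Set Plane}

lemma exists_isFan_forall (hcomp : IsCompact Ω) (hne : Ω.Nonempty) {p : ℝ → Prop}
    (hp : ∀ N δ b, IsFan Ω N δ b → p δ) : ∀ᶠ N : ℕ in atTop, p (2 * π / N) := by
  filter_upwards [eventually_ge_atTop 8] with N hN
  obtain ⟨b, hb⟩ := exists_isFan hcomp hne hN
  exact hp _ _ _ hb

lemma tendsto_two_pi_div : Tendsto (fun N : ℕ => 2 * π / (N : ℝ)) atTop (𝓝 0) :=
  tendsto_const_div_atTop_nhds_zero_nat _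

lemma hausdorffMeasure_frontier_ne_top (hconv : Convex ℝ Ω) (hcomp : IsCompact Ω)
    (hint : (interior Ω).Nonempty) : μH[1] (frontier Ω) ≠ ∞ := by
  obtain ⟨b, hb⟩ := exists_isFan hcomp (hint.mono interior_subset) le_rfl
  exact ((hb.hausdorffMeasure_frontier_le hconv hcomp hint).trans_lt ENNReal.ofReal_lt_top).ne

lemma IsFan.width_le {N : ℕ} {δ : ℝ} {b : ℕ → Plane} (h : IsFan Ω N δ b) (hconv : Convex ℝ Ω)
    (hcomp : IsCompact Ω) (hint : (interior Ω).Nonempty) :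
    width N δ b ≤ (μH[1] (frontier Ω)).toReal :=
  (ENNReal.ofReal_le_iff_le_toReal (hausdorffMeasure_frontier_ne_top hconv hcomp hint)).1
    (h.ofReal_width_le hconv hcomp hint)

lemma IsFan.toReal_hausdorffMeasure_le {N : ℕ} {δ : ℝ} {b : ℕ → Plane} (h : IsFan Ω N δ b)
    (hconv : Convex ℝ Ω) (hcomp : IsCompact Ω) (hint : (interior Ω).Nonempty) :
    (μH[1] (frontier Ω)).toReal ≤ (1 + 2 * δ) * width N δ b :=
  ENNReal.toReal_le_of_le_ofReal
    (mul_nonneg (by linarith [h.pos]) h.width_nonneg)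
    (h.hausdorffMeasure_frontier_le hconv hcomp hint)

lemma toReal_hausdorffMeasure_frontier_pos (hconv : Convex ℝ Ω) (hcomp : IsCompact Ω)
    (hint : (interior Ω).Nonempty) : 0 < (μH[1] (frontier Ω)).toReal := by
  refine ENNReal.toReal_pos (fun h0 => ?_) (hausdorffMeasure_frontier_ne_top hconv hcomp hint)
  obtain ⟨x₀, hx₀⟩ := hint
  obtain ⟨ρ, hρ, hball⟩ := isOpen_iff.1 isOpen_interior x₀ hx₀
  have h1 : x₀ + planePoint 0 (ρ / 2) 0 ∈ interior Ω := hball (by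
    rw [mem_ball, dist_eq_norm, add_sub_cancel_left]
    have := norm_le_abs_side_add_abs_height 0 (planePoint 0 (ρ / 2) 0)
    rw [side_planePoint, height_planePoint, abs_zero, abs_of_pos (by linarith)] at this
    linarith)
  have h2 := le_hausdorffMeasure_frontier_inter_strip hconv hcomp (ν := 0) (by simp) hx₀ h1
  have h3 := h2.trans (measure_mono Set.inter_subset_left)
  rw [h0, side_add, side_planePoint, nonpos_iff_eq_zero, ENNReal.ofReal_eq_zero] at h3
  linarith

lemma le_volume_infDist_lt (hconv : Convex ℝ Ω) (hcomp : IsCompact Ω)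
    {x₀ : Plane} {ρ t : ℝ} (hball : closedBall x₀ ρ ⊆ Ω) (ht : 0 < t) (htρ : t ≤ ρ) :
    ENNReal.ofReal (t * (1 - t / ρ) * (μH[1] (frontier Ω)).toReal) ≤
      volume {x ∈ Ω | infDist x Ωᶜ < t} := by
  have hρ := ht.trans_le htρ
  have hint : (interior Ω).Nonempty := ⟨x₀, mem_interior_iff_mem_nhds.2
    (mem_of_superset (closedBall_mem_nhds _ hρ) hball)⟩
  set P := (μH[1] (frontier Ω)).toReal
  have h1 := exists_isFan_forall hcomp (hint.mono interior_subset)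
    (p := fun δ => ENNReal.ofReal (t * (1 - t / ρ) * (P / (1 + 2 * δ))) ≤
      volume {x ∈ Ω | infDist x Ωᶜ < t}) fun N δ b hb => by
    refine le_trans (ENNReal.ofReal_le_ofReal ?_) (hb.le_volume_infDist hconv hcomp hball ht htρ)
    have : 0 ≤ 1 - t / ρ := sub_nonneg.2 ((div_le_one hρ).2 htρ)
    gcongr
    exact div_le_of_le_mul₀ (by linarith [hb.pos]) hb.width_nonneg
      (by linarith [hb.toReal_hausdorffMeasure_le hconv hcomp hint])
  refine le_of_tendsto (ENNReal.tendsto_ofReal ?_) h1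
  have h2 : Tendsto (fun δ : ℝ => t * (1 - t / ρ) * (P / (1 + 2 * δ))) (𝓝 0)
      (𝓝 (t * (1 - t / ρ) * (P / (1 + 2 * 0)))) :=
    ContinuousAt.tendsto (f := fun δ : ℝ => t * (1 - t / ρ) * (P / (1 + 2 * δ)))
      (by fun_prop (disch := norm_num))
  rw [mul_zero, add_zero, div_one] at h2
  exact h2.comp tendsto_two_pi_div

lemma volume_infDist_le_le (hconv : Convex ℝ Ω) (hcomp : IsCompact Ω)
    (hint : (interior Ω).Nonempty) {t : ℝ} (ht : 0 ≤ t) :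
    volume {x ∈ Ω | infDist x Ωᶜ ≤ t} ≤
      ENNReal.ofReal (((μH[1] (frontier Ω)).toReal + 4 * π * t) * t) := by
  set P := (μH[1] (frontier Ω)).toReal
  have h1 := exists_isFan_forall hcomp (hint.mono interior_subset)
    (p := fun δ => volume {x ∈ Ω | infDist x Ωᶜ ≤ t} ≤
      ENNReal.ofReal ((P + 4 * π * t) * (t * (1 + 2 * δ ^ 2)))) fun N δ b hb => by
    refine (hb.volume_infDist_le hconv hcomp hint ht).trans (ENNReal.ofReal_le_ofReal ?_)
    gcongr
    exact hb.width_le hconv hcomp hint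
  refine ge_of_tendsto (ENNReal.tendsto_ofReal ?_) h1
  have h2 : Tendsto (fun δ : ℝ => (P + 4 * π * t) * (t * (1 + 2 * δ ^ 2))) (𝓝 0)
      (𝓝 ((P + 4 * π * t) * (t * (1 + 2 * 0 ^ 2)))) :=
    ContinuousAt.tendsto (f := fun δ : ℝ => (P + 4 * π * t) * (t * (1 + 2 * δ ^ 2)))
      (by fun_prop)
  rw [zero_pow two_ne_zero, mul_zero, add_zero, mul_one] at h2
  exact h2.comp tendsto_two_pi_div

end Perimeter

section Caps

variable {Ω : Set Plane}

lemma volume_real_closedBall (x : Plane) {r : ℝ} (hr : 0 ≤ r) :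
    volume.real (closedBall x r) = π * r ^ 2 := by
  rw [Measure.real, EuclideanSpace.volume_closedBall_fin_two, ENNReal.toReal_mul,
    ENNReal.toReal_pow, ENNReal.toReal_ofReal hr]
  simp [mul_comm, pi_pos.le]

lemma volume_real_closedBall_inter_le (hconv : Convex ℝ Ω) (hcomp : IsCompact Ω)
    (hint : (interior Ω).Nonempty) {x : Plane} (hx : x ∈ Ω) {r : ℝ} (hr : 0 ≤ r) :
    volume.real (closedBall x r ∩ Ω) ≤ capArea r (infDist x Ωᶜ) := by
  obtain ⟨φ, b, hb, -, hxb⟩ := exists_isHighest_eq_sub hconv hcomp hint hx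
  rw [capArea, ← volume_closedBall_height_le φ r _ hr x]
  refine measureReal_mono (fun z hz => ⟨hz.1, ?_⟩) ?_
  · have h1 := hb.2 z hz.2
    have h2 := congrArg (height φ) hxb
    rw [height_sub, height_planePoint] at h2
    show height φ (z - x) ≤ _
    rw [height_sub]
    linarith
  · rw [volume_closedBall_height_le φ r _ hr x]
    exact volume_discBelow_ne_top hr _

lemma volume_real_closedBall_inter_eq (hcl : IsClosed Ω) {x : Plane} (hx : x ∈ Ω) {r : ℝ}
    (hr : 0 ≤ r) (hxr : r ≤ infDist x Ωᶜ) : volume.real (closedBall x r ∩ Ω) = π * r ^ 2 := by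
  rw [Set.inter_eq_left.2 (closedBall_subset_of_le_infDist hcl hx hxr), volume_real_closedBall x hr]

lemma le_volume_real_closedBall_inter (hconv : Convex ℝ Ω) {x₀ : Plane} {ρ D : ℝ} (hρ : 0 < ρ)
    (hball : closedBall x₀ ρ ⊆ Ω) (hD : Ω ⊆ closedBall x₀ D) (hρD : ρ ≤ D) {x : Plane}
    (hx : x ∈ Ω) {r : ℝ} (hr : 0 < r) (hrD : r ≤ D) :
    π * ρ ^ 2 / (4 * D ^ 2) * r ^ 2 ≤ volume.real (closedBall x r ∩ Ω) := by
  have hD0 : 0 < D := hρ.trans_le hρD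
  set τ := r / (2 * D) with hτ
  have hτD : τ * D = r / 2 := by rw [hτ]; field_simp
  have hτ0 : 0 < τ := by positivity
  have hsub := closedBall_shrink_subset hconv hball hτ0
    ((div_le_one (by positivity)).2 (by linarith)) hx
  have h1 : closedBall (shrink x₀ τ x) (τ * ρ) ⊆ closedBall x r := by
    refine closedBall_subset_closedBall' ?_
    have h2 : dist (shrink x₀ τ x) x ≤ τ * D := by
      rw [dist_eq_norm, show shrink x₀ τ x - x = τ • (x₀ - x) by rw [shrink]; module,
        norm_smul, norm_of_nonneg hτ0.le, ← dist_eq_norm, dist_comm]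
      gcongr
      exact hD hx
    have : τ * ρ ≤ τ * D := by gcongr
    linarith
  calc π * ρ ^ 2 / (4 * D ^ 2) * r ^ 2 = π * (τ * ρ) ^ 2 := by rw [hτ]; field_simp; norm_num
    _ = volume.real (closedBall (shrink x₀ τ x) (τ * ρ)) :=
      (volume_real_closedBall _ (by positivity)).symm
    _ ≤ _ := measureReal_mono (Set.subset_inter h1 hsub)
      ((measure_mono Set.inter_subset_left).trans_lt measure_closedBall_lt_top).ne

/-- A convex set reaches below any of its points as soon as it contains a low point. -/
lemma exists_mem_side_eq (hconv : Convex ℝ Ω) {φ u : ℝ} {a c : Plane} (ha : a ∈ Ω) (hc : c ∈ Ω)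
    (hu : u ∈ Set.uIcc (side φ a) (side φ c)) :
    ∃ τ ∈ Set.Icc (0 : ℝ) 1, a + τ • (c - a) ∈ Ω ∧ side φ (a + τ • (c - a)) = u := by
  have hcont : ContinuousOn (fun τ : ℝ => side φ a + τ * (side φ c - side φ a))
      (Set.uIcc 0 1) := by fun_prop
  obtain ⟨τ, hτ, h⟩ := intermediate_value_uIcc hcont
    (by simpa using hu : u ∈ Set.uIcc (side φ a + 0 * (side φ c - side φ a))
      (side φ a + 1 * (side φ c - side φ a)))
  rw [Set.uIcc_of_le zero_le_one] at hτ
  exact ⟨τ, hτ, hconv.add_smul_sub_mem ha hc hτ, by simpa using h⟩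

lemma mem_of_side_eq_of_height_le (hconv : Convex ℝ Ω) {φ : ℝ} {p q z : Plane} (hp : p ∈ Ω)
    (hq : q ∈ Ω) (hpz : side φ p = side φ z) (hqz : side φ q = side φ z)
    (h1 : height φ p ≤ height φ z) (h2 : height φ z ≤ height φ q) : z ∈ Ω := by
  have hcont : ContinuousOn (fun τ : ℝ => height φ p + τ * (height φ q - height φ p))
      (Set.Icc 0 1) := by fun_prop
  obtain ⟨τ, hτ, h⟩ := intermediate_value_Icc zero_le_one hcont
    (by simpa using And.intro h1 h2 : height φ z ∈ Set.Icc
      (height φ p + 0 * (height φ q - height φ p)) (height φ p + 1 * (height φ q - height φ p)))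
  have : p + τ • (q - p) = z := plane_ext (θ := φ) (by simp [hpz, hqz]) (by simpa using h)
  exact this ▸ hconv.add_smul_sub_mem hp hq hτ

/-- Flatness of the frontier between two flat neighbours `a` and `c` of a highest point `β`. -/
lemma mem_of_flat (hconv : Convex ℝ Ω) {x₀ : Plane} {ρ D r δ φ : ℝ} (hρ : 0 < ρ) (hD0 : 0 < D)
    (hball : closedBall x₀ ρ ⊆ Ω) (hD : Ω ⊆ closedBall x₀ D) {β a c : Plane}
    (hβ : IsHighest Ω φ β) (ha : a ∈ Ω) (hc : c ∈ Ω) (hr : 0 ≤ r)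
    (haβ : height φ β - height φ a ≤ 2 * δ * |side φ β - side φ a|)
    (hcβ : height φ β - height φ c ≤ 2 * δ * |side φ β - side φ c|) (hδ : 0 ≤ δ)
    (ha' : r + 2 * D * r / ρ ≤ side φ β - side φ a) (hc' : r + 2 * D * r / ρ ≤ side φ c - side φ β)
    {z : Plane} (hz : |side φ z - side φ β| ≤ r) (hz1 : height φ z ≤ height φ β - 2 * δ * r)
    (hz2 : height φ β - 2 * r ≤ height φ z) : z ∈ Ω := by
  have hx₀Ω : x₀ ∈ Ω := hball (mem_closedBall_self hρ.le)
  have hx₀ : height φ x₀ ≤ height φ β - ρ := by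
    have h1 : x₀ + planePoint φ 0 ρ ∈ Ω := hball (by
      rw [mem_closedBall, dist_eq_norm, add_sub_cancel_left]
      have := norm_le_abs_side_add_abs_height φ (planePoint φ 0 ρ)
      rwa [side_planePoint, height_planePoint, abs_zero, zero_add, abs_of_pos hρ] at this)
    have h2 := hβ.2 _ h1
    rw [height_add, height_planePoint] at h2
    linarith
  have bottom : ∀ e ∈ Ω, side φ z ∈ Set.uIcc (side φ e) (side φ x₀) →
      2 * D * r / ρ ≤ |side φ z - side φ e| →
      ∃ p ∈ Ω, side φ p = side φ z ∧ height φ p ≤ height φ β - 2 * r := by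
    intro e he hu hle
    obtain ⟨τ, hτ, hmem, hside⟩ := exists_mem_side_eq hconv he hx₀Ω hu
    refine ⟨_, hmem, hside, ?_⟩
    rw [← hside, side_add, side_smul, add_sub_cancel_left, abs_mul, abs_of_nonneg hτ.1] at hle
    have h1 : |side φ (x₀ - e)| ≤ D :=
      (abs_side_le_norm φ _).trans (by rw [← dist_eq_norm, dist_comm]; exact hD he)
    have h2 : 2 * D * r / ρ ≤ τ * D := hle.trans (mul_le_mul_of_nonneg_left h1 hτ.1)
    rw [div_le_iff₀ hρ] at h2
    have h3 : 2 * r ≤ τ * ρ := le_of_mul_le_mul_left (by linarith) hD0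
    rw [height_add, height_smul, height_sub]
    nlinarith [mul_le_mul_of_nonneg_left (hβ.2 e he) (sub_nonneg.2 hτ.2),
      mul_le_mul_of_nonneg_left hx₀ hτ.1]
  have top : ∀ e ∈ Ω, height φ β - height φ e ≤ 2 * δ * |side φ β - side φ e| →
      side φ z ∈ Set.uIcc (side φ β) (side φ e) →
      ∃ q ∈ Ω, side φ q = side φ z ∧ height φ z ≤ height φ q := by
    intro e he hle hu
    obtain ⟨τ, hτ, hmem, hside⟩ := exists_mem_side_eq hconv hβ.1 he hu
    refine ⟨_, hmem, hside, ?_⟩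
    rw [← hside, side_add, side_smul, add_sub_cancel_left, abs_mul, abs_of_nonneg hτ.1,
      side_sub, abs_sub_comm] at hz
    rw [height_add, height_smul, height_sub]
    nlinarith [mul_le_mul_of_nonneg_left hle hτ.1, mul_le_mul_of_nonneg_left hz hδ]
  have hzr := abs_le.1 hz
  have hnn : 0 ≤ 2 * D * r / ρ := by positivity
  obtain ⟨p, hp, hpz, hp'⟩ : ∃ p ∈ Ω, side φ p = side φ z ∧ height φ p ≤ height φ β - 2 * r := by
    rcases le_total (side φ z) (side φ x₀) with h | h
    · refine bottom a ha (Set.mem_uIcc_of_le (by linarith) h) ?_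
      exact le_trans (by linarith) (le_abs_self _)
    · refine bottom c hc (Set.mem_uIcc_of_ge h (by linarith)) ?_
      exact le_trans (by linarith) (neg_le_abs _)
  obtain ⟨q, hq, hqz, hzq⟩ : ∃ q ∈ Ω, side φ q = side φ z ∧ height φ z ≤ height φ q := by
    rcases le_total (side φ z) (side φ β) with h | h
    · exact top a ha haβ (Set.mem_uIcc_of_ge (by linarith) h)
    · exact top c hc hcβ (Set.mem_uIcc_of_le h (by linarith))
  exact mem_of_side_eq_of_height_le hconv hp hq hpz hqz (by linarith) hzq

/-- Points of an arc lie between its endpoints, in the direction of their own normal. -/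
lemma side_mem_Icc_of_mem_arc {α δ φ : ℝ} {a c β : Plane} (hδ : 0 < δ) (hδ4 : δ ≤ π / 4)
    (ha : IsHighest Ω α a) (hc : IsHighest Ω (α + δ) c) (h : (φ, β) ∈ arc Ω α (α + δ) a c) :
    side φ β ∈ Set.Icc (side φ a) (side φ c) := by
  obtain ⟨⟨h1, h2⟩, hβ, h3, h4⟩ := h
  dsimp only at h1 h2 hβ h3 h4
  constructor
  · rcases h1.eq_or_lt with rfl | hlt
    · exact h3
    · exact ha.side_le_side hβ hlt (by linarith [pi_pos])
        (abs_le.2 ⟨by linarith [pi_pos], by linarith [pi_pos]⟩)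
        (abs_le.2 ⟨by linarith [pi_pos], by linarith [pi_pos]⟩)
  · rcases h2.eq_or_lt with rfl | hlt
    · have h5 : height (α + δ) (c - β) = 0 := by
        rw [height_sub]
        linarith [hβ.2 c hc.1, hc.2 β hβ.1]
      have h6 := side_eq_cos_mul_sub (α + δ) α (c - β)
      rw [h5, mul_zero, sub_zero, side_sub, side_sub] at h6
      have h7 := half_le_cos (t := α - (α + δ)) (by
        rw [sub_add_cancel_left, abs_neg, abs_of_pos hδ]
        exact hδ4)
      by_contra! h8
      nlinarith
    · exact hβ.side_le_side hc hlt (by linarith [pi_pos])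
        (abs_le.2 ⟨by linarith [pi_pos], by linarith [pi_pos]⟩)
        (abs_le.2 ⟨by linarith [pi_pos], by linarith [pi_pos]⟩)

lemma IsFan.capArea_le (hconv : Convex ℝ Ω) (hcomp : IsCompact Ω)
    {N : ℕ} {δ : ℝ} {b : ℕ → Plane} (h : IsFan Ω N δ b) {x₀ : Plane} {ρ D r : ℝ} (hρ : 0 < ρ)
    (hD0 : 0 < D) (hball : closedBall x₀ ρ ⊆ Ω) (hD : Ω ⊆ closedBall x₀ D) (hr : 0 < r)
    {x : Plane} (hx : x ∈ Ω) (hdr : infDist x Ωᶜ ≤ r)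
    (hfar : ∀ i ≤ N, (4 + 6 * D / ρ) * r ≤ dist x (b i)) :
    capArea r (infDist x Ωᶜ - 2 * δ * r) ≤ volume.real (closedBall x r ∩ Ω) := by
  have hint : (interior Ω).Nonempty := ⟨x₀, mem_interior_iff_mem_nhds.2
    (mem_of_superset (closedBall_mem_nhds _ hρ) hball)⟩
  have hδ := h.pos
  have hδ4 := h.le_pi_div_four
  obtain ⟨ψ, β, hβψ, -, hxβ⟩ := exists_isHighest_eq_sub hconv hcomp hint hx
  obtain ⟨j, hj, φ, hh, hs, harc⟩ := h.exists_mem_arc hβψ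
  have hβ : IsHighest Ω φ β := harc.2.1
  have hhx : height φ x = height φ β - infDist x Ωᶜ := by
    have h2 := congrArg (height ψ) hxβ
    rw [height_sub, height_planePoint] at h2
    rwa [hh]
  have hsx : side φ x = side φ β := by
    have h2 := congrArg (side ψ) hxβ
    rw [side_sub, side_planePoint, sub_zero] at h2
    rwa [hs]
  have hmem := side_mem_Icc_of_mem_arc hδ hδ4 (h.isHighest j) (h.isHighest_succ j) harc
  have hφ := harc.1
  dsimp only at hφ
  have ha : height φ (β - b j) ≤ 2 * δ * |side φ (β - b j)| :=
    height_le_of_rotated_nonpos (α := φ) (φ := j * δ) hδ4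
      (abs_le.2 ⟨by linarith [hφ.2], by linarith [hφ.1]⟩)
      (by rw [height_sub]; linarith [(h.isHighest j).2 β hβ.1])
  have hc : height φ (β - b (j + 1)) ≤ 2 * δ * |side φ (β - b (j + 1))| :=
    height_le_of_rotated_nonpos (α := φ) (φ := j * δ + δ) hδ4
      (abs_le.2 ⟨by linarith [hφ.2], by linarith [hφ.1]⟩)
      (by rw [height_sub]; linarith [(h.isHighest_succ j).2 β hβ.1])
  have hd0 : 0 ≤ infDist x Ωᶜ := infDist_nonneg
  have hside : ∀ i ≤ N, b i ∈ Ω → height φ (β - b i) ≤ 2 * δ * |side φ (β - b i)| →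
      r + 2 * D * r / ρ ≤ |side φ (β - b i)| := by
    intro i hi hbi hle
    have h1 := hfar i hi
    have h2 : dist x (b i) ≤ infDist x Ωᶜ + (|side φ (β - b i)| + |height φ (β - b i)|) := by
      rw [dist_eq_norm]
      refine (norm_le_abs_side_add_abs_height φ _).trans ?_
      rw [side_sub, height_sub, hsx, hhx, side_sub, height_sub]
      have := abs_sub (height φ β - height φ (b i)) (infDist x Ωᶜ)
      rw [abs_of_nonneg hd0] at this
      rw [show height φ β - infDist x Ωᶜ - height φ (b i) =
        height φ β - height φ (b i) - infDist x Ωᶜ by ring]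
      linarith
    have h3 : |height φ (β - b i)| ≤ 2 * |side φ (β - b i)| := by
      rw [abs_of_nonneg (by rw [height_sub]; linarith [hβ.2 _ hbi])]
      refine hle.trans ?_
      gcongr
      linarith [pi_le_four]
    have h4 : (4 + 6 * D / ρ) * r = 4 * r + 3 * (2 * D * r / ρ) := by ring
    linarith
  have hja := hside j hj.le (h.isHighest j).1 ha
  have hjc := hside (j + 1) hj (h.isHighest_succ j).1 hc
  rw [side_sub, abs_of_nonneg (by linarith [hmem.1])] at hja
  rw [side_sub, abs_of_nonpos (by linarith [hmem.2])] at hjc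
  rw [height_sub, side_sub] at ha hc
  rw [capArea, ← volume_closedBall_height_le φ r _ hr.le x]
  refine measureReal_mono (fun z hz => ⟨hz.1, ?_⟩)
    ((measure_mono Set.inter_subset_left).trans_lt measure_closedBall_lt_top).ne
  obtain ⟨hz1, hz2⟩ := hz
  rw [mem_closedBall, dist_eq_norm] at hz1
  have hz3 := (abs_side_le_norm φ (z - x)).trans hz1
  have hz4 := (abs_height_le_norm φ (z - x)).trans hz1
  rw [side_sub, hsx] at hz3
  rw [height_sub, hhx] at hz2 hz4
  exact mem_of_flat hconv hρ hD0 hball hD hβ (h.isHighest j).1 (h.isHighest_succ j).1 hr.le ha hc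
      hδ.le hja
    (by linarith) hz3 (by linarith) (by linarith [(abs_le.1 hz4).1])

end Caps

section Overlap

variable {Ω : Set Plane}

lemma dist_planePoint_zero (φ s : ℝ) (hs : 0 ≤ s) (x : Plane) : dist (x + planePoint φ 0 s) x =
    s := by
  rw [dist_eq_norm, add_sub_cancel_left]
  have h := norm_sq_eq_side_height φ (planePoint φ 0 s)
  rw [side_planePoint, height_planePoint, zero_pow two_ne_zero, zero_add] at h
  exact (pow_left_inj₀ (norm_nonneg _) hs two_ne_zero).1 h

lemma one_sub_mul_lt_norm_sq {φ s η r κ : ℝ} (hs : 0 ≤ s) (hr : 0 ≤ r) (hη : η ≤ 1 / 2)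
    (hκ : 2 * η * r ≤ κ * s) {w : Plane} (hw : κ * ‖w‖ ≤ height φ w) (hw1 : (1 - η) * r < ‖w‖)
    (hκ0 : 0 ≤ κ) :
    r ^ 2 < ‖w + planePoint φ 0 s‖ ^ 2 := by
  have h0 : 0 ≤ (1 - η) * r := by nlinarith
  rw [norm_sq_eq_side_height φ, side_add, side_planePoint, height_add, height_planePoint]
  have h1 := norm_sq_eq_side_height φ w
  have h2 : ((1 - η) * r) ^ 2 < ‖w‖ ^ 2 := by gcongr
  have h3 : (κ * s) * ((1 - η) * r) ≤ s * height φ w := by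
    calc (κ * s) * ((1 - η) * r) ≤ (κ * s) * ‖w‖ := by gcongr
      _ = s * (κ * ‖w‖) := by ring
      _ ≤ _ := by gcongr
  have h4 : 2 * η * r * ((1 - η) * r) ≤ (κ * s) * ((1 - η) * r) := by gcongr
  rcases le_total 0 η with h | h
  · nlinarith [sq_nonneg s, mul_nonneg h (sq_nonneg r),
      mul_nonneg (mul_nonneg h (sub_nonneg.2 hη)) (sq_nonneg r)]
  · nlinarith [sq_nonneg s, sq_nonneg r, mul_nonneg (neg_nonneg.2 h) (sq_nonneg r),
      mul_nonneg (sq_nonneg η) (sq_nonneg r), mul_nonneg hs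
          (show 0 ≤ height φ w from le_trans (by positivity) hw)]

lemma le_volume_sdiff_of_height_le (hconv : Convex ℝ Ω) {x₀ : Plane} {ρ D r s φ : ℝ} (hρ : 0 < ρ)
    (hρD : ρ ≤ D) (hball : closedBall x₀ ρ ⊆ Ω) (hD : Ω ⊆ closedBall x₀ D) (hr : 0 < r)
    (hrρ : r ≤ ρ / 8) (hs : 0 ≤ s) (hsr : s ≤ 2 * r) {x y : Plane} (hy : y ∈ Ω)
    (hxy : y = x + planePoint φ 0 s) (hφ : height φ y - s / 2 ≤ height φ x₀) :
    π * ρ ^ 3 / (2048 * D ^ 3) * (r * s) ≤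
      volume.real ((closedBall y r \ closedBall x r) ∩ Ω) := by
  have hD0 : 0 < D := hρ.trans_le hρD
  set w₀ := x₀ + planePoint φ 0 (ρ / 2) with hw₀
  set C : Set Plane := {z | ∃ t : ℝ, 0 ≤ t ∧ ∃ q ∈ closedBall w₀ (ρ / 4), z = y + t •
      (q - y)} with hC
  set S := closedBall y r ∩ C with hS
  set η := ρ / (16 * D) * s / (2 * r) with hη
  have hη0 : 0 ≤ η := by positivity
  have hη1 : η ≤ 1 / 2 := by
    rw [hη, div_le_iff₀ (by positivity), div_mul_eq_mul_div, div_le_iff₀ (by positivity)]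
    nlinarith
  have hwball : closedBall w₀ (ρ / 4) ⊆ closedBall x₀ ρ :=
    closedBall_subset_closedBall' (by
      have := dist_planePoint_zero φ (ρ / 2) (by positivity) x₀
      linarith)
  have hq : ∀ q ∈ closedBall w₀ (ρ / 4), ρ / 8 ≤ height φ (q - y) ∧ ‖q - y‖ ≤ 2 * D := by
    intro q hq
    constructor
    · rw [mem_closedBall, dist_eq_norm] at hq
      have h1 := abs_le.1 ((abs_height_le_norm φ (q - w₀)).trans hq)
      rw [height_sub, hw₀, height_add, height_planePoint] at h1
      rw [height_sub]
      linarith [h1.1]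
    · have h1 : dist q x₀ ≤ ρ := hwball hq
      have h2 : dist y x₀ ≤ D := hD hy
      rw [← dist_eq_norm]
      linarith [dist_triangle_right q y x₀]
  have hSΩ : S ⊆ Ω := by
    rintro z ⟨hz, t, ht, q, hqb, rfl⟩
    have h1 := hq q hqb
    rw [mem_closedBall, dist_eq_norm, add_sub_cancel_left, norm_smul, norm_of_nonneg ht] at hz
    have h2 : ρ / 8 ≤ ‖q - y‖ := h1.1.trans ((le_abs_self _).trans (abs_height_le_norm φ _))
    have h3 : t ≤ 1 := by
      by_contra! h
      nlinarith
    exact hconv.add_smul_sub_mem hy (hball (hwball hqb)) ⟨ht, h3⟩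
  have hSfin : volume S ≠ ∞ :=
    ((measure_mono Set.inter_subset_left).trans_lt measure_closedBall_lt_top).ne
  have hSvol : π * (r * ρ / (8 * D)) ^ 2 ≤ volume.real S := by
    rw [← volume_real_closedBall (y + (r / (2 * D)) • (w₀ - y)) (by positivity)]
    refine measureReal_mono ?_ hSfin
    intro z hz
    have hτ : 0 < r / (2 * D) := by positivity
    set τ := r / (2 * D) with hτd
    have hqz : w₀ + τ⁻¹ • (z - (y + τ • (w₀ - y))) ∈ closedBall w₀ (ρ / 4) := by
      rw [mem_closedBall, dist_eq_norm] at hz ⊢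
      rw [add_sub_cancel_left, norm_smul, norm_inv, norm_of_nonneg hτ.le]
      calc τ⁻¹ * ‖z - (y + τ • (w₀ - y))‖ ≤ τ⁻¹ * (r * ρ / (8 * D)) := by gcongr
        _ = ρ / 4 := by rw [hτd]; field_simp; norm_num
    have hzq : z = y + τ • (w₀ + τ⁻¹ • (z - (y + τ • (w₀ - y))) - y) := by
      rw [add_sub_right_comm, smul_add, smul_inv_smul₀ hτ.ne']
      abel
    refine ⟨?_, τ, hτ.le, _, hqz, hzq⟩
    have h1 := (hq _ hqz).2
    rw [mem_closedBall, dist_eq_norm, hzq, add_sub_cancel_left, norm_smul, norm_of_nonneg hτ.le]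
    calc _ ≤ τ * (2 * D) := by gcongr
      _ = r := by rw [hτd]; field_simp
  set S' := AffineMap.homothety y (1 - η) '' S with hS'
  have hS'vol : volume.real S' = (1 - η) ^ 2 * volume.real S := by
    rw [hS', Measure.real, Measure.addHaar_image_homothety, finrank_euclideanSpace_fin,
      ENNReal.toReal_mul, abs_of_nonneg (sq_nonneg _), ENNReal.toReal_ofReal (sq_nonneg _)]
    rfl
  have hS'fin : volume S' ≠ ∞ := by
    rw [hS', Measure.addHaar_image_homothety]
    exact ENNReal.mul_ne_top ENNReal.ofReal_ne_top hSfin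
  have hdiff : volume.real S ≤ volume.real S' + volume.real (S \ S') :=
    (measureReal_mono (fun z hz => (em (z ∈ S')).imp id fun h => ⟨hz, h⟩)
      (measure_union_ne_top hS'fin (measure_ne_top_of_subset Set.sdiff_subset hSfin))).trans
      (measureReal_union_le _ _)
  have hsub : S \ S' ⊆ (closedBall y r \ closedBall x r) ∩ Ω := by
    rintro z ⟨hzS, hzS'⟩
    refine ⟨⟨hzS.1, fun hzx => ?_⟩, hSΩ hzS⟩
    obtain ⟨hzr, t, ht, q, hqb, rfl⟩ := hzS
    have h1 := hq q hqb
    have hκ : ρ / (16 * D) * ‖q - y‖ ≤ height φ (q - y) := by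
      refine le_trans ?_ h1.1
      rw [div_mul_eq_mul_div, div_le_iff₀ (by positivity)]
      nlinarith [h1.2]
    have hlt : (1 - η) * r < ‖t • (q - y)‖ := by
      by_contra! hle
      have h2 : (0 : ℝ) < 1 - η := by linarith
      refine hzS' ⟨y + ((1 - η)⁻¹ * t) • (q - y), ⟨?_, (1 - η)⁻¹ * t, by positivity, q, hqb, rfl⟩,
          ?_⟩
      · rw [mem_closedBall, dist_eq_norm, add_sub_cancel_left, mul_smul, norm_smul, norm_inv,
          norm_of_nonneg h2.le, inv_mul_le_iff₀ h2]
        exact hle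
      · rw [AffineMap.homothety_apply, vsub_eq_sub, add_sub_cancel_left, vadd_eq_add, smul_smul,
          mul_inv_cancel_left₀ h2.ne', add_comm]
    have h3 := one_sub_mul_lt_norm_sq hs hr.le hη1 (κ := ρ / (16 * D)) (φ := φ) (w := t • (q - y))
      (le_of_eq (by rw [hη]; field_simp)) (by
        rw [norm_smul, norm_of_nonneg ht, height_smul]
        nlinarith [mul_le_mul_of_nonneg_left hκ ht]) hlt (by positivity)
    rw [mem_closedBall, dist_eq_norm] at hzx
    have h4 : t • (q - y) + planePoint φ 0 s = y + t • (q - y) - x := by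
      nth_rewrite 2 [hxy]
      abel
    rw [h4] at h3
    have h5 : ‖y + t • (q - y) - x‖ ^ 2 ≤ r ^ 2 := by gcongr
    linarith
  have hfin : volume ((closedBall y r \ closedBall x r) ∩ Ω) ≠ ∞ :=
    ((measure_mono (Set.inter_subset_left.trans Set.sdiff_subset)).trans_lt
      measure_closedBall_lt_top).ne
  refine le_trans ?_ (measureReal_mono hsub hfin)
  rw [hS'vol] at hdiff
  calc π * ρ ^ 3 / (2048 * D ^ 3) * (r * s) = η * (π * (r * ρ / (8 * D)) ^ 2) := by
        rw [hη]; field_simp; ring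
    _ ≤ η * volume.real S := by gcongr
    _ ≤ volume.real (S \ S') := by
        have hS0 : 0 ≤ volume.real S := measureReal_nonneg
        nlinarith [mul_nonneg hη0 hS0]

lemma le_volume_sdiff_or (hconv : Convex ℝ Ω) {x₀ : Plane} {ρ D r : ℝ} (hρ : 0 < ρ)
    (hρD : ρ ≤ D) (hball : closedBall x₀ ρ ⊆ Ω) (hD : Ω ⊆ closedBall x₀ D) (hr : 0 < r)
    (hrρ : r ≤ ρ / 8) {x y : Plane} (hx : x ∈ Ω) (hy : y ∈ Ω) (hxy : dist y x ≤ 2 * r) :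
    π * ρ ^ 3 / (2048 * D ^ 3) * (r * dist y x) ≤
        volume.real ((closedBall y r \ closedBall x r) ∩ Ω) ∨
      π * ρ ^ 3 / (2048 * D ^ 3) * (r * dist y x) ≤
        volume.real ((closedBall x r \ closedBall y r) ∩ Ω) := by
  obtain ⟨φ, hφ⟩ := exists_eq_planePoint (y - x)
  rw [← dist_eq_norm] at hφ
  set s := dist y x with hs
  have hy' : y = x + planePoint φ 0 s := by rw [← hφ]; abel
  rcases le_total (height φ y - s / 2) (height φ x₀) with h | h
  · exact Or.inl (le_volume_sdiff_of_height_le hconv hρ hρD hball hD hr hrρ dist_nonneg hxy hy hy'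
      h)
  · have hneg : ∀ z, height (φ + π) z = -height φ z := fun z => by
      simp only [height, cos_add_pi, sin_add_pi]
      ring
    have hyx : height φ y = height φ x + s := by
      nth_rewrite 1 [hy']
      rw [height_add, height_planePoint]
    refine Or.inr (le_volume_sdiff_of_height_le (φ := φ + π) hconv hρ hρD hball hD hr hrρ
      dist_nonneg hxy hx (plane_ext (θ := φ + π) ?_ ?_) (by rw [hneg, hneg]; linarith))
    · have hside : ∀ z, side (φ + π) z = -side φ z := fun z => by
        simp only [side, cos_add_pi, sin_add_pi]
        ring
      have : side φ y = side φ x := by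
        nth_rewrite 1 [hy']
        rw [side_add, side_planePoint, add_zero]
      rw [side_add, side_planePoint, hside, hside, this, add_zero]
    · rw [height_add, height_planePoint, hneg, hneg]
      linarith

end Overlap

section CapMean

variable {k : ℕ} (ξ : ℝ)

lemma tendsto_critMean_pow_div (k : ℕ) (m : ℕ) :
    Tendsto (fun x => critMean k ξ x ^ m / x) atTop (𝓝 0) := by
  have h1 := ((tendsto_critMean_div_log k ξ).pow m).mul
    (isLittleO_pow_log_id_atTop (n := m)).tendsto_div_nhds_zero
  rw [one_pow, one_mul] at h1
  refine h1.congr' ?_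
  filter_upwards [tendsto_log_atTop.eventually_gt_atTop 0] with x hx
  simp only [id]
  rw [div_pow]
  field_simp

lemma tendsto_critRadius (k : ℕ) : Tendsto (critRadius k ξ) atTop (𝓝 0) := by
  have h := ((tendsto_critMean_pow_div ξ k 1).div_const π).sqrt
  rw [zero_div, sqrt_zero] at h
  refine h.congr fun x => ?_
  rw [critRadius, pow_one, div_div, mul_comm x]

lemma eventually_critRadius_pos (k : ℕ) : ∀ᶠ x in atTop,
    0 < x ∧ 0 < critMean k ξ x ∧ 0 < critRadius k ξ x := by
  filter_upwards [eventually_gt_atTop 0, (tendsto_critMean k ξ).eventually_gt_atTop 0] with x hx hL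
  exact ⟨hx, hL, sqrt_pos.2 (by positivity)⟩

lemma capArea_nonneg (r t : ℝ) : 0 ≤ capArea r t := ENNReal.toReal_nonneg

lemma tendsto_lintegral_poissonTail_capArea (hk : 1 ≤ k) :
    Tendsto (fun x => ENNReal.ofReal (2 * critRadius k ξ x)⁻¹ *
      ∫⁻ u in Set.Ico 0 (2 / π * critMean k ξ x), ENNReal.ofReal (poissonTail k
        (x * capArea (critRadius k ξ x) (u / (2 * x * critRadius k ξ x))))) atTop
      (𝓝 (ENNReal.ofReal (√π * exp (-(ξ / 2)) / (2 ^ (k + 1) * k.factorial)))) := by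
  set H : ℝ → ℝ → ℝ := fun x u => x * (capArea (critRadius k ξ x) (u / (2 * x * critRadius k ξ x)) -
    π * critRadius k ξ x ^ 2 / 2) with hH
  have key : ∀ᶠ x in atTop, ∀ u, 0 ≤ u → u < 2 / π * critMean k ξ x →
      0 ≤ u / (2 * x * critRadius k ξ x) ∧ u / (2 * x * critRadius k ξ x) ≤ critRadius k ξ x := by
    filter_upwards [eventually_critRadius_pos ξ k] with x ⟨hx, hL, hr⟩ u hu0 hu
    refine ⟨by positivity, (div_le_iff₀ (by positivity)).2 ?_⟩
    rw [← critRadius_sq ξ hx hL.le] at hu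
    have : 2 / π * (π * x * critRadius k ξ x ^ 2) = critRadius k ξ x *
        (2 * x * critRadius k ξ x) := by
      field_simp
    linarith
  have hmul : ∀ x u : ℝ, 0 < x → 0 < critRadius k ξ x →
      2 * x * critRadius k ξ x * (u / (2 * x * critRadius k ξ x)) = u := fun x u hx hr => by
    field_simp
  have h := tendsto_lintegral_poissonTail ξ hk (H := H) (fun x => ?_) ?_ ?_ ?_
  · refine h.congr' ?_
    filter_upwards [eventually_critRadius_pos ξ k] with x ⟨hx, hL, hr⟩
    congr! 5 with u
    rw [hH]
    nth_rewrite 1 [← critRadius_sq ξ hx hL.le]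
    ring
  · rw [hH]
    exact (((capArea_mono (sqrt_nonneg _)).measurable.comp (measurable_id.div_const _)).sub_const
      _).const_mul _
  · filter_upwards [eventually_critRadius_pos ξ k, key] with x ⟨hx, hL, hr⟩ hkey u hu0 hu
    obtain ⟨h0, h1⟩ := hkey u hu0 hu
    have h2 := capArea_sub_le hr.le h0
    rw [capArea_zero hr.le] at h2
    calc H x u ≤ x * (2 * critRadius k ξ x * (u / (2 * x * critRadius k ξ x))) := by
          exact mul_le_mul_of_nonneg_left (by linarith) hx.le
      _ = u := by rw [← hmul x u hx hr]; field_simp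
  · filter_upwards [eventually_critRadius_pos ξ k, key] with x ⟨hx, hL, hr⟩ hkey u hu0 hu
    obtain ⟨h0, h1⟩ := hkey u hu0 hu
    have h2 := le_capArea hr.le h0 h1
    rw [capArea_zero hr.le] at h2
    calc u * (1 - u / (2 / π * critMean k ξ x)) =
          x * (2 * (u / (2 * x * critRadius k ξ x)) *
              (critRadius k ξ x - u / (2 * x * critRadius k ξ x))) := by
          rw [← critRadius_sq ξ hx hL.le]
          field_simp
      _ ≤ H x u := by
          exact mul_le_mul_of_nonneg_left (by linarith) hx.le
  · filter_upwards [eventually_critRadius_pos ξ k, key] with x ⟨hx, hL, hr⟩ hkey u hu0 hu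
    obtain ⟨h0, h1⟩ := hkey u hu0 hu
    have h2 := le_capArea' hr.le h0 h1
    rw [capArea_zero hr.le] at h2
    calc u / 4 = x * (critRadius k ξ x * (u / (2 * x * critRadius k ξ x)) / 2) := by
          field_simp
          norm_num
      _ ≤ H x u := by
          exact mul_le_mul_of_nonneg_left (by linarith) hx.le

variable {Ω : Set Plane}

lemma measurable_infDist_compl : Measurable fun y : Plane => infDist y Ωᶜ :=
  (continuous_infDist_pt _).measurable

lemma measurable_poissonTail_capArea (r : ℝ) (hr : 0 ≤ r) (x : ℝ) :
    Measurable fun t => poissonTail k (x * capArea r t) :=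
  (continuous_poissonTail k).measurable.comp ((capArea_mono hr).measurable.const_mul x)

/-- The contribution of the points close to the frontier, as an integral over distances. -/
lemma setLIntegral_infDist_lt {x r : ℝ} (hx : 0 < x) (hr : 0 < r) :
    ENNReal.ofReal x * ∫⁻ y in Ω ∩ {y | infDist y Ωᶜ < r},
        ENNReal.ofReal (poissonTail k (x * capArea r (infDist y Ωᶜ))) =
      ∫⁻ u in Set.Ico 0 (2 * x * r * r),
        ENNReal.ofReal (poissonTail k (x * capArea r (u / (2 * x * r))))
          ∂(ENNReal.ofReal x • (volume.restrict Ω).map fun y => 2 * x * r * infDist y Ωᶜ) := by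
  have hg : Measurable fun y : Plane => 2 * x * r * infDist y Ωᶜ :=
    measurable_infDist_compl.const_mul _
  have hpre : (fun y : Plane => 2 * x * r * infDist y Ωᶜ) ⁻¹' Set.Ico 0 (2 * x * r * r) ∩ Ω =
      Ω ∩ {y | infDist y Ωᶜ < r} := by
    ext y
    have h1 : 0 ≤ 2 * x * r * infDist y Ωᶜ := mul_nonneg (by positivity) infDist_nonneg
    have h2 : 2 * x * r * infDist y Ωᶜ < 2 * x * r * r ↔ infDist y Ωᶜ < r :=
      mul_lt_mul_iff_right₀ (by positivity)
    simp [h1, h2, and_comm]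
  have hf : Measurable fun u => ENNReal.ofReal (poissonTail k (x * capArea r (u / (2 * x * r)))) :=
    ((measurable_poissonTail_capArea r hr.le x).comp (measurable_id.div_const _)).ennreal_ofReal
  rw [Measure.restrict_smul, lintegral_smul_measure, smul_eq_mul,
    setLIntegral_map measurableSet_Ico hf hg,
    Measure.restrict_restrict (hg measurableSet_Ico), hpre]
  congr! 5 with y
  field_simp

lemma map_infDist_Icc {x r a : ℝ} (hx : 0 < x) (hr : 0 < r) :
    (ENNReal.ofReal x • (volume.restrict Ω).map fun y => 2 * x * r * infDist y Ωᶜ) (Set.Icc 0 a) =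
      ENNReal.ofReal x * volume {y ∈ Ω | infDist y Ωᶜ ≤ a / (2 * x * r)} := by
  have hg : Measurable fun y : Plane => 2 * x * r * infDist y Ωᶜ :=
    measurable_infDist_compl.const_mul _
  rw [Measure.smul_apply, Measure.map_apply hg measurableSet_Icc,
    Measure.restrict_apply (hg measurableSet_Icc), smul_eq_mul]
  congr 2
  ext y
  have h1 : 0 ≤ 2 * x * r * infDist y Ωᶜ := mul_nonneg (by positivity) infDist_nonneg
  have h2 : infDist y Ωᶜ ≤ a / (2 * x * r) ↔ 2 * x * r * infDist y Ωᶜ ≤ a := by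
    rw [le_div_iff₀ (by positivity), mul_comm]
  simp [h1, h2, and_comm]

lemma map_infDist_Ico {x r a : ℝ} (hx : 0 < x) (hr : 0 < r) :
    (ENNReal.ofReal x • (volume.restrict Ω).map fun y => 2 * x * r * infDist y Ωᶜ) (Set.Ico 0 a) =
      ENNReal.ofReal x * volume {y ∈ Ω | infDist y Ωᶜ < a / (2 * x * r)} := by
  have hg : Measurable fun y : Plane => 2 * x * r * infDist y Ωᶜ :=
    measurable_infDist_compl.const_mul _
  rw [Measure.smul_apply, Measure.map_apply hg measurableSet_Ico,
    Measure.restrict_apply (hg measurableSet_Ico), smul_eq_mul]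
  congr 2
  ext y
  have h1 : 0 ≤ 2 * x * r * infDist y Ωᶜ := mul_nonneg (by positivity) infDist_nonneg
  have h2 : infDist y Ωᶜ < a / (2 * x * r) ↔ 2 * x * r * infDist y Ωᶜ < a := by
    rw [lt_div_iff₀ (by positivity), mul_comm]
  simp [h1, h2, and_comm]

lemma mul_setLIntegral_eq (c : ℝ≥0∞) (f : ℝ → ℝ≥0∞) (s : Set ℝ) :
    c * ∫⁻ u in s, f u = ∫⁻ u in s, f u ∂(c • volume) := by
  rw [Measure.restrict_smul, lintegral_smul_measure, smul_eq_mul]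

lemma antitone_poissonTail_capArea {x r : ℝ} (hx : 0 < x) (hr : 0 < r) :
    Antitone fun u => poissonTail k (x * capArea r (u / (2 * x * r))) := fun u v huv => by
  refine antitoneOn_poissonTail k (Set.mem_Ici.2 (mul_nonneg hx.le (capArea_nonneg _ _)))
    (Set.mem_Ici.2 (mul_nonneg hx.le (capArea_nonneg _ _))) ?_
  gcongr
  exact capArea_mono hr.le (by gcongr)

lemma setLIntegral_infDist_lt_le (hconv : Convex ℝ Ω) (hcomp : IsCompact Ω)
    (hint : (interior Ω).Nonempty) {x r : ℝ} (hx : 0 < x) (hr : 0 < r) :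
    ENNReal.ofReal x * ∫⁻ y in Ω ∩ {y | infDist y Ωᶜ < r},
        ENNReal.ofReal (poissonTail k (x * capArea r (infDist y Ωᶜ))) ≤
      ENNReal.ofReal ((μH[1] (frontier Ω)).toReal + 4 * π * r) * (ENNReal.ofReal (2 * r)⁻¹ *
        ∫⁻ u in Set.Ico 0 (2 * x * r * r),
          ENNReal.ofReal (poissonTail k (x * capArea r (u / (2 * x * r))))) := by
  set P := (μH[1] (frontier Ω)).toReal
  have hP : 0 ≤ P := ENNReal.toReal_nonneg
  rw [setLIntegral_infDist_lt hx hr, ← mul_assoc,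
    mul_setLIntegral_eq (ENNReal.ofReal _ * ENNReal.ofReal _)]
  have hbound : ∀ a, 0 ≤ a → a ≤ 2 * x * r * r →
      ENNReal.ofReal x * volume {y ∈ Ω | infDist y Ωᶜ ≤ a / (2 * x * r)} ≤
      ENNReal.ofReal (P + 4 * π * r) * ENNReal.ofReal (2 * r)⁻¹ * ENNReal.ofReal a := by
    intro a ha haw
    have h1 : a / (2 * x * r) ≤ r := (div_le_iff₀ (by positivity)).2 (by linarith)
    refine (mul_le_mul_right (volume_infDist_le_le hconv hcomp hint (by positivity)) _).trans ?_
    rw [← ENNReal.ofReal_mul hx.le, ← ENNReal.ofReal_mul (by positivity),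
      ← ENNReal.ofReal_mul (by positivity)]
    refine ENNReal.ofReal_le_ofReal ?_
    calc x * ((P + 4 * π * (a / (2 * x * r))) * (a / (2 * x * r)))
        ≤ x * ((P + 4 * π * r) * (a / (2 * x * r))) := by gcongr
      _ = (P + 4 * π * r) * (2 * r)⁻¹ * a := by field_simp
  refine setLIntegral_le_of_antitoneOn
    ((measurable_poissonTail_capArea r hr.le x).comp (measurable_id.div_const _))
    ((antitone_poissonTail_capArea hx hr).antitoneOn _)
    (fun u _ => poissonTail_nonneg k (mul_nonneg hx.le (capArea_nonneg _ _)))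
    (fun a ha haw => ?_) (fun a ha haw => ?_)
  · rw [map_infDist_Icc hx hr, Measure.smul_apply, Real.volume_Icc, sub_zero, smul_eq_mul]
    exact hbound a ha haw.le
  · rw [map_infDist_Ico hx hr, Measure.smul_apply, Real.volume_Ico, sub_zero, smul_eq_mul]
    refine le_trans (mul_le_mul_right (measure_mono ?_) _) (hbound a ha haw)
    exact fun y hy => ⟨hy.1, hy.2.le⟩

lemma le_setLIntegral_infDist_lt (hconv : Convex ℝ Ω) (hcomp : IsCompact Ω)
    {x₀ : Plane} {ρ x r : ℝ} (hball : closedBall x₀ ρ ⊆ Ω) (hx : 0 < x) (hr : 0 < r) (hrρ : r ≤ ρ) :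
    ENNReal.ofReal ((μH[1] (frontier Ω)).toReal * (1 - r / ρ)) * (ENNReal.ofReal (2 * r)⁻¹ *
        ∫⁻ u in Set.Ico 0 (2 * x * r * r),
          ENNReal.ofReal (poissonTail k (x * capArea r (u / (2 * x * r))))) ≤
      ENNReal.ofReal x * ∫⁻ y in Ω ∩ {y | infDist y Ωᶜ < r},
        ENNReal.ofReal (poissonTail k (x * capArea r (infDist y Ωᶜ))) := by
  have hρ : 0 < ρ := hr.trans_le hrρ
  have hρ1 : 0 ≤ 1 - r / ρ := sub_nonneg.2 ((div_le_one hρ).2 hrρ)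
  set P := (μH[1] (frontier Ω)).toReal with hPd
  have hP : 0 ≤ P := ENNReal.toReal_nonneg
  rw [setLIntegral_infDist_lt hx hr, ← mul_assoc,
    mul_setLIntegral_eq (ENNReal.ofReal _ * ENNReal.ofReal _)]
  have hbound : ∀ a, 0 ≤ a → a ≤ 2 * x * r * r →
      ENNReal.ofReal (P * (1 - r / ρ)) * ENNReal.ofReal (2 * r)⁻¹ * ENNReal.ofReal a ≤
      ENNReal.ofReal x * volume {y ∈ Ω | infDist y Ωᶜ < a / (2 * x * r)} := by
    intro a ha haw
    rcases ha.eq_or_lt with rfl | ha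
    · simp
    have h1 : a / (2 * x * r) ≤ r := (div_le_iff₀ (by positivity)).2 (by linarith)
    refine le_trans ?_ (mul_le_mul_right
      (le_volume_infDist_lt hconv hcomp hball (by positivity) (h1.trans hrρ)) _)
    rw [← hPd, ← ENNReal.ofReal_mul hx.le, ← ENNReal.ofReal_mul (by positivity),
      ← ENNReal.ofReal_mul (by positivity)]
    refine ENNReal.ofReal_le_ofReal ?_
    calc P * (1 - r / ρ) * (2 * r)⁻¹ * a = x * (a / (2 * x * r) * (1 - r / ρ) * P) := by
          field_simp
      _ ≤ x * (a / (2 * x * r) * (1 - a / (2 * x * r) / ρ) * P) := by gcongr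
  refine setLIntegral_le_of_antitoneOn
    ((measurable_poissonTail_capArea r hr.le x).comp (measurable_id.div_const _))
    ((antitone_poissonTail_capArea hx hr).antitoneOn _)
    (fun u _ => poissonTail_nonneg k (mul_nonneg hx.le (capArea_nonneg _ _)))
    (fun a ha haw => ?_) (fun a ha haw => ?_)
  · rw [map_infDist_Icc hx hr, Measure.smul_apply, Real.volume_Icc, sub_zero, smul_eq_mul]
    refine (hbound a ha haw.le).trans (mul_le_mul_right (measure_mono ?_) _)
    exact fun y hy => ⟨hy.1, hy.2.le⟩
  · rw [map_infDist_Ico hx hr, Measure.smul_apply, Real.volume_Ico, sub_zero, smul_eq_mul]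
    exact hbound a ha haw

end CapMean

section CapMeanLimit

variable {k : ℕ} (ξ : ℝ) {Ω : Set Plane}

lemma tendsto_setLIntegral_infDist_lt (hk : 1 ≤ k) (hconv : Convex ℝ Ω) (hcomp : IsCompact Ω)
    (hint : (interior Ω).Nonempty) :
    Tendsto (fun x => ENNReal.ofReal x * ∫⁻ y in Ω ∩ {y | infDist y Ωᶜ < critRadius k ξ x},
        ENNReal.ofReal (poissonTail k (x * capArea (critRadius k ξ x) (infDist y Ωᶜ)))) atTop
      (𝓝 (ENNReal.ofReal ((μH[1] (frontier Ω)).toReal *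
        (√π * exp (-(ξ / 2)) / (2 ^ (k + 1) * k.factorial))))) := by
  obtain ⟨x₀, hx₀⟩ := hint
  obtain ⟨ρ, hρ, hball⟩ := nhds_basis_closedBall.mem_iff.1 (mem_interior_iff_mem_nhds.1 hx₀)
  have hint : (interior Ω).Nonempty := ⟨x₀, hx₀⟩
  have hP : 0 ≤ (μH[1] (frontier Ω)).toReal := ENNReal.toReal_nonneg
  have hB := tendsto_lintegral_poissonTail_capArea ξ hk
  have hr := tendsto_critRadius ξ k
  have hlow : Tendsto (fun x => ENNReal.ofReal ((μH[1] (frontier Ω)).toReal *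
      (1 - critRadius k ξ x / ρ))) atTop (𝓝 (ENNReal.ofReal (μH[1] (frontier Ω)).toReal)) := by
    refine ENNReal.tendsto_ofReal ?_
    have := ((hr.div_const ρ).const_sub 1).const_mul (μH[1] (frontier Ω)).toReal
    rwa [zero_div, sub_zero, mul_one] at this
  have hupp : Tendsto (fun x => ENNReal.ofReal ((μH[1] (frontier Ω)).toReal +
      4 * π * critRadius k ξ x)) atTop (𝓝 (ENNReal.ofReal (μH[1] (frontier Ω)).toReal)) := by
    refine ENNReal.tendsto_ofReal ?_
    have := (hr.const_mul (4 * π)).const_add (μH[1] (frontier Ω)).toReal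
    rwa [mul_zero, add_zero] at this
  have hl := ENNReal.Tendsto.mul hlow (.inr ENNReal.ofReal_ne_top) hB (.inr ENNReal.ofReal_ne_top)
  have hu := ENNReal.Tendsto.mul hupp (.inr ENNReal.ofReal_ne_top) hB (.inr ENNReal.ofReal_ne_top)
  rw [← ENNReal.ofReal_mul hP] at hl hu
  have hW : ∀ x, 0 < x → 0 < critMean k ξ x →
      2 / π * critMean k ξ x = 2 * x * critRadius k ξ x * critRadius k ξ x := fun x hx hL => by
    rw [← critRadius_sq ξ hx hL.le]
    field_simp
  refine tendsto_of_tendsto_of_tendsto_of_le_of_le' hl hu ?_ ?_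
  · filter_upwards [eventually_critRadius_pos ξ k, hr.eventually_le_const hρ] with x ⟨hx, hL, hr⟩
      hrρ
    rw [hW x hx hL]
    exact le_setLIntegral_infDist_lt hconv hcomp hball hx hr hrρ
  · filter_upwards [eventually_critRadius_pos ξ k] with x ⟨hx, hL, hr⟩
    rw [hW x hx hL]
    exact setLIntegral_infDist_lt_le hconv hcomp hint hx hr

lemma tendsto_setLIntegral_le_infDist (hk : 1 ≤ k) (hconv : Convex ℝ Ω) (hcomp : IsCompact Ω)
    (hint : (interior Ω).Nonempty) (hvol : volume Ω = 1) :
    Tendsto (fun x => ENNReal.ofReal x * ∫⁻ y in Ω \ {y | infDist y Ωᶜ < critRadius k ξ x},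
        ENNReal.ofReal (poissonTail k (x * capArea (critRadius k ξ x) (infDist y Ωᶜ)))) atTop
      (𝓝 (ENNReal.ofReal (if k = 1 then exp (-ξ) else 0))) := by
  have hr := tendsto_critRadius ξ k
  have hmain := ENNReal.tendsto_ofReal (tendsto_mul_poissonTail_critMean ξ hk)
  have hΩm : MeasurableSet Ω := hcomp.isClosed.measurableSet
  have hcol : Tendsto (fun x => 1 - ENNReal.ofReal (((μH[1] (frontier Ω)).toReal +
      4 * π * critRadius k ξ x) * critRadius k ξ x)) atTop (𝓝 1) := by
    have h := ((hr.const_mul (4 * π)).const_add (μH[1] (frontier Ω)).toReal).mul hr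
    rw [mul_zero] at h
    have h' := ENNReal.Tendsto.sub (tendsto_const_nhds (x := (1 : ℝ≥0∞)))
      (ENNReal.tendsto_ofReal h) (.inl ENNReal.one_ne_top)
    rwa [ENNReal.ofReal_zero, tsub_zero] at h'
  have hvols : Tendsto (fun x => volume (Ω \ {y | infDist y Ωᶜ < critRadius k ξ x})) atTop
      (𝓝 1) := by
    refine tendsto_of_tendsto_of_tendsto_of_le_of_le' hcol tendsto_const_nhds ?_ ?_
    · filter_upwards [eventually_critRadius_pos ξ k] with x ⟨hx, hL, hr⟩
      rw [tsub_le_iff_right, ← hvol,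
        ← measure_inter_add_sdiff Ω (measurableSet_lt measurable_infDist_compl
          (measurable_const (a := critRadius k ξ x))), add_comm]
      refine add_le_add le_rfl (le_trans (measure_mono ?_)
        (volume_infDist_le_le hconv hcomp hint hr.le))
      exact fun y hy => ⟨hy.1, (show infDist y Ωᶜ < critRadius k ξ x from hy.2).le⟩
    · exact .of_forall fun x => hvol ▸ measure_mono Set.sdiff_subset
  have h := ENNReal.Tendsto.mul hmain (.inr ENNReal.one_ne_top) hvols (.inr ENNReal.ofReal_ne_top)
  rw [mul_one] at h
  refine h.congr' ?_
  filter_upwards [eventually_critRadius_pos ξ k] with x ⟨hx, hL, hr⟩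
  have : ∫⁻ y in Ω \ {y | infDist y Ωᶜ < critRadius k ξ x},
      ENNReal.ofReal (poissonTail k (x * capArea (critRadius k ξ x) (infDist y Ωᶜ))) =
      ∫⁻ y in Ω \ {y | infDist y Ωᶜ < critRadius k ξ x},
        ENNReal.ofReal (poissonTail k (critMean k ξ x)) := by
    refine setLIntegral_congr_fun (hΩm.diff (measurableSet_lt measurable_infDist_compl
      measurable_const)) fun y hy => ?_
    have hy : critRadius k ξ x ≤ infDist y Ωᶜ := not_lt.1 hy.2
    rw [capArea_self hr.le hy, ← critRadius_sq ξ hx hL.le]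
    ring_nf
  rw [this, setLIntegral_const, ENNReal.ofReal_mul hx.le, mul_assoc]

lemma tendsto_lintegral_poissonTail_capArea_infDist (hk : 1 ≤ k) (hconv : Convex ℝ Ω)
    (hcomp : IsCompact Ω) (hint : (interior Ω).Nonempty) (hvol : volume Ω = 1) :
    Tendsto (fun x => ENNReal.ofReal x * ∫⁻ y in Ω,
        ENNReal.ofReal (poissonTail k (x * capArea (critRadius k ξ x) (infDist y Ωᶜ)))) atTop
      (𝓝 (ENNReal.ofReal ((μH[1] (frontier Ω)).toReal *
        (√π * exp (-(ξ / 2)) / (2 ^ (k + 1) * k.factorial)) +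
          if k = 1 then exp (-ξ) else 0))) := by
  rw [ENNReal.ofReal_add (by positivity) (by positivity)]
  refine ((tendsto_setLIntegral_infDist_lt ξ hk hconv hcomp hint).add
    (tendsto_setLIntegral_le_infDist ξ hk hconv hcomp hint hvol)).congr fun x => ?_
  rw [← mul_add, lintegral_inter_add_sdiff _ _ (measurableSet_lt measurable_infDist_compl
    measurable_const)]

end CapMeanLimit

section VolumeMean

variable {k : ℕ} {Ω : Set Plane}

lemma lintegral_poissonTail_volume_le (hconv : Convex ℝ Ω) (hcomp : IsCompact Ω) {x₀ : Plane}
    {ρ D : ℝ} (hρ : 0 < ρ) (hball : closedBall x₀ ρ ⊆ Ω) (hD : Ω ⊆ closedBall x₀ D) (hρD : ρ ≤ D)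
    {x r : ℝ} (hx : 0 < x) (hr : 0 < r) (hrD : r ≤ D) {N : ℕ} {δ : ℝ} {b : ℕ → Plane}
    (h : IsFan Ω N δ b) (hδ : 0 ≤ δ) (hδ8 : 8 * δ ≤ π) :
    ∫⁻ y in Ω, ENNReal.ofReal (poissonTail k (x * (volume.restrict Ω).real (closedBall y r))) ≤
      ENNReal.ofReal (exp (4 * δ * (x * r ^ 2))) *
        (∫⁻ y in Ω, ENNReal.ofReal (poissonTail k (x * capArea r (infDist y Ωᶜ)))) +
      ENNReal.ofReal (poissonTail k (x * (π * ρ ^ 2 / (4 * D ^ 2) * r ^ 2))) *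
        ((N + 1) * ENNReal.ofReal (π * ((4 + 6 * D / ρ) * r) ^ 2)) := by
  have hD0 : 0 < D := hρ.trans_le hρD
  set K := (4 + 6 * D / ρ) * r with hK
  have hK0 : 0 ≤ K := by positivity
  have hΩm : MeasurableSet Ω := hcomp.isClosed.measurableSet
  set B : Set Plane := ⋃ i ∈ Finset.range (N + 1), closedBall (b i) K with hB
  have hBm : MeasurableSet B := Finset.measurableSet_biUnion _ fun i _ => measurableSet_closedBall
  have hBv : volume B ≤ (N + 1) * ENNReal.ofReal (π * K ^ 2) := by
    refine (measure_biUnion_finset_le _ _).trans ?_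
    have : ∀ y : Plane, volume (closedBall y K) = ENNReal.ofReal (π * K ^ 2) := fun y => by
      rw [← volume_real_closedBall y hK0, ofReal_measureReal measure_closedBall_lt_top.ne]
    simp [this]
  have hpt : ∀ y ∈ Ω, ENNReal.ofReal (poissonTail k
      (x * (volume.restrict Ω).real (closedBall y r))) ≤
      ENNReal.ofReal (exp (4 * δ * (x * r ^ 2))) *
        ENNReal.ofReal (poissonTail k (x * capArea r (infDist y Ωᶜ))) +
      B.indicator (fun _ => ENNReal.ofReal (poissonTail k (x * (π * ρ ^ 2 / (4 * D ^ 2) * r ^ 2))))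
          y := by
    intro y hy
    rw [measureReal_restrict_apply measurableSet_closedBall]
    have hcap : π * r ^ 2 / 2 ≤ capArea r (infDist y Ωᶜ) :=
      capArea_zero hr.le ▸ capArea_mono hr.le infDist_nonneg
    by_cases hyB : y ∈ B
    · rw [Set.indicator_of_mem hyB]
      refine le_trans (ENNReal.ofReal_le_ofReal ?_) le_add_self
      refine antitoneOn_poissonTail k (Set.mem_Ici.2 (by positivity))
        (Set.mem_Ici.2 (by positivity)) ?_
      gcongr
      exact le_volume_real_closedBall_inter hconv hρ hball hD hρD hy hr hrD
    · rw [Set.indicator_of_notMem hyB, add_zero, ← ENNReal.ofReal_mul (exp_pos _).le]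
      refine ENNReal.ofReal_le_ofReal ?_
      have hsub : 4 * δ * (x * r ^ 2) ≤ x * capArea r (infDist y Ωᶜ) := by
        calc 4 * δ * (x * r ^ 2) ≤ x * (π * r ^ 2 / 2) := by
              have := mul_le_mul_of_nonneg_right hδ8 (by positivity : 0 ≤ x * r ^ 2)
              linarith
          _ ≤ _ := by gcongr
      refine le_trans ?_ (poissonTail_sub_le k (by positivity) hsub)
      refine antitoneOn_poissonTail k (Set.mem_Ici.2 (sub_nonneg.2 hsub))
        (Set.mem_Ici.2 (by positivity)) ?_
      have hle : capArea r (infDist y Ωᶜ) - 4 * δ * r ^ 2 ≤ volume.real (closedBall y r ∩ Ω) := by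
        rcases le_total r (infDist y Ωᶜ) with hd | hd
        · rw [volume_real_closedBall_inter_eq hcomp.isClosed hy hr.le hd, capArea_self hr.le hd]
          linarith [(by positivity : 0 ≤ 4 * δ * r ^ 2)]
        · have hfar : ∀ i ≤ N, (4 + 6 * D / ρ) * r ≤ dist y (b i) := by
            intro i hi
            by_contra! hlt
            exact hyB (Set.mem_biUnion (Finset.mem_range.2 (Nat.lt_succ_of_le hi)) hlt.le)
          have h1 := h.capArea_le hconv hcomp hρ hD0 hball hD hr hy hd hfar
          have h2 := capArea_sub_le hr.le
            (by linarith [(by positivity : 0 ≤ 2 * δ * r)] :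
              infDist y Ωᶜ - 2 * δ * r ≤ infDist y Ωᶜ)
          linarith
      calc x * capArea r (infDist y Ωᶜ) - 4 * δ * (x * r ^ 2)
          = x * (capArea r (infDist y Ωᶜ) - 4 * δ * r ^ 2) := by ring
        _ ≤ _ := by gcongr
  have hm : Measurable fun y : Plane =>
      ENNReal.ofReal (poissonTail k (x * capArea r (infDist y Ωᶜ))) :=
    ((measurable_poissonTail_capArea r hr.le x).comp measurable_infDist_compl).ennreal_ofReal
  refine (setLIntegral_mono' hΩm hpt).trans ?_
  rw [lintegral_add_left (hm.const_mul _), lintegral_const_mul _ hm, lintegral_indicator hBm,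
    setLIntegral_const]
  gcongr
  exact (Measure.restrict_apply_le _ _).trans hBv

lemma tendsto_pow_mul_poissonTail (k m : ℕ) {κ : ℝ} (hκ : 0 < κ) :
    Tendsto (fun a => a ^ m * poissonTail k (κ * a)) atTop (𝓝 0) := by
  have hterm : ∀ i ∈ Finset.range (k + 1), Tendsto (fun a =>
      κ ^ i / i.factorial * (a ^ (m + i) * exp (-κ * a))) atTop (𝓝 0) := fun i _ => by
    have := (tendsto_rpow_mul_exp_neg_mul_atTop_nhds_zero (m + i : ℕ) κ hκ).const_mul
      (κ ^ i / i.factorial)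
    simp_rw [rpow_natCast] at this
    rwa [mul_zero] at this
  have h := tendsto_finsetSum _ hterm
  rw [Finset.sum_const_zero] at h
  refine h.congr fun a => ?_
  rw [poissonTail, Finset.mul_sum, Finset.mul_sum]
  refine Finset.sum_congr rfl fun i _ => ?_
  rw [mul_pow, pow_add, neg_mul]
  ring

lemma le_lintegral_poissonTail_volume (hconv : Convex ℝ Ω) (hcomp : IsCompact Ω)
    (hint : (interior Ω).Nonempty) {x r : ℝ} (hx : 0 < x) (hr : 0 < r) :
    ∫⁻ y in Ω, ENNReal.ofReal (poissonTail k (x * capArea r (infDist y Ωᶜ))) ≤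
      ∫⁻ y in Ω, ENNReal.ofReal
        (poissonTail k (x * (volume.restrict Ω).real (closedBall y r))) := by
  refine setLIntegral_mono' hcomp.isClosed.measurableSet fun y hy => ENNReal.ofReal_le_ofReal ?_
  refine antitoneOn_poissonTail k (Set.mem_Ici.2 (by positivity))
    (Set.mem_Ici.2 (mul_nonneg hx.le (capArea_nonneg _ _))) ?_
  rw [measureReal_restrict_apply measurableSet_closedBall]
  gcongr
  exact volume_real_closedBall_inter_le hconv hcomp hint hy hr.le

variable (ξ : ℝ)

lemma tendsto_lintegral_poissonTail_volume (hk : 1 ≤ k) (hconv : Convex ℝ Ω)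
    (hcomp : IsCompact Ω) (hint : (interior Ω).Nonempty) (hvol : volume Ω = 1) :
    Tendsto (fun x => ENNReal.ofReal x * ∫⁻ y in Ω, ENNReal.ofReal
        (poissonTail k (x * (volume.restrict Ω).real (closedBall y (critRadius k ξ x))))) atTop
      (𝓝 (ENNReal.ofReal ((μH[1] (frontier Ω)).toReal *
        (√π * exp (-(ξ / 2)) / (2 ^ (k + 1) * k.factorial)) +
          if k = 1 then exp (-ξ) else 0))) := by
  have hcap := tendsto_lintegral_poissonTail_capArea_infDist ξ hk hconv hcomp hint hvol
  obtain ⟨x₀, hx₀⟩ := hint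
  obtain ⟨ρ, hρ, hball⟩ := nhds_basis_closedBall.mem_iff.1 (mem_interior_iff_mem_nhds.1 hx₀)
  have hint : (interior Ω).Nonempty := ⟨x₀, hx₀⟩
  obtain ⟨D, hρD, hD⟩ := hcomp.isBounded.subset_closedBall_lt ρ x₀
  have hD0 : 0 < D := hρ.trans hρD
  set C := (4 + 6 * D / ρ) ^ 2 with hC
  set κ := ρ ^ 2 / (4 * D ^ 2) with hκ
  have hκ0 : 0 < κ := by positivity
  have hL := tendsto_critMean k ξ
  have hexp : Tendsto (fun x => ENNReal.ofReal (exp (8 / critMean k ξ x))) atTop (𝓝 1) := by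
    have := ENNReal.tendsto_ofReal ((continuous_exp.tendsto _).comp (hL.const_div_atTop 8))
    rwa [exp_zero, ENNReal.ofReal_one] at this
  have hbad : Tendsto (fun x => ENNReal.ofReal
      (C * (critMean k ξ x ^ 3 * poissonTail k (κ * critMean k ξ x) +
      10 * (critMean k ξ x ^ 1 * poissonTail k (κ * critMean k ξ x))))) atTop (𝓝 0) := by
    have h1 := ((tendsto_pow_mul_poissonTail k 3 hκ0).comp hL).add
      (((tendsto_pow_mul_poissonTail k 1 hκ0).comp hL).const_mul 10)
    have := ENNReal.tendsto_ofReal (h1.const_mul C)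
    simpa using this
  have hupp := (ENNReal.Tendsto.mul hexp (.inl one_ne_zero) hcap (.inr ENNReal.one_ne_top)).add hbad
  rw [one_mul, add_zero] at hupp
  refine tendsto_of_tendsto_of_tendsto_of_le_of_le' hcap hupp ?_ ?_
  · filter_upwards [eventually_critRadius_pos ξ k] with x ⟨hx, hL, hr⟩
    refine mul_le_mul_right ?_ _
    exact le_lintegral_poissonTail_volume hconv hcomp hint hx hr
  · filter_upwards [eventually_critRadius_pos ξ k, hL.eventually_ge_atTop 4,
      (tendsto_critRadius ξ k).eventually_le_const hD0] with x ⟨hx, hL, hr⟩ hL4 hrD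
    set L := critMean k ξ x with hLd
    set r := critRadius k ξ x with hrd
    have hLr : π * x * r ^ 2 = L := critRadius_sq ξ hx hL.le
    obtain ⟨b, hb⟩ := exists_isFan hcomp (hint.mono interior_subset)
      (le_add_self : 8 ≤ ⌈L ^ 2⌉₊ + 8)
    set N := ⌈L ^ 2⌉₊ + 8 with hN
    have hNL : L ^ 2 ≤ N := (Nat.le_ceil _).trans (by rw [hN]; push_cast; linarith)
    have hNL' : (N : ℝ) + 1 ≤ L ^ 2 + 10 := by
      have := Nat.ceil_lt_add_one (sq_nonneg L)
      rw [hN]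
      push_cast
      linarith
    have hL2 : 4 * L ≤ L ^ 2 := by nlinarith
    have hN16 : (16 : ℝ) ≤ N := by linarith
    have hN0 : (0 : ℝ) < N := by linarith
    have h1 := lintegral_poissonTail_volume_le (k := k) hconv hcomp hρ hball hD hρD.le hx hr hrD hb
      (by positivity) (by rw [mul_div_assoc', div_le_iff₀ hN0]; nlinarith [pi_pos])
    refine (mul_le_mul_right h1 _).trans ?_
    rw [mul_add, mul_left_comm]
    have hκL : x * (π * ρ ^ 2 / (4 * D ^ 2) * r ^ 2) = κ * L := by
      rw [← hLr, hκ]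
      ring
    rw [hκL]
    have hT : 0 ≤ poissonTail k (κ * L) := poissonTail_nonneg k (by positivity)
    gcongr ?_ * _ + ?_
    · refine ENNReal.ofReal_le_ofReal (exp_le_exp.2 ?_)
      calc 4 * (2 * π / N) * (x * r ^ 2) = 8 * L / N := by rw [← hLr]; ring
        _ ≤ 8 * L / L ^ 2 := by gcongr
        _ = 8 / L := by field_simp
    · have : ((N : ℝ≥0∞) + 1) = ENNReal.ofReal (N + 1) := by
        rw [ENNReal.ofReal_add hN0.le zero_le_one]
        simp
      rw [this, ← ENNReal.ofReal_mul (by positivity), ← ENNReal.ofReal_mul hT,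
        ← ENNReal.ofReal_mul hx.le]
      refine ENNReal.ofReal_le_ofReal ?_
      calc x * (poissonTail k (κ * L) * ((N + 1) * (π * ((4 + 6 * D / ρ) * r) ^ 2)))
          = C * (L * poissonTail k (κ * L)) * (N + 1) := by rw [hC, ← hLr]; ring
        _ ≤ C * (L * poissonTail k (κ * L)) * (L ^ 2 + 10) := by gcongr
        _ = _ := by ring

end VolumeMean

section HitsMean

variable {k : ℕ} {Ω : Set Plane}

lemma restrict_real_closedBall_le (Ω : Set Plane) (y : Plane) {r : ℝ} (hr : 0 ≤ r) :
    (volume.restrict Ω).real (closedBall y r) ≤ π * r ^ 2 := by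
  rw [← volume_real_closedBall y hr, measureReal_restrict_apply measurableSet_closedBall]
  exact measureReal_mono Set.inter_subset_left measure_closedBall_lt_top.ne

lemma lintegral_iidLaw_hits_le [IsProbabilityMeasure (volume.restrict Ω)] {x r : ℝ} (hr : 0 ≤ r)
    {m : ℕ} (hx : x = m + 1) :
    ∫⁻ y in Ω, iidLaw (volume.restrict Ω) m {X | hits (closedBall y r) X ≤ k} ≤
      ENNReal.ofReal (exp ((k + 1) * (π * r ^ 2))) * ∫⁻ y in Ω, ENNReal.ofReal
        (poissonTail k (x * (volume.restrict Ω).real (closedBall y r))) := by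
  rw [← lintegral_const_mul' _ _ ENNReal.ofReal_ne_top]
  refine lintegral_mono fun y => ?_
  rw [← ENNReal.ofReal_mul (exp_pos _).le, ← ofReal_measureReal]
  refine ENNReal.ofReal_le_ofReal
    ((iidLaw_real_hits_le_poissonTail _ measurableSet_closedBall m k).trans ?_)
  rw [hx]
  have := poissonTail_nonneg k
    (by positivity : 0 ≤ (m + 1 : ℝ) * (volume.restrict Ω).real (closedBall y r))
  gcongr
  exact restrict_real_closedBall_le Ω y hr

lemma le_lintegral_iidLaw_hits [IsProbabilityMeasure (volume.restrict Ω)] {x r : ℝ} (hr : 0 ≤ r)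
    {m : ℕ} (hkm : k ≤ m) (hx : x = m + 1) (hr2 : π * r ^ 2 ≤ 1 / 2) :
    ENNReal.ofReal ((1 - k / x) ^ k * exp (-(2 * (x * (π * r ^ 2) ^ 2)))) *
      ∫⁻ y in Ω, ENNReal.ofReal
        (poissonTail k (x * (volume.restrict Ω).real (closedBall y r))) ≤
      ∫⁻ y in Ω, iidLaw (volume.restrict Ω) m {X | hits (closedBall y r) X ≤ k} := by
  rw [← lintegral_const_mul' _ _ ENNReal.ofReal_ne_top]
  refine lintegral_mono fun y => ?_
  have hkx : 0 ≤ 1 - k / x := by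
    have : (k : ℝ) ≤ m := by exact_mod_cast hkm
    rw [sub_nonneg, hx]
    exact div_le_one_of_le₀ (by linarith) (by positivity)
  rw [← ENNReal.ofReal_mul (by positivity), ← ofReal_measureReal]
  have hU := restrict_real_closedBall_le Ω y hr
  refine ENNReal.ofReal_le_ofReal (le_trans ?_
    (poissonTail_le_iidLaw_real_hits_le _ measurableSet_closedBall hkm (hU.trans hr2)))
  rw [hx] at hkx ⊢
  have := poissonTail_nonneg k
    (by positivity : 0 ≤ (m + 1 : ℝ) * (volume.restrict Ω).real (closedBall y r))
  gcongr
  linarith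

variable (ξ : ℝ)

lemma tendsto_pi_mul_critRadius_sq (k : ℕ) :
    Tendsto (fun x => π * critRadius k ξ x ^ 2) atTop (𝓝 0) := by
  simpa using ((tendsto_critRadius ξ k).pow 2).const_mul π

lemma tendsto_mul_critRadius_sq_sq (k : ℕ) :
    Tendsto (fun x => x * (π * critRadius k ξ x ^ 2) ^ 2) atTop (𝓝 0) := by
  refine (tendsto_critMean_pow_div ξ k 2).congr' ?_
  filter_upwards [eventually_critRadius_pos ξ k] with x ⟨hx, hL, hr⟩
  rw [← critRadius_sq ξ hx hL.le]
  field_simp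

lemma natCast_add_three_eq_ofReal (M : ℕ) : (M + 3 : ℝ≥0∞) = ENNReal.ofReal (M + 3) := by
  rw [ENNReal.ofReal_add (by positivity) (by norm_num)]
  simp

lemma tendsto_natCast_add_three : Tendsto (fun M : ℕ => (M : ℝ) + 3) atTop atTop :=
  tendsto_atTop_add_const_right _ _ tendsto_natCast_atTop_atTop

lemma tendsto_lintegral_iidLaw_hits (hk : 1 ≤ k) (hconv : Convex ℝ Ω) (hcomp : IsCompact Ω)
    (hint : (interior Ω).Nonempty) (hvol : volume Ω = 1) :
    Tendsto (fun M : ℕ => (M + 3) * ∫⁻ y in Ω, iidLaw (volume.restrict Ω) (M + 2)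
        {X | hits (closedBall y (critRadius k ξ (M + 3))) X ≤ k}) atTop
      (𝓝 (ENNReal.ofReal ((μH[1] (frontier Ω)).toReal *
        (√π * exp (-(ξ / 2)) / (2 ^ (k + 1) * k.factorial)) +
          if k = 1 then exp (-ξ) else 0))) := by
  have hprob : IsProbabilityMeasure (volume.restrict Ω) := ⟨by simp [hvol]⟩
  have hx := tendsto_natCast_add_three
  have hmain := (tendsto_lintegral_poissonTail_volume ξ hk hconv hcomp hint hvol).comp hx
  have hr2 := tendsto_pi_mul_critRadius_sq ξ k
  have hupp : Tendsto (fun x => ENNReal.ofReal (exp ((k + 1) * (π * critRadius k ξ x ^ 2)))) atTop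
      (𝓝 1) := by
    have := ENNReal.tendsto_ofReal ((continuous_exp.tendsto _).comp (hr2.const_mul (k + 1 : ℝ)))
    simpa using this
  have hsq := tendsto_mul_critRadius_sq_sq ξ k
  have hlow : Tendsto (fun x => ENNReal.ofReal ((1 - k / x) ^ k *
      exp (-(2 * (x * (π * critRadius k ξ x ^ 2) ^ 2))))) atTop (𝓝 1) := by
    have h1 := ((tendsto_id.const_div_atTop (k : ℝ)).const_sub 1).pow k
    have h2 := (continuous_exp.tendsto _).comp (hsq.const_mul 2).neg
    have := ENNReal.tendsto_ofReal (h1.mul h2)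
    simpa using this
  have hl := ENNReal.Tendsto.mul (hlow.comp hx) (.inl one_ne_zero) hmain (.inr ENNReal.one_ne_top)
  have hu := ENNReal.Tendsto.mul (hupp.comp hx) (.inl one_ne_zero) hmain (.inr ENNReal.one_ne_top)
  rw [one_mul] at hl hu
  have hcast' : ∀ M : ℕ, (M + 3 : ℝ) = (M + 2 : ℕ) + 1 := fun M => by
    push_cast
    ring
  refine tendsto_of_tendsto_of_tendsto_of_le_of_le' hl hu ?_ ?_
  · filter_upwards [hx.eventually (hr2.eventually_le_const (by norm_num : (0 : ℝ) < 1 / 2)),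
      eventually_ge_atTop k] with M hM hkM
    have h := le_lintegral_iidLaw_hits (Ω := Ω) (k := k) (sqrt_nonneg _) (by omega : k ≤ M + 2)
        (hcast' M) hM
    simp only [Function.comp_apply]
    rw [mul_left_comm, natCast_add_three_eq_ofReal]
    exact mul_le_mul_right h _
  · refine .of_forall fun M => ?_
    have h := lintegral_iidLaw_hits_le (Ω := Ω) (k := k) (r := critRadius k ξ (M + 3))
      (sqrt_nonneg _) (hcast' M)
    simp only [Function.comp_apply]
    rw [mul_left_comm, natCast_add_three_eq_ofReal]
    exact mul_le_mul_right h _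

end HitsMean

section Pairs

lemma hits_mono {F : Type*} {U V : Set F} (h : U ⊆ V) {m : ℕ} (X : Fin m → F) :
    hits U X ≤ hits V X :=
  Finset.sum_le_sum fun _ _ => Set.indicator_le_indicator_of_subset h (fun _ => Nat.zero_le _) _

/-- The Chernoff bound for two disjoint sets, one of which is a ball. -/
lemma iidLaw_closedBall_disjoint_le {F : Type*} [PseudoMetricSpace F] [MeasurableSpace F]
    [OpensMeasurableSpace F] (μ : Measure F) [IsProbabilityMeasure μ] {x : F} {r s v : ℝ}
      {U : Set F}
    (hU : MeasurableSet U) (hdisj : Disjoint (closedBall x r) U) (hs : 0 < s) (hs1 : s ≤ 1)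
    (hv : v ≤ μ.real U) (k M : ℕ) :
    iidLaw μ (M + 1) {X | hits (closedBall x r) X ≤ k ∧ hits U X ≤ k} ≤
      lowBound μ r s k M x * ENNReal.ofReal (2 ^ k * exp (-(M / 2 * v))) := by
  refine (iidLaw_hits_le_hits_le μ measurableSet_closedBall hU ?_ hs (t := 1 / 2) (by norm_num)
    hs1 (by norm_num) (M + 1) k).trans ?_
  · rw [hdisj.inter_eq]
    simpa using by positivity
  have hs1' : 0 ≤ 1 - s := by linarith
  rw [lowBound, ← ENNReal.ofReal_mul (by positivity)]
  refine ENNReal.ofReal_le_ofReal ?_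
  have h2 : ((1 / 2 : ℝ) ^ k)⁻¹ = 2 ^ k := by simp
  rw [h2]
  have e1 : M * (1 - s) * μ.real (closedBall x r) ≤
      (M + 1 : ℕ) * (1 - s) * μ.real (closedBall x r) := by
    gcongr
    omega
  have e2 : (M : ℝ) / 2 * v ≤ (M + 1 : ℕ) * (1 - 1 / 2) * μ.real U := by
    push_cast
    calc (M : ℝ) / 2 * v ≤ M / 2 * μ.real U := by gcongr
      _ ≤ (M + 1) * (1 - 1 / 2) * μ.real U := by
        have : 0 ≤ μ.real U := measureReal_nonneg
        nlinarith
  gcongr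

variable {k : ℕ} {Ω : Set Plane}

lemma iidLaw_pair_le [IsProbabilityMeasure (volume.restrict Ω)] (hconv : Convex ℝ Ω)
    {x₀ : Plane} {ρ D r s : ℝ} (hρ : 0 < ρ)
    (hρD : ρ ≤ D) (hball : closedBall x₀ ρ ⊆ Ω) (hD : Ω ⊆ closedBall x₀ D) (hr : 0 < r)
    (hrρ : r ≤ ρ / 8) (hs : 0 < s) (hs1 : s ≤ 1) (M : ℕ) {x y : Plane} (hx : x ∈ Ω) (hy : y ∈ Ω)
    (hxy : dist y x ≤ 2 * r) :
    iidLaw (volume.restrict Ω) (M + 1)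
        {X | hits (closedBall x r) X ≤ k ∧ hits (closedBall y r) X ≤ k} ≤
      (lowBound (volume.restrict Ω) r s k M x + lowBound (volume.restrict Ω) r s k M y) *
        ENNReal.ofReal (2 ^ k *
          exp (-(M / 2 * (π * ρ ^ 3 / (2048 * D ^ 3) * (r * dist y x))))) := by
  have hm : ∀ u w : Plane, MeasurableSet (closedBall u r \ closedBall w r) := fun u w =>
    measurableSet_closedBall.diff measurableSet_closedBall
  rw [add_mul]
  rcases le_volume_sdiff_or hconv hρ hρD hball hD hr hrρ hx hy hxy with h | h
  · rw [← measureReal_restrict_apply (hm y x)] at h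
    refine le_trans (measure_mono ?_) ((iidLaw_closedBall_disjoint_le (volume.restrict Ω)
      (hm y x) Set.disjoint_sdiff_right hs hs1 h k M).trans le_self_add)
    exact fun X hX => ⟨hX.1, (hits_mono Set.sdiff_subset X).trans hX.2⟩
  · rw [← measureReal_restrict_apply (hm x y)] at h
    refine le_trans (measure_mono ?_) ((iidLaw_closedBall_disjoint_le (volume.restrict Ω)
      (hm x y) Set.disjoint_sdiff_right hs hs1 h k M).trans le_add_self)
    exact fun X hX => ⟨hX.2, (hits_mono Set.sdiff_subset X).trans hX.1⟩

lemma lintegral_exp_neg_norm_ne_top : ∫⁻ w : Plane, ENNReal.ofReal (exp (-‖w‖)) ≠ ∞ := by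
  have h := finite_integral_one_add_norm (E := Plane) (μ := volume) (r := 3) (by simp; norm_num)
  have hle : ∀ w : Plane, ENNReal.ofReal (exp (-‖w‖)) ≤
      ENNReal.ofReal (6 * exp 1) * ENNReal.ofReal ((1 + ‖w‖) ^ (-3 : ℝ)) := fun w => by
    rw [← ENNReal.ofReal_mul (by positivity)]
    refine ENNReal.ofReal_le_ofReal ?_
    have h1 : 0 < 1 + ‖w‖ := by positivity
    have h2 := pow_div_factorial_le_exp (1 + ‖w‖) h1.le 3
    have h3 : (3 : ℝ) = (3 : ℕ) := by norm_num
    rw [rpow_neg h1.le, h3, rpow_natCast, exp_neg, ← div_eq_mul_inv, le_div_iff₀ (by positivity),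
      inv_mul_le_iff₀ (exp_pos _)]
    rw [div_le_iff₀ (by positivity), exp_add] at h2
    norm_num [Nat.factorial] at h2
    linarith
  refine ((lintegral_mono hle).trans_lt ?_).ne
  rw [lintegral_const_mul' _ _ ENNReal.ofReal_ne_top]
  exact ENNReal.mul_lt_top ENNReal.ofReal_lt_top h

lemma lintegral_exp_neg_mul_dist {a : ℝ} (ha : 0 < a) (x : Plane) :
    ∫⁻ y, ENNReal.ofReal (exp (-(a * dist y x))) =
      ENNReal.ofReal (a ^ 2)⁻¹ * ∫⁻ w : Plane, ENNReal.ofReal (exp (-‖w‖)) := by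
  simp_rw [dist_eq_norm]
  rw [lintegral_sub_right_eq_self (fun w : Plane => ENNReal.ofReal (exp (-(a * ‖w‖)))) x]
  have h1 : ∀ w : Plane, a * ‖w‖ = ‖a • w‖ := fun w => by rw [norm_smul, norm_of_nonneg ha.le]
  have hm : Measurable fun w : Plane => ENNReal.ofReal (exp (-‖w‖)) := by fun_prop
  simp_rw [h1]
  rw [← lintegral_map hm (measurable_const_smul a), Measure.map_addHaar_smul _ ha.ne',
    lintegral_smul_measure, smul_eq_mul]
  simp

lemma lintegral_pair_le [IsProbabilityMeasure (volume.restrict Ω)] (hconv : Convex ℝ Ω)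
    (hcl : IsClosed Ω) {x₀ : Plane} {ρ D r s : ℝ} (hρ : 0 < ρ)
    (hρD : ρ ≤ D) (hball : closedBall x₀ ρ ⊆ Ω) (hD : Ω ⊆ closedBall x₀ D) (hr : 0 < r)
    (hrρ : r ≤ ρ / 8) (hs : 0 < s) (hs1 : s ≤ 1) {M : ℕ} (hM : 0 < M) :
    ∫⁻ x in Ω, ∫⁻ y in closedBall x (2 * r), iidLaw (volume.restrict Ω) (M + 1)
        {X | hits (closedBall x r) X ≤ k ∧ hits (closedBall y r) X ≤ k} ∂(volume.restrict Ω) ≤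
      2 * (∫⁻ x in Ω, lowBound (volume.restrict Ω) r s k M x) * (ENNReal.ofReal (2 ^ k) *
        (ENNReal.ofReal ((M / 2 * (π * ρ ^ 3 / (2048 * D ^ 3)) * r) ^ 2)⁻¹ *
          ∫⁻ w : Plane, ENNReal.ofReal (exp (-‖w‖)))) := by
  have hD0 : 0 < D := hρ.trans_le hρD
  set μ := volume.restrict Ω with hμ
  set a := M / 2 * (π * ρ ^ 3 / (2048 * D ^ 3)) * r with ha
  have ha0 : 0 < a := by positivity
  set q := lowBound μ r s k M with hq
  have hqm : Measurable q := measurable_lowBound μ r s k M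
  set g : Plane → Plane → ℝ≥0∞ := fun x y => ENNReal.ofReal (2 ^ k * exp (-(a * dist y x))) with hg
  have hgm : Measurable (Function.uncurry g) := by
    simp only [hg]
    fun_prop
  have hgi : ∀ x, ∫⁻ y, g x y ∂μ ≤ ENNReal.ofReal (2 ^ k) * (ENNReal.ofReal (a ^ 2)⁻¹ *
      ∫⁻ w : Plane, ENNReal.ofReal (exp (-‖w‖))) := fun x => by
    rw [← lintegral_exp_neg_mul_dist ha0 x, ← lintegral_const_mul' _ _ ENNReal.ofReal_ne_top]
    refine (setLIntegral_le_lintegral _ _).trans (lintegral_mono fun y => ?_)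
    rw [← ENNReal.ofReal_mul (by positivity)]
  set G := ENNReal.ofReal (2 ^ k) * (ENNReal.ofReal (a ^ 2)⁻¹ *
      ∫⁻ w : Plane, ENNReal.ofReal (exp (-‖w‖))) with hG
  have hstep : ∀ x ∈ Ω, ∫⁻ y in closedBall x (2 * r), iidLaw μ (M + 1)
        {X | hits (closedBall x r) X ≤ k ∧ hits (closedBall y r) X ≤ k} ∂μ ≤
      ∫⁻ y, (q x * g x y + q y * g x y) ∂μ := fun x hx => by
    rw [hμ, Measure.restrict_restrict measurableSet_closedBall]
    refine (setLIntegral_mono' (measurableSet_closedBall.inter hcl.measurableSet)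
      fun y hy => ?_).trans (lintegral_mono_set Set.inter_subset_right)
    rw [← add_mul]
    refine (iidLaw_pair_le hconv hρ hρD hball hD hr hrρ hs hs1 M hx hy.2
      (mem_closedBall.1 hy.1)).trans_eq ?_
    rw [show M / 2 * (π * ρ ^ 3 / (2048 * D ^ 3) * (r * dist y x)) = a * dist y x by rw [ha]; ring]
  refine (setLIntegral_mono' hcl.measurableSet hstep).trans ?_
  have hsymm : ∀ x y, g x y = g y x := fun x y => by simp only [hg, dist_comm]
  have e1 : ∫⁻ x, ∫⁻ y, q x * g x y ∂μ ∂μ ≤ (∫⁻ x, q x ∂μ) * G := by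
    rw [← lintegral_mul_const _ hqm]
    refine lintegral_mono fun x => ?_
    rw [lintegral_const_mul _ (hgm.of_uncurry_left)]
    exact mul_le_mul_right (hgi x) _
  have e2 : ∫⁻ x, ∫⁻ y, q y * g x y ∂μ ∂μ = ∫⁻ x, ∫⁻ y, q x * g x y ∂μ ∂μ := by
    rw [lintegral_lintegral_swap]
    · simp_rw [fun x y => hsymm y x]
    · exact ((hqm.comp measurable_snd).mul hgm).aemeasurable
  have e3 : ∀ x, ∫⁻ y, (q x * g x y + q y * g x y) ∂μ =
      ∫⁻ y, q x * g x y ∂μ + ∫⁻ y, q y * g x y ∂μ := fun x =>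
    lintegral_add_left (hgm.of_uncurry_left.const_mul _) _
  calc ∫⁻ x, ∫⁻ y, (q x * g x y + q y * g x y) ∂μ ∂μ
      = (∫⁻ x, ∫⁻ y, q x * g x y ∂μ ∂μ) + ∫⁻ x, ∫⁻ y, q y * g x y ∂μ ∂μ := by
        simp_rw [e3]
        refine lintegral_add_left ?_ _
        exact ((hqm.comp measurable_fst).mul hgm).lintegral_prod_right'
    _ ≤ 2 * (∫⁻ x, q x ∂μ) * G := by
        rw [e2, ← two_mul, mul_assoc]
        exact mul_le_mul_right e1 _

end Pairs

section Assembly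

variable {k : ℕ} {Ω : Set Plane}

lemma lowBound_le_ofReal {L r : ℝ} {M : ℕ} (hr : 0 ≤ r) (hL : 1 ≤ L)
    (hLr : π * (M + 3) * r ^ 2 = L) (hr1 : π * r ^ 2 ≤ 1) (y : Plane) :
    lowBound (volume.restrict Ω) r (max 1 L)⁻¹ k M y ≤ ENNReal.ofReal (exp 4 * (L ^ k *
      exp (-((M + 3) * (volume.restrict Ω).real (closedBall y r))))) := by
  have hv := restrict_real_closedBall_le Ω y hr
  set v := (volume.restrict Ω).real (closedBall y r) with hvd
  have hv0 : 0 ≤ v := measureReal_nonneg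
  have hL0 : 0 < L := by linarith
  rw [lowBound, max_eq_right hL, ← hvd]
  refine ENNReal.ofReal_le_ofReal ?_
  rw [inv_pow, inv_inv, mul_left_comm, ← exp_add]
  gcongr
  have h1 : (M + 3) * v * L⁻¹ ≤ 1 := by
    rw [← div_eq_mul_inv, div_le_one hL0, ← hLr]
    calc (M + 3 : ℝ) * v ≤ (M + 3) * (π * r ^ 2) := by gcongr
      _ = _ := by ring
  have h2 : 0 ≤ v * L⁻¹ := by positivity
  linarith [hv.trans hr1]

lemma exp_neg_mul_pow_le_poissonTail {κ L a : ℝ} (hκ : 0 < κ) (hL : 0 ≤ L) (ha : κ * L ≤ a) :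
    L ^ k * exp (-a) ≤ k.factorial / κ ^ k * poissonTail k a := by
  have ha0 : 0 ≤ a := (by positivity : 0 ≤ κ * L).trans ha
  have h1 := exp_mul_pow_le_poissonTail k ha0
  have h2 : (κ * L) ^ k ≤ a ^ k := by gcongr
  rw [mul_pow] at h2
  calc L ^ k * exp (-a) = k.factorial / κ ^ k * (exp (-a) * ((κ ^ k * L ^ k) / k.factorial)) := by
        field_simp
    _ ≤ k.factorial / κ ^ k * (exp (-a) * (a ^ k / k.factorial)) := by gcongr
    _ ≤ _ := by gcongr

variable (ξ : ℝ)

lemma eventually_critMean_ge (k : ℕ) : ∀ᶠ M : ℕ in atTop, 1 ≤ critMean k ξ (M + 3) ∧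
    0 < critRadius k ξ (M + 3) ∧
    π * (M + 3) * critRadius k ξ (M + 3) ^ 2 = critMean k ξ (M + 3) ∧
    π * critRadius k ξ (M + 3) ^ 2 ≤ 1 := by
  filter_upwards [tendsto_natCast_add_three.eventually (eventually_critRadius_pos ξ k),
    tendsto_natCast_add_three.eventually ((tendsto_critMean k ξ).eventually_ge_atTop 1),
    tendsto_natCast_add_three.eventually
      ((tendsto_pi_mul_critRadius_sq ξ k).eventually_le_const one_pos)] with M ⟨hx, hL, hr⟩ hL1 hr1
  exact ⟨hL1, hr, critRadius_sq ξ hx hL.le, hr1⟩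

/-- The area of `Ω` in balls centred in `Ω` is comparable to that of the full balls. -/
lemma exists_eventually_le_mul_real_closedBall (k : ℕ) (hconv : Convex ℝ Ω) (hcomp : IsCompact Ω)
    (hint : (interior Ω).Nonempty) : ∃ κ : ℝ, 0 < κ ∧ ∀ᶠ M : ℕ in atTop, ∀ y ∈ Ω,
      κ * critMean k ξ (M + 3) ≤
        (M + 3) * (volume.restrict Ω).real (closedBall y (critRadius k ξ (M + 3))) := by
  obtain ⟨x₀, hx₀⟩ := hint
  obtain ⟨ρ, hρ, hball⟩ := nhds_basis_closedBall.mem_iff.1 (mem_interior_iff_mem_nhds.1 hx₀)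
  obtain ⟨D, hρD, hD⟩ := hcomp.isBounded.subset_closedBall_lt ρ x₀
  have hD0 : 0 < D := hρ.trans hρD
  refine ⟨ρ ^ 2 / (4 * D ^ 2), by positivity, ?_⟩
  filter_upwards [eventually_critMean_ge ξ k, tendsto_natCast_add_three.eventually
    ((tendsto_critRadius ξ k).eventually_le_const hD0)] with M ⟨hL1, hr, hLr, hr1⟩ hrD y hy
  have h := le_volume_real_closedBall_inter hconv hρ hball hD hρD.le hy hr hrD
  rw [measureReal_restrict_apply measurableSet_closedBall, ← hLr]
  calc _ = (M + 3) * (π * ρ ^ 2 / (4 * D ^ 2) * critRadius k ξ (M + 3) ^ 2) := by ring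
    _ ≤ _ := by gcongr

lemma exists_eventually_lintegral_lowBound_le (hk : 1 ≤ k) (hconv : Convex ℝ Ω)
    (hcomp : IsCompact Ω) (hint : (interior Ω).Nonempty) (hvol : volume Ω = 1) :
    ∃ K : ℝ≥0∞, K ≠ ∞ ∧ ∀ᶠ M : ℕ in atTop, (M + 3) * ∫⁻ y in Ω,
      lowBound (volume.restrict Ω) (critRadius k ξ (M + 3)) (max 1 (critMean k ξ (M + 3)))⁻¹ k M y ≤
        K := by
  obtain ⟨κ, hκ, hv⟩ := exists_eventually_le_mul_real_closedBall ξ k hconv hcomp hint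
  have hmain := (tendsto_lintegral_poissonTail_volume ξ hk hconv hcomp hint hvol).comp
    tendsto_natCast_add_three
  set c := exp 4 * (k.factorial / κ ^ k) with hc
  have h := ENNReal.Tendsto.const_mul (a := ENNReal.ofReal c) hmain (.inr ENNReal.ofReal_ne_top)
  obtain ⟨T, hT, h⟩ : ∃ T : ℝ≥0∞, T ≠ ∞ ∧ Tendsto _ atTop (𝓝 T) :=
    ⟨_, ENNReal.mul_ne_top ENNReal.ofReal_ne_top ENNReal.ofReal_ne_top, h⟩
  refine ⟨T + 1, ENNReal.add_ne_top.2 ⟨hT, ENNReal.one_ne_top⟩, ?_⟩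
  filter_upwards [hv, eventually_critMean_ge ξ k, h.eventually_le_const
    (ENNReal.lt_add_right hT one_ne_zero)] with M hvM ⟨hL1, hr, hLr, hr1⟩ hM
  refine le_trans ?_ hM
  rw [Function.comp_apply, mul_left_comm, natCast_add_three_eq_ofReal]
  refine mul_le_mul_right ?_ _
  rw [← lintegral_const_mul' _ _ ENNReal.ofReal_ne_top]
  refine setLIntegral_mono' hcomp.isClosed.measurableSet fun y hy => ?_
  refine (lowBound_le_ofReal hr.le hL1 hLr hr1 y).trans ?_
  rw [← ENNReal.ofReal_mul (by positivity)]
  refine ENNReal.ofReal_le_ofReal ?_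
  rw [hc, mul_assoc]
  exact mul_le_mul_of_nonneg_left
    (exp_neg_mul_pow_le_poissonTail hκ (zero_le_one.trans hL1) (hvM y hy)) (exp_pos _).le

lemma tendsto_iSup_lintegral_lowBound (k : ℕ) (hconv : Convex ℝ Ω)
    (hcomp : IsCompact Ω) (hint : (interior Ω).Nonempty) :
    Tendsto (fun M : ℕ => (M + 3) * ⨆ x, ∫⁻ y in closedBall x (2 * critRadius k ξ (M + 3)),
      lowBound (volume.restrict Ω) (critRadius k ξ (M + 3)) (max 1 (critMean k ξ (M + 3)))⁻¹ k M y
        ∂(volume.restrict Ω)) atTop (𝓝 0) := by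
  obtain ⟨κ, hκ, hv⟩ := exists_eventually_le_mul_real_closedBall ξ k hconv hcomp hint
  have hlim : Tendsto (fun L => ENNReal.ofReal (4 * exp 4 * (L ^ (k + 1) * exp (-κ * L)))) atTop
      (𝓝 0) := by
    have h := tendsto_rpow_mul_exp_neg_mul_atTop_nhds_zero (k + 1 : ℕ) κ hκ
    simp_rw [rpow_natCast] at h
    simpa using ENNReal.tendsto_ofReal (h.const_mul (4 * exp 4))
  refine tendsto_of_tendsto_of_tendsto_of_le_of_le' tendsto_const_nhds
    (hlim.comp ((tendsto_critMean k ξ).comp tendsto_natCast_add_three))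
    (.of_forall fun _ => zero_le) ?_
  filter_upwards [hv, eventually_critMean_ge ξ k] with M hvM ⟨hL1, hr, hLr, hr1⟩
  set r := critRadius k ξ (M + 3) with hrd
  simp only [Function.comp_apply]
  set L := critMean k ξ (M + 3) with hLd
  rw [ENNReal.mul_iSup]
  refine iSup_le fun x => ?_
  have hpt : ∀ y ∈ closedBall x (2 * r) ∩ Ω, lowBound (volume.restrict Ω) r (max 1 L)⁻¹ k M y ≤
      ENNReal.ofReal (exp 4 * (L ^ k * exp (-κ * L))) := fun y hy => by
    refine (lowBound_le_ofReal hr.le hL1 hLr hr1 y).trans (ENNReal.ofReal_le_ofReal ?_)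
    gcongr
    linarith [hvM y hy.2]
  rw [Measure.restrict_restrict measurableSet_closedBall]
  refine (mul_le_mul_right ((setLIntegral_mono' (measurableSet_closedBall.inter
    hcomp.isClosed.measurableSet) hpt).trans_eq (setLIntegral_const _ _)) _).trans ?_
  have hvb : volume (closedBall x (2 * r) ∩ Ω) ≤ ENNReal.ofReal (π * (2 * r) ^ 2) := by
    rw [← volume_real_closedBall x (by positivity), ofReal_measureReal measure_closedBall_lt_top.ne]
    exact measure_mono Set.inter_subset_left
  refine (mul_le_mul_right (mul_le_mul_right hvb _) _).trans ?_
  rw [natCast_add_three_eq_ofReal, ← ENNReal.ofReal_mul (by positivity),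
    ← ENNReal.ofReal_mul (by positivity)]
  refine ENNReal.ofReal_le_ofReal (le_of_eq ?_)
  rw [pow_succ L k]
  nth_rewrite 4 [← hLr]
  ring

lemma tendsto_lintegral_pair (hk : 1 ≤ k) (hconv : Convex ℝ Ω) (hcomp : IsCompact Ω)
    (hint : (interior Ω).Nonempty) (hvol : volume Ω = 1) :
    Tendsto (fun M : ℕ => (M + 3) ^ 2 * ∫⁻ x in Ω,
      ∫⁻ y in closedBall x (2 * critRadius k ξ (M + 3)), iidLaw (volume.restrict Ω) (M + 1)
        {X | hits (closedBall x (critRadius k ξ (M + 3))) X ≤ k ∧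
          hits (closedBall y (critRadius k ξ (M + 3))) X ≤ k} ∂(volume.restrict Ω)) atTop
              (𝓝 0) := by
  have hprob : IsProbabilityMeasure (volume.restrict Ω) := ⟨by simp [hvol]⟩
  obtain ⟨K, hK, hQ⟩ := exists_eventually_lintegral_lowBound_le ξ hk hconv hcomp hint hvol
  obtain ⟨x₀, hx₀⟩ := hint
  obtain ⟨ρ, hρ, hball⟩ := nhds_basis_closedBall.mem_iff.1 (mem_interior_iff_mem_nhds.1 hx₀)
  obtain ⟨D, hρD, hD⟩ := hcomp.isBounded.subset_closedBall_lt ρ x₀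
  have hD0 : 0 < D := hρ.trans hρD
  set γ := π * ρ ^ 3 / (2048 * D ^ 3) with hγ
  have hγ0 : 0 < γ := by positivity
  set C : ℝ≥0∞ := 2 * K * (ENNReal.ofReal (2 ^ k) * ∫⁻ w : Plane, ENNReal.ofReal (exp (-‖w‖)))
    with hC
  have hCtop : C ≠ ∞ := ENNReal.mul_ne_top (ENNReal.mul_ne_top ENNReal.ofNat_ne_top hK)
    (ENNReal.mul_ne_top ENNReal.ofReal_ne_top lintegral_exp_neg_norm_ne_top)
  have hlim : Tendsto (fun L => C * ENNReal.ofReal (16 * π / γ ^ 2 / L)) atTop (𝓝 0) := by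
    have h := ENNReal.tendsto_ofReal (tendsto_id.const_div_atTop (16 * π / γ ^ 2))
    simpa using ENNReal.Tendsto.const_mul h (.inr hCtop)
  refine tendsto_of_tendsto_of_tendsto_of_le_of_le' tendsto_const_nhds
    (hlim.comp ((tendsto_critMean k ξ).comp tendsto_natCast_add_three))
    (.of_forall fun _ => zero_le) ?_
  filter_upwards [hQ, eventually_critMean_ge ξ k, tendsto_natCast_add_three.eventually
    ((tendsto_critRadius ξ k).eventually_le_const (by positivity : 0 < ρ / 8)),
    eventually_ge_atTop 3] with M hQM ⟨hL1, hr, hLr, hr1⟩ hrρ hM3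
  set r := critRadius k ξ (M + 3) with hrd
  simp only [Function.comp_apply]
  set L := critMean k ξ (M + 3) with hLd
  have hM : (3 : ℝ) ≤ M := by exact_mod_cast hM3
  have h := lintegral_pair_le (k := k) hconv hcomp.isClosed hρ hρD.le hball hD hr hrρ
    (by positivity : 0 < (max 1 L)⁻¹) (inv_le_one_of_one_le₀ (le_max_left _ _))
    (by omega : 0 < M)
  refine (mul_le_mul_right h _).trans ?_
  set q := ∫⁻ x in Ω, lowBound (volume.restrict Ω) r (max 1 L)⁻¹ k M x with hq
  set I := ∫⁻ w : Plane, ENNReal.ofReal (exp (-‖w‖)) with hI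
  have hr2 : ENNReal.ofReal (M + 3) * ENNReal.ofReal ((M / 2 * γ * r) ^ 2)⁻¹ ≤
      ENNReal.ofReal (16 * π / γ ^ 2 / L) := by
    rw [← ENNReal.ofReal_mul (by positivity)]
    refine ENNReal.ofReal_le_ofReal ?_
    calc ((M : ℝ) + 3) * ((M / 2 * γ * r) ^ 2)⁻¹
        ≤ (M + 3) * (((M + 3) / 2 / 2 * γ * r) ^ 2)⁻¹ := by
          gcongr
          linarith
      _ = 16 * π / γ ^ 2 / L := by
          rw [← hLr]
          field_simp
          norm_num
  calc (M + 3 : ℝ≥0∞) ^ 2 * (2 * q * (ENNReal.ofReal (2 ^ k) *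
        (ENNReal.ofReal ((M / 2 * γ * r) ^ 2)⁻¹ * I)))
      = 2 * ((M + 3) * q) * (ENNReal.ofReal (2 ^ k) * I) *
        ((M + 3) * ENNReal.ofReal ((M / 2 * γ * r) ^ 2)⁻¹) := by ring
    _ ≤ 2 * K * (ENNReal.ofReal (2 ^ k) * I) * ENNReal.ofReal (16 * π / γ ^ 2 / L) := by
        gcongr
        rw [natCast_add_three_eq_ofReal]
        exact hr2

/-- The number of points with at most `k` neighbours at the critical radius is asymptotically
Poisson at zero. -/
theorem tendsto_iidLaw_lowCount_critRadius (hk : 1 ≤ k) (hconv : Convex ℝ Ω) (hcomp : IsCompact Ω)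
    (hint : (interior Ω).Nonempty) (hvol : volume Ω = 1) :
    Tendsto (fun M : ℕ => (iidLaw (volume.restrict Ω) (M + 3)).real
        {X | lowCount (critRadius k ξ (M + 3)) k X = 0}) atTop
      (𝓝 (exp (-((μH[1] (frontier Ω)).toReal *
        (√π * exp (-(ξ / 2)) / (2 ^ (k + 1) * k.factorial)) +
          if k = 1 then exp (-ξ) else 0)))) := by
  have hprob : IsProbabilityMeasure (volume.restrict Ω) := ⟨by simp [hvol]⟩
  obtain ⟨K, hK, hQ⟩ := exists_eventually_lintegral_lowBound_le ξ hk hconv hcomp hint hvol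
  refine tendsto_iidLaw_lowCount_eq_zero (volume.restrict Ω) k
    (r := fun M => critRadius k ξ (M + 3)) (s := fun M => (max 1 (critMean k ξ (M + 3)))⁻¹)
    (V := fun M => ENNReal.ofReal (π * critRadius k ξ (M + 3) ^ 2))
    (fun M => sqrt_nonneg _) (fun M => by positivity)
    (fun M => inv_le_one_of_one_le₀ (le_max_left _ _)) (by positivity) hK (fun M y => ?_)
    (fun M x => le_iSup (fun x => ∫⁻ y in closedBall x (2 * critRadius k ξ (M + 3)),
      lowBound (volume.restrict Ω) (critRadius k ξ (M + 3)) (max 1 (critMean k ξ (M + 3)))⁻¹ k M y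
        ∂(volume.restrict Ω)) x)
    (tendsto_lintegral_iidLaw_hits ξ hk hconv hcomp hint hvol) hQ ?_ ?_
    (tendsto_iSup_lintegral_lowBound ξ k hconv hcomp hint)
    (tendsto_lintegral_pair ξ hk hconv hcomp hint hvol)
  · rw [← ofReal_measureReal]
    exact ENNReal.ofReal_le_ofReal (restrict_real_closedBall_le Ω y (sqrt_nonneg _))
  · have h := ENNReal.tendsto_ofReal ((tendsto_mul_critRadius_sq_sq ξ k).comp
      tendsto_natCast_add_three)
    rw [ENNReal.ofReal_zero] at h
    refine h.congr fun M => ?_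
    rw [natCast_add_three_eq_ofReal, ← ENNReal.ofReal_pow (by positivity),
      ← ENNReal.ofReal_mul (by positivity), Function.comp_apply]
  · have h := ENNReal.tendsto_ofReal ((tendsto_pi_mul_critRadius_sq ξ k).comp
      tendsto_natCast_add_three)
    rwa [ENNReal.ofReal_zero] at h

end Assembly

lemma lowCount_eq_zero_iff {F : Type*} [PseudoMetricSpace F] {r : ℝ} (hr : 0 ≤ r) (k : ℕ) {n : ℕ}
    (X : Fin n → F) : lowCount r k X = 0 ↔
      ∀ i, k + 1 ≤ {j : Fin n | j ≠ i ∧ dist (X i) (X j) ≤ r}.ncard := by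
  classical
  have h (i : Fin n) : hits (closedBall (X i) r) X =
      {j : Fin n | j ≠ i ∧ dist (X i) (X j) ≤ r}.ncard + 1 := by
    have hset : {j : Fin n | j ≠ i ∧ dist (X i) (X j) ≤ r} =
        ↑(({j | dist (X j) (X i) ≤ r} : Finset (Fin n)).erase i) := by
      ext j
      simp [dist_comm, and_comm]
    rw [hset, Set.ncard_coe_finset, Finset.card_erase_add_one (by simpa using hr),
      Finset.card_filter]
    simp [hits, Set.indicator_apply]
  simp [lowCount, h]

/-- The limiting mean for the critical value of `ξ`. -/
lemma mean_eq_exp_neg_of_critical {ℓ c ξ : ℝ} (hℓ : 0 < ℓ) {k : ℕ} (hk : 1 ≤ k)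
    (hξ1 : k = 1 → ξ = -2 * log (√(exp (-c) + π * ℓ ^ 2 / 64) - ℓ * √π / 8))
    (hξ2 : 1 < k → ξ = 2 * log (ℓ * √π / (2 ^ (k + 1) * (k.factorial : ℝ))) + 2 * c) :
    ℓ * (√π * exp (-(ξ / 2)) / (2 ^ (k + 1) * k.factorial)) +
      (if k = 1 then exp (-ξ) else 0) = exp (-c) := by
  rcases hk.eq_or_lt with rfl | hk
  · have hs : ℓ * √π / 8 < √(exp (-c) + π * ℓ ^ 2 / 64) := by
      refine lt_sqrt_of_sq_lt ?_
      rw [div_pow, mul_pow, sq_sqrt pi_pos.le]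
      linarith [exp_pos (-c)]
    have hy : exp (-(ξ / 2)) = √(exp (-c) + π * ℓ ^ 2 / 64) - ℓ * √π / 8 := by
      rw [hξ1 rfl, ← exp_log (sub_pos.2 hs)]
      congr 1
      rw [exp_log (sub_pos.2 hs)]
      ring
    have hy2 : exp (-ξ) = exp (-(ξ / 2)) ^ 2 := by
      rw [← exp_nat_mul]
      congr 1
      push_cast
      ring
    have hsq := sq_sqrt (by positivity : 0 ≤ exp (-c) + π * ℓ ^ 2 / 64)
    have hpi := sq_sqrt pi_pos.le
    rw [if_pos rfl, hy2, hy, Nat.factorial_one, Nat.cast_one]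
    linear_combination hsq - ℓ ^ 2 / 64 * hpi
  · have hA : 0 < ℓ * √π / (2 ^ (k + 1) * (k.factorial : ℝ)) := by positivity
    have hy : exp (-(ξ / 2)) = (ℓ * √π / (2 ^ (k + 1) * (k.factorial : ℝ)))⁻¹ * exp (-c) := by
      rw [← exp_log hA, ← exp_neg, ← exp_add, hξ2 hk]
      congr 1
      ring
    rw [if_neg hk.ne', hy, add_zero]
    field_simp

theorem min_degree_critical_radius_2d
    (Ω : Set (EuclideanSpace ℝ (Fin 2)))
    (hconv : Convex ℝ Ω) (hcomp : IsCompact Ω) (hint : (interior Ω).Nonempty)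
    (hvol : volume Ω = 1)
    (ℓ : ℝ) (hℓ : ℓ = (μH[1] (frontier Ω)).toReal)
    (k : ℕ) (hk : 1 ≤ k) (c : ℝ) (hc : 0 < c) (ξ : ℝ)
    (hξ1 : k = 1 → ξ = -2 * Real.log
        (Real.sqrt (Real.exp (-c) + π * ℓ ^ 2 / 64) - ℓ * Real.sqrt π / 8))
    (hξ2 : 1 < k → ξ = 2 * Real.log
        (ℓ * Real.sqrt π / (2 ^ (k + 1) * (k.factorial : ℝ))) + 2 * c)
    (r : ℕ → ℝ)
    (hr : ∀ n : ℕ, r n = Real.sqrt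
        ((Real.log n + (2 * (k : ℝ) - 1) * Real.log (Real.log n) + ξ) / (π * n))) :
    Tendsto (fun n : ℕ =>
        ((Measure.pi fun _ : Fin n => volume.restrict Ω)
          {X : Fin n → EuclideanSpace ℝ (Fin 2) |
            ∀ i : Fin n,
              k + 1 ≤ {j : Fin n | j ≠ i ∧ dist (X i) (X j) ≤ r n}.ncard}).toReal)
      atTop (𝓝 (Real.exp (-Real.exp (-c)))) := by
  have hℓ0 : 0 < ℓ := hℓ ▸ toReal_hausdorffMeasure_frontier_pos hconv hcomp hint
  rw [← mean_eq_exp_neg_of_critical hℓ0 hk hξ1 hξ2, ← tendsto_add_atTop_iff_nat 3, hℓ]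
  refine (tendsto_iidLaw_lowCount_critRadius ξ hk hconv hcomp hint hvol).congr fun M => ?_
  have hrM : r (M + 3) = critRadius k ξ (M + 3) := by
    rw [hr, critRadius, critMean]
    push_cast
    rfl
  simp_rw [← hrM, lowCount_eq_zero_iff (hrM ▸ sqrt_nonneg _ : 0 ≤ r (M + 3))]
  rfl
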